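/- arXiv:1105.0127 — 2 statements merged into one kernel-verified Lean document; each statement's English description precedes it below -/
import Mathlib

section
/- The ideal I is a prime ideal of R; equivalently, the homogeneous coordinate ring A = R/I of the space X of eleven-dimensional gravitational spinors is an integral domain (so the scheme X = Proj A is reduced and irreducible). -/
set_option synthInstance.maxHeartbeats 1000000
set_option maxHeartbeats 2000000

noncomputable section

/-- The polynomial ring `R` over `ℂ` in the 32 variables `λ_S`, `S ⊆ {1,…,5}`. -/
abbrev R32 : Type := MvPolynomial (Finset (Fin 5)) ℂ

/-- The exterior algebra `Λ(V) ⊗ R` of `V = ℂ⁵` with polynomial coefficients. -/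
abbrev Ext5 : Type := ExteriorAlgebra R32 (Fin 5 → R32)

/-- The basis wedge monomial `e_S = e_{s₁} ∧ ⋯ ∧ e_{s_k}` for `S = {s₁ < ⋯ < s_k}`. -/
def eS (S : Finset (Fin 5)) : Ext5 :=
  ((S.sort (· ≤ ·)).map fun s => ExteriorAlgebra.ι R32 (Pi.single s 1)).prod

/-- The degree-`k` component `λ_k = Σ_{|S| = k} λ_S e_S` of the generic spinor. -/
def lamb (k : ℕ) : Ext5 :=
  ∑ S ∈ Finset.univ.filter (fun S : Finset (Fin 5) => S.card = k),
    (MvPolynomial.X S : R32) • eS S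

/-- Contraction `ι_r` with the `r`-th dual basis vector. -/
def ctr (r : Fin 5) : Ext5 →ₗ[R32] Ext5 :=
  CliffordAlgebra.contractLeft (Q := (0 : QuadraticForm R32 (Fin 5 → R32))) (LinearMap.proj r)

/-- Equation (E1): `λ₀λ₅ + λ₁∧λ₄ − λ₂∧λ₃ = 0` in `Λ⁵V`. -/
def E1 : Ext5 := (MvPolynomial.X ∅ : R32) • lamb 5 + lamb 1 * lamb 4 - lamb 2 * lamb 3

/-- Equation (E2): `−2λ₀λ₄ − 2λ₁∧λ₃ + λ₂∧λ₂ = 0` in `Λ⁴V`. -/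
def E2 : Ext5 :=
  -(2 • ((MvPolynomial.X ∅ : R32) • lamb 4)) - 2 • (lamb 1 * lamb 3) + lamb 2 * lamb 2

/-- Equation (E3): `−2ι_r(λ₁)λ₅ + 2ι_r(λ₂)∧λ₄ + ι_r(λ₃)∧λ₃ = 0` in `Λ⁵V`, `r = 1,…,5`. -/
def E3 (r : Fin 5) : Ext5 :=
  -(2 • (ctr r (lamb 1) * lamb 5)) + 2 • (ctr r (lamb 2) * lamb 4) + ctr r (lamb 3) * lamb 3

/-- The ideal `I ⊆ R` generated by the 11 coefficients of the expressions (E1), (E2), (E3):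
equivalently, the smallest ideal `J` such that each of the expressions lies in the submodule
`J • Λ(V)` of the (free) `R`-module `Λ(V) ⊗ R`. -/
def Igrav : Ideal R32 :=
  sInf {J : Ideal R32 |
    E1 ∈ J • (⊤ : Submodule R32 Ext5) ∧ E2 ∈ J • (⊤ : Submodule R32 Ext5) ∧
    ∀ r : Fin 5, E3 r ∈ J • (⊤ : Submodule R32 Ext5)}

set_option linter.all false
set_option linter.unusedSimpArgs false


/-! ## Reduction of polynomials whose monomials are coded by natural numbers -/

namespace Grav

/-- A rewriting rule `l ⟶ ∑ c • a` between coded monomials. -/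
abbrev Rule : Type := ℕ × List (ℕ × ℤ)

/-! The following variants, in continuation passing style, compute the same functions but make
the evaluation strict. -/

/-- Evaluate a natural number, then continue. -/
def fN {α : Type} (n : ℕ) (K : ℕ → α) : α :=
  match n with
  | 0 => K 0
  | m + 1 => K (m + 1)

lemma fN_eq {α : Type} (n : ℕ) (K : ℕ → α) : fN n K = K n := by cases n <;> rfl

/-- Evaluate an integer, then continue. -/
def fI {α : Type} (n : ℤ) (K : ℤ → α) : α :=
  match n with
  | Int.ofNat m => fN m fun x => K (Int.ofNat x)
  | Int.negSucc m => fN m fun x => K (Int.negSucc x)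

lemma fI_eq {α : Type} (n : ℤ) (K : ℤ → α) : fI n K = K n := by
  cases n <;> simp [fI, fN_eq]

/-- Merge `c * v * t` with `p` (strict, in continuation passing style). -/
def mrgK {α : Type} (v : ℕ) (c : ℤ) (t : List (ℕ × ℤ)) :
    List (ℕ × ℤ) → (List (ℕ × ℤ) → α) → α :=
  List.rec (motive := fun _ => List (ℕ × ℤ) → (List (ℕ × ℤ) → α) → α)
    (fun p K => K p)
    (fun ae _ ih p => fN (v * ae.1) fun x => fI (c * ae.2) fun y =>
      List.rec (motive := fun _ => (List (ℕ × ℤ) → α) → α)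
        (fun K => ih [] fun q => K ((x, y) :: q))
        (fun md p' ihp K =>
          bif Nat.blt x md.1 then ihp fun q => K (md :: q)
          else bif Nat.beq x md.1 then
            ih p' fun q => fI (y + md.2) fun z =>
              bif Nat.beq z.natAbs 0 then K q else K ((x, z) :: q)
          else ih (md :: p') fun q => K ((x, y) :: q))
        p) t

/-- Merge `c * v * t` with `p`. -/
def addS (v : ℕ) (c : ℤ) (t p : List (ℕ × ℤ)) : List (ℕ × ℤ) := mrgK v c t p id

/-- First rule applicable to a monomial. -/
def fnd (n : ℕ) : List Rule → Option Rule
  | [] => none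
  | r :: rs => bif Nat.beq (n % r.1) 0 then some r else fnd n rs

/-- Does the polynomial reduce to zero? -/
def redZ (rules : List Rule) : ℕ → List (ℕ × ℤ) → Bool
  | _, [] => true
  | 0, _ :: _ => false
  | k + 1, (n, c) :: p =>
    match fnd n rules with
    | none => false
    | some r => fN (n / r.1) fun v => mrgK v c r.2 p fun q => redZ rules k q

/-- Check a critical pair. -/
def pairOK (rules : List Rule) (fuel : ℕ) (r s : Rule) : Bool :=
  bif Nat.beq (Nat.gcd r.1 s.1) 1 then true
  else
    fN (s.1 / Nat.gcd r.1 s.1) fun v => fN (r.1 / Nat.gcd r.1 s.1) fun w =>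
      mrgK w (-1) s.2 [] fun q => mrgK v 1 r.2 q fun qq => redZ rules fuel qq

/-- Each rule is decreasing, with nonzero monomials. -/
def ruleOK (r : Rule) : Bool := r.2.all fun t => Nat.blt t.1 r.1 && Nat.blt 0 t.1

/-- All critical pairs are resolvable. -/
def allOK (rules : List Rule) (fuel : ℕ) : Bool :=
  rules.all ruleOK && rules.all fun r => rules.all fun s => pairOK rules fuel r s

/-- Evaluation of a coded polynomial. -/
def ev {M : Type*} [AddCommGroup M] (Φ : ℕ → M) (u : ℕ) (p : List (ℕ × ℤ)) : M :=
  (p.map fun t => t.2 • Φ (u * t.1)).sum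

section
variable {M : Type*} [AddCommGroup M] (Φ : ℕ → M)

@[simp] lemma ev_nil (u : ℕ) : ev Φ u [] = 0 := rfl

@[simp] lemma ev_cons (u : ℕ) (t : ℕ × ℤ) (p : List (ℕ × ℤ)) :
    ev Φ u (t :: p) = t.2 • Φ (u * t.1) + ev Φ u p := by
  simp [ev]

end

/-- Specification of the merge. -/
lemma mrgK_spec (v : ℕ) (c : ℤ) (t p : List (ℕ × ℤ)) :
    ∃ q, (∀ (α : Type) (K : List (ℕ × ℤ) → α), mrgK v c t p K = K q) ∧
      (∀ (M : Type) [AddCommGroup M] (Φ : ℕ → M) (u : ℕ),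
        ev Φ u q = c • ev Φ (u * v) t + ev Φ u p) ∧
      ∀ x ∈ q, (∃ s ∈ t, v * s.1 = x.1) ∨ ∃ s ∈ p, s.1 = x.1 := by
  induction t generalizing p with
  | nil => exact ⟨p, fun _ _ => rfl, by simp, fun x hx => Or.inr ⟨x, hx, rfl⟩⟩
  | cons ae t ih =>
    have base : ∀ p, ∃ q, (∀ (α : Type) (K : List (ℕ × ℤ) → α),
        mrgK v c t p (fun q => K ((v * ae.1, c * ae.2) :: q)) = K q) ∧
      (∀ (M : Type) [AddCommGroup M] (Φ : ℕ → M) (u : ℕ),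
        ev Φ u q = c • ev Φ (u * v) (ae :: t) + ev Φ u p) ∧
      ∀ x ∈ q, (∃ s ∈ ae :: t, v * s.1 = x.1) ∨ ∃ s ∈ p, s.1 = x.1 := by
      intro p
      obtain ⟨q, h1, h2, h3⟩ := ih p
      refine ⟨(v * ae.1, c * ae.2) :: q, fun α K => h1 α _, ?_, ?_⟩
      · intro M _ Φ u
        rw [ev_cons, ev_cons, h2, smul_add, smul_smul, mul_assoc]
        abel
      · intro x hx
        rcases List.mem_cons.1 hx with rfl | hx
        · exact Or.inl ⟨ae, by simp, rfl⟩
        · rcases h3 x hx with ⟨s, hs, h⟩ | h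
          · exact Or.inl ⟨s, by simp [hs], h⟩
          · exact Or.inr h
    induction p with
    | nil =>
      obtain ⟨q, h1, h2, h3⟩ := base []
      refine ⟨q, fun α K => ?_, h2, h3⟩
      rw [← h1 α K]
      unfold mrgK
      simp only [fN_eq, fI_eq]
    | cons md p ihp =>
      have hun : ∀ (α : Type) (K : List (ℕ × ℤ) → α), mrgK v c (ae :: t) (md :: p) K =
          bif Nat.blt (v * ae.1) md.1 then mrgK v c (ae :: t) p fun q => K (md :: q)
          else bif Nat.beq (v * ae.1) md.1 then
            mrgK v c t p fun q => bif Nat.beq (c * ae.2 + md.2).natAbs 0 then K q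
              else K ((v * ae.1, c * ae.2 + md.2) :: q)
          else mrgK v c t (md :: p) fun q => K ((v * ae.1, c * ae.2) :: q) := by
        intro α K
        unfold mrgK
        simp only [fN_eq, fI_eq]
      cases hb : Nat.blt (v * ae.1) md.1
      · cases he : Nat.beq (v * ae.1) md.1
        · obtain ⟨q, h1, h2, h3⟩ := base (md :: p)
          refine ⟨q, fun α K => ?_, h2, h3⟩
          rw [hun, hb, he, ← h1 α K]
          rfl
        · have hm : v * ae.1 = md.1 := Nat.eq_of_beq_eq_true he
          obtain ⟨q, h1, h2, h3⟩ := ih p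
          have h3' : ∀ x ∈ q, (∃ s ∈ ae :: t, v * s.1 = x.1) ∨ ∃ s ∈ md :: p, s.1 = x.1 := by
            intro x hx
            rcases h3 x hx with ⟨s, hs, h⟩ | ⟨s, hs, h⟩
            · exact Or.inl ⟨s, by simp [hs], h⟩
            · exact Or.inr ⟨s, by simp [hs], h⟩
          cases hz : Nat.beq (c * ae.2 + md.2).natAbs 0
          · refine ⟨(v * ae.1, c * ae.2 + md.2) :: q, fun α K => ?_, ?_, ?_⟩
            · rw [hun, hb, he, hz, cond_false, cond_true, h1, cond_false]
            · intro M _ Φ u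
              rw [ev_cons, ev_cons, ev_cons, h2, smul_add, smul_smul, ← hm, mul_assoc]
              simp only [add_smul]
              abel
            · intro x hx
              rcases List.mem_cons.1 hx with rfl | hx
              · exact Or.inl ⟨ae, by simp, rfl⟩
              · exact h3' x hx
          · have hz' : c * ae.2 + md.2 = 0 := by
              simpa using Nat.eq_of_beq_eq_true hz
            refine ⟨q, fun α K => ?_, ?_, h3'⟩
            · rw [hun, hb, he, hz, cond_false, cond_true, h1, cond_true]
            · intro M _ Φ u
              have : (c * ae.2) • Φ (u * md.1) + md.2 • Φ (u * md.1) = 0 := by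
                rw [← add_smul, hz', zero_smul]
              rw [ev_cons, ev_cons, h2, smul_add, smul_smul, mul_assoc, hm,
                eq_neg_of_add_eq_zero_left this]
              abel
      · obtain ⟨q, h1, h2, h3⟩ := ihp
        refine ⟨md :: q, fun α K => ?_, ?_, ?_⟩
        · rw [hun, hb, cond_true, h1]
        · intro M _ Φ u
          rw [ev_cons, h2, ev_cons _ _ md]
          abel
        · intro x hx
          rcases List.mem_cons.1 hx with rfl | hx
          · exact Or.inr ⟨_, by simp, rfl⟩
          · rcases h3 x hx with h | ⟨s, hs, h⟩
            · exact Or.inl h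
            · exact Or.inr ⟨s, by simp [hs], h⟩

lemma addK_eq {α : Type} (v : ℕ) (c : ℤ) (t p : List (ℕ × ℤ)) (K : List (ℕ × ℤ) → α) :
    mrgK v c t p K = K (addS v c t p) := by
  obtain ⟨q, h1, -, -⟩ := mrgK_spec v c t p
  rw [addS, h1, h1]
  rfl

lemma ev_addS {M : Type} [AddCommGroup M] (Φ : ℕ → M) (u v : ℕ) (c : ℤ)
    (t p : List (ℕ × ℤ)) :
    ev Φ u (addS v c t p) = c • ev Φ (u * v) t + ev Φ u p := by
  obtain ⟨q, h1, h2, -⟩ := mrgK_spec v c t p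
  rw [addS, h1]
  exact h2 M Φ u

lemma mem_addS {v : ℕ} {c : ℤ} {t p : List (ℕ × ℤ)} {x : ℕ × ℤ} (h : x ∈ addS v c t p) :
    (∃ s ∈ t, v * s.1 = x.1) ∨ ∃ s ∈ p, s.1 = x.1 := by
  obtain ⟨q, h1, -, h3⟩ := mrgK_spec v c t p
  rw [addS, h1] at h
  exact h3 x h

lemma fnd_some {n : ℕ} {rules : List Rule} {r : Rule} (h : fnd n rules = some r) :
    r ∈ rules ∧ r.1 ∣ n := by
  induction rules with
  | nil => simp [fnd] at h
  | cons s rs ih =>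
    simp only [fnd] at h
    cases h1 : Nat.beq (n % s.1) 0
    · simp only [h1, cond_false] at h
      exact ⟨by simp [(ih h).1], (ih h).2⟩
    · simp only [h1, cond_true, Option.some.injEq] at h
      subst h
      exact ⟨by simp, Nat.dvd_of_mod_eq_zero (Nat.eq_of_beq_eq_true h1)⟩

lemma fnd_none {n : ℕ} {rules : List Rule} (h : fnd n rules = none) :
    ∀ r ∈ rules, ¬ r.1 ∣ n := by
  induction rules with
  | nil => simp
  | cons s rs ih =>
    simp only [fnd] at h
    cases h1 : Nat.beq (n % s.1) 0
    · simp only [h1, cond_false] at h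
      intro r hr hd
      rcases List.mem_cons.1 hr with rfl | hr
      · rw [Nat.mod_eq_zero_of_dvd hd] at h1
        simp at h1
      · exact ih h r hr hd
    · simp [h1] at h

/-- Rules decrease. -/
def Decr (rules : List Rule) : Prop := ∀ r ∈ rules, ∀ t ∈ r.2, t.1 < r.1 ∧ 0 < t.1

/-- Soundness of the reduction. -/
lemma redZ_sound {M : Type} [AddCommGroup M] (Φ : ℕ → M) (u B : ℕ) (rules : List Rule)
    (hd : Decr rules)
    (hΦ : ∀ r ∈ rules, ∀ v, 0 < v → v * r.1 < B → Φ (u * (v * r.1)) = ev Φ (u * v) r.2)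
    (k : ℕ) (p : List (ℕ × ℤ)) (hp : ∀ t ∈ p, 0 < t.1 ∧ t.1 < B) (h : redZ rules k p = true) :
    ev Φ u p = 0 := by
  induction k generalizing p with
  | zero =>
    cases p with
    | nil => rfl
    | cons t p => simp [redZ] at h
  | succ k ih =>
    cases p with
    | nil => rfl
    | cons t p =>
      obtain ⟨n, c⟩ := t
      simp only [redZ] at h
      cases hf : fnd n rules with
      | none => simp [hf] at h
      | some r =>
        simp only [hf, fN_eq, addK_eq] at h
        obtain ⟨hr, hdv⟩ := fnd_some hf
        obtain ⟨hn0, hnB⟩ := hp (n, c) (by simp)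
        simp only at hn0 hnB
        have hv : n / r.1 * r.1 = n := Nat.div_mul_cancel hdv
        have hv0 : 0 < n / r.1 := by
          rcases Nat.eq_zero_or_pos (n / r.1) with h0 | h0
          · rw [h0] at hv; omega
          · exact h0
        have := ih (addS (n / r.1) c r.2 p) (by
          intro t ht
          rcases mem_addS ht with ⟨s, hs, he⟩ | ⟨s, hs, he⟩
          · rw [← he]
            have := hd r hr s hs
            refine ⟨Nat.mul_pos hv0 this.2, lt_trans ?_ hnB⟩
            calc n / r.1 * s.1 < n / r.1 * r.1 := Nat.mul_lt_mul_of_pos_left this.1 hv0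
              _ = n := hv
          · rw [← he]
            exact hp s (by simp [hs])) h
        rw [ev_addS] at this
        rw [ev_cons, ← this]
        simp only
        rw [← hΦ r hr (n / r.1) hv0 (by rw [hv]; exact hnB), hv]

/-! ### Normal forms -/

/-- Normal form with fuel. -/
def NF (rules : List Rule) : ℕ → ℕ → (ℕ →₀ ℂ)
  | 0, _ => 0
  | k + 1, n =>
    match fnd n rules with
    | none => Finsupp.single n 1
    | some r => ev (NF rules k) (n / r.1) r.2

/-- Normal form. -/
def Nrm (rules : List Rule) (n : ℕ) : ℕ →₀ ℂ := NF rules (n + 1) n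

lemma ev_congr {M : Type*} [AddCommGroup M] {Φ Ψ : ℕ → M} {u v : ℕ} {p : List (ℕ × ℤ)}
    (h : ∀ t ∈ p, Φ (u * t.1) = Ψ (v * t.1)) : ev Φ u p = ev Ψ v p := by
  unfold ev
  congr 1
  apply List.map_congr_left
  intro t ht
  rw [h t ht]

lemma step_lt {rules : List Rule} (hd : Decr rules) {n : ℕ} (hn : 0 < n) {r : Rule}
    (hr : r ∈ rules) (hdv : r.1 ∣ n) {t : ℕ × ℤ} (ht : t ∈ r.2) :
    n / r.1 * t.1 < n ∧ 0 < n / r.1 * t.1 ∧ 0 < n / r.1 := by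
  have hv : n / r.1 * r.1 = n := Nat.div_mul_cancel hdv
  have hv0 : 0 < n / r.1 := by
    rcases Nat.eq_zero_or_pos (n / r.1) with h0 | h0
    · rw [h0] at hv; omega
    · exact h0
  have := hd r hr t ht
  refine ⟨?_, Nat.mul_pos hv0 this.2, hv0⟩
  calc n / r.1 * t.1 < n / r.1 * r.1 := Nat.mul_lt_mul_of_pos_left this.1 hv0
    _ = n := hv

lemma NF_fuel {rules : List Rule} (hd : Decr rules) (n : ℕ) :
    0 < n → ∀ k, n < k → NF rules k n = Nrm rules n := by
  induction n using Nat.strong_induction_on with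
  | _ n ih =>
    intro hn k hk
    obtain ⟨k, rfl⟩ : ∃ j, k = j + 1 := ⟨k - 1, by omega⟩
    unfold Nrm
    simp only [NF]
    cases hf : fnd n rules with
    | none => rfl
    | some r =>
      obtain ⟨hr, hdv⟩ := fnd_some hf
      apply ev_congr
      intro t ht
      obtain ⟨h1, h2, _⟩ := step_lt hd hn hr hdv ht
      rw [ih _ h1 h2 k (by omega), ih _ h1 h2 n h1]

lemma Nrm_std {rules : List Rule} {n : ℕ} (h : ∀ r ∈ rules, ¬ r.1 ∣ n) :
    Nrm rules n = Finsupp.single n 1 := by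
  unfold Nrm
  simp only [NF]
  cases hf : fnd n rules with
  | none => rfl
  | some r => exact absurd (fnd_some hf).2 (h r (fnd_some hf).1)

lemma Nrm_fnd {rules : List Rule} (hd : Decr rules) {n : ℕ} (hn : 0 < n) {r : Rule}
    (hf : fnd n rules = some r) : Nrm rules n = ev (Nrm rules) (n / r.1) r.2 := by
  obtain ⟨hr, hdv⟩ := fnd_some hf
  conv_lhs => unfold Nrm
  simp only [NF, hf]
  apply ev_congr
  intro t ht
  obtain ⟨h1, h2, _⟩ := step_lt hd hn hr hdv ht
  exact NF_fuel hd _ h2 _ h1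

lemma ev_apply_zero {Φ : ℕ → (ℕ →₀ ℂ)} {u K : ℕ} {p : List (ℕ × ℤ)}
    (h : ∀ t ∈ p, Φ (u * t.1) K = 0) : ev Φ u p K = 0 := by
  induction p with
  | nil => simp
  | cons t p ih =>
    rw [ev_cons, Finsupp.add_apply, ih (fun s hs => h s (by simp [hs])), Finsupp.smul_apply,
      h t (by simp)]
    simp

lemma Nrm_lt {rules : List Rule} (hd : Decr rules) (n K : ℕ) :
    0 < n → n < K → Nrm rules n K = 0 := by
  induction n using Nat.strong_induction_on with
  | _ n ih =>
    intro hn hK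
    cases hf : fnd n rules with
    | none =>
      rw [Nrm_std (fnd_none hf), Finsupp.single_apply, if_neg (by omega)]
    | some r =>
      obtain ⟨hr, hdv⟩ := fnd_some hf
      rw [Nrm_fnd hd hn hf]
      apply ev_apply_zero
      intro t ht
      obtain ⟨h1, h2, _⟩ := step_lt hd hn hr hdv ht
      exact ih _ h1 h2 (by omega)

lemma ev_swap {M : Type*} [AddCommGroup M] (Φ : ℕ → M) (u : ℕ) (p q : List (ℕ × ℤ)) :
    ev (fun n => ev Φ n q) u p = ev (fun n => ev Φ n p) u q := by
  induction p with
  | nil =>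
    simp only [ev_nil]
    induction q with
    | nil => rfl
    | cons t q ih => rw [ev_cons, ← ih]; simp
  | cons t p ih =>
    rw [ev_cons, ih]
    clear ih
    induction q with
    | nil => simp
    | cons s q ih =>
      rw [ev_cons _ _ s q, ev_cons _ _ s q, ev_cons _ _ s q, ← ih]
      simp only [ev_cons, smul_add]
      rw [smul_comm t.2 s.2, mul_right_comm u t.1 s.1]
      abel

/-- Buchberger criterion. -/
lemma Nrm_rule {rules : List Rule} {fuel : ℕ} (h : allOK rules fuel = true) :
    ∀ (n : ℕ), ∀ r ∈ rules, ∀ u, 0 < u → u * r.1 = n →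
      Nrm rules (u * r.1) = ev (Nrm rules) u r.2 := by
  simp only [allOK, Bool.and_eq_true, List.all_eq_true] at h
  obtain ⟨h1, h2⟩ := h
  have hd : Decr rules := by
    intro r hr t ht
    have := h1 r hr
    simp only [ruleOK, Bool.and_eq_true, List.all_eq_true, Nat.blt_eq] at this
    exact this t ht
  intro n
  induction n using Nat.strong_induction_on with
  | _ n ih =>
    intro r hr u hu hn
    rcases Nat.eq_zero_or_pos r.1 with h0 | h0
    · have hnil : r.2 = [] := by
        cases hh : r.2 with
        | nil => rfl
        | cons t p =>
          have := hd r hr t (by rw [hh]; simp)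
          omega
      have hall : ∀ s ∈ rules, s.1 ∣ 0 := fun s _ => dvd_zero _
      rw [h0, hnil, mul_zero, ev_nil]
      unfold Nrm
      simp only [NF]
      cases hf : fnd 0 rules with
      | none => exact absurd (dvd_zero _) (fnd_none hf r hr)
      | some s =>
        simp only
        apply Finsupp.ext
        intro K
        apply ev_apply_zero
        intro t ht
        rfl
    · have hn0 : 0 < n := by rw [← hn]; positivity
      cases hf : fnd n rules with
      | none => exact absurd (by rw [← hn]; exact dvd_mul_left _ _) (fnd_none hf r hr)
      | some s =>
        obtain ⟨hs, hsd⟩ := fnd_some hf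
        rw [hn, Nrm_fnd hd hn0 hf]
        have hs0 : 0 < s.1 := Nat.pos_of_dvd_of_pos hsd hn0
        set g := Nat.gcd s.1 r.1 with hg
        have hg0 : 0 < g := Nat.gcd_pos_of_pos_left _ hs0
        obtain ⟨s', hs'⟩ : g ∣ s.1 := Nat.gcd_dvd_left _ _
        obtain ⟨r', hr'⟩ : g ∣ r.1 := Nat.gcd_dvd_right _ _
        have hrd : s.1 / g = s' := by rw [hs', Nat.mul_div_cancel_left _ hg0]
        have hrd' : r.1 / g = r' := by rw [hr', Nat.mul_div_cancel_left _ hg0]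
        have hs'0 : 0 < s' := Nat.pos_of_ne_zero (by rintro rfl; omega)
        have hr'0 : 0 < r' := Nat.pos_of_ne_zero (by rintro rfl; omega)
        have hl : g * s' * r' ∣ n := by
          have : Nat.lcm s.1 r.1 ∣ n := Nat.lcm_dvd hsd (by rw [← hn]; exact dvd_mul_left _ _)
          have h3 : Nat.lcm s.1 r.1 = g * s' * r' := by
            unfold Nat.lcm
            rw [← hg, Nat.mul_div_assoc _ (Nat.gcd_dvd_right _ _), hrd', ← hs']
          rwa [h3] at this
        obtain ⟨w, hw⟩ := hl
        have hw0 : 0 < w := Nat.pos_of_ne_zero (by rintro rfl; omega)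
        have hu' : u = w * s' := by
          have : u * (g * r') = w * s' * (g * r') := by
            calc u * (g * r') = u * r.1 := by rw [hr']
              _ = w * s' * (g * r') := by rw [hn, hw]; ring
          exact Nat.eq_of_mul_eq_mul_right (by positivity) this
        have hv' : n / s.1 = w * r' := by
          apply Nat.div_eq_of_eq_mul_left hs0
          rw [hw, hs']; ring
        rw [hv', hu']
        have hpair := h2 s hs r hr
        simp only [pairOK, ← hg] at hpair
        cases hb : Nat.beq g 1
        · simp only [hb, cond_false, hrd, hrd', fN_eq, addK_eq] at hpair
          have key := redZ_sound (Nrm rules) w (g * s' * r') rules hd (by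
            intro q hq v hv0 hlt
            rw [← mul_assoc]
            refine ih (w * v * q.1) ?_ q hq (w * v) (by positivity) rfl
            rw [hw, mul_assoc, mul_comm (g * s' * r') w]
            exact Nat.mul_lt_mul_of_pos_left hlt hw0) fuel _ (by
              intro t ht
              rcases mem_addS ht with ⟨x, hx, he⟩ | ⟨x, hx, he⟩
              · rw [← he]
                obtain ⟨ha, hb⟩ := hd s hs x hx
                refine ⟨by positivity, ?_⟩
                rw [mul_comm (g * s') r', ← hs']
                exact Nat.mul_lt_mul_of_pos_left ha hr'0
              · rcases mem_addS hx with ⟨y, hy, he'⟩ | ⟨y, hy, he'⟩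
                · rw [← he, ← he']
                  obtain ⟨ha, hb⟩ := hd r hr y hy
                  refine ⟨by positivity, ?_⟩
                  rw [mul_comm g s', mul_assoc, ← hr']
                  exact Nat.mul_lt_mul_of_pos_left ha hs'0
                · simp at hy) hpair
          rw [ev_addS, ev_addS, ev_nil] at key
          simp only [one_smul, neg_smul, add_zero] at key
          rw [← sub_eq_add_neg, sub_eq_zero] at key
          exact key
        · have hg1 : g = 1 := Nat.eq_of_beq_eq_true hb
          rw [hg1, one_mul] at hs' hr'
          have e1 : ev (Nrm rules) (w * r') s.2
              = ev (fun n => ev (Nrm rules) n r.2) w s.2 := by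
            apply ev_congr
            intro t ht
            obtain ⟨ha, hb⟩ := hd s hs t ht
            rw [← hr', mul_right_comm w r.1 t.1]
            refine ih (w * t.1 * r.1) ?_ r hr (w * t.1) (by positivity) rfl
            rw [hw, hg1, one_mul, ← hs', ← hr', mul_assoc, mul_comm (s.1 * r.1) w]
            apply Nat.mul_lt_mul_of_pos_left _ hw0
            exact Nat.mul_lt_mul_of_pos_right ha h0
          have e2 : ev (Nrm rules) (w * s') r.2
              = ev (fun n => ev (Nrm rules) n s.2) w r.2 := by
            apply ev_congr
            intro t ht
            obtain ⟨ha, hb⟩ := hd r hr t ht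
            rw [← hs', mul_right_comm w s.1 t.1]
            refine ih (w * t.1 * s.1) ?_ s hs (w * t.1) (by positivity) rfl
            rw [hw, hg1, one_mul, ← hs', ← hr', mul_assoc, mul_comm (s.1 * r.1) w,
              mul_comm s.1 r.1]
            apply Nat.mul_lt_mul_of_pos_left _ hw0
            exact Nat.mul_lt_mul_of_pos_right ha hs0
          rw [e1, e2, ev_swap]

/-! ### The data -/

/-- A rule in terms of variables (numbered by bit masks). -/
abbrev RawRule : Type := List ℕ × List (List ℕ × ℤ)

/-- The primes attached to the variables. -/
def prm : List ℕ :=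
  [2, 3, 17, 47, 19, 37, 71, 113, 23, 101, 83, 89, 103, 97, 73, 11, 61, 107, 53, 109, 127, 59,
    79, 29, 131, 67, 43, 7, 31, 13, 5, 41]

/-- The prime with a given number. -/
def pr (i : ℕ) : ℕ := prm.getD i 2

/-- Code of a monomial. -/
def cod (l : List ℕ) : ℕ := (l.map pr).prod

/-- Code of a rule. -/
def codR (r : RawRule) : Rule := (cod r.1, r.2.map fun t => (cod t.1, t.2))

/-- The Groebner basis: the eleven quadrics followed by ten cubics. -/

def rawRules : List RawRule :=
  [([7, 24], [([11, 20], 1), ([12, 19], -1), ([9, 22], -1), ([14, 17], 1), ([13, 18], -1),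
      ([10, 21], 1), ([6, 25], -1), ([5, 26], 1), ([3, 28], -1), ([15, 16], 1), ([8, 23], -1),
      ([2, 29], -1), ([4, 27], 1), ([0, 31], 1), ([1, 30], 1)]),
   ([10, 20], [([6, 24], 1), ([12, 18], 1), ([14, 16], 1), ([8, 22], -1), ([4, 26], 1),
      ([2, 28], -1), ([0, 30], -1)]),
   ([9, 20], [([12, 17], 1), ([13, 16], 1), ([5, 24], 1), ([8, 21], -1), ([4, 25], 1),
      ([1, 28], -1), ([0, 29], -1)]),
   ([10, 17], [([3, 24], -1), ([11, 16], -1), ([9, 18], 1), ([8, 19], 1), ([2, 25], -1),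
      ([1, 26], 1), ([0, 27], 1)]),
   ([6, 17], [([7, 16], -1), ([3, 20], -1), ([4, 19], 1), ([5, 18], 1), ([2, 21], -1),
      ([1, 22], 1), ([0, 23], 1)]),
   ([6, 9], [([3, 12], -1), ([5, 10], 1), ([7, 8], -1), ([4, 11], 1), ([2, 13], -1),
      ([1, 14], 1), ([0, 15], 1)]),
   ([13, 19], [([7, 25], -1), ([11, 21], 1), ([9, 23], 1), ([15, 17], -1), ([3, 29], 1),
      ([5, 27], -1), ([1, 31], 1)]),
   ([14, 19], [([11, 22], 1), ([7, 26], -1), ([10, 23], 1), ([2, 31], 1), ([15, 18], -1),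
      ([6, 27], -1), ([3, 30], 1)]),
   ([13, 22], [([14, 21], 1), ([7, 28], 1), ([12, 23], -1), ([15, 20], 1), ([6, 29], 1),
      ([4, 31], -1), ([5, 30], -1)]),
   ([14, 25], [([13, 26], 1), ([11, 28], -1), ([15, 24], -1), ([10, 29], -1), ([8, 31], 1),
      ([12, 27], 1), ([9, 30], 1)]),
   ([22, 25], [([23, 24], -1), ([19, 28], -1), ([21, 26], 1), ([16, 31], 1), ([20, 27], 1),
      ([18, 29], -1), ([17, 30], 1)]),
   ([11, 12, 16], [([10, 13, 16], 1), ([9, 14, 16], -1), ([8, 11, 20], 1), ([4, 11, 24], -1),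
      ([2, 13, 24], 1), ([8, 14, 17], 1), ([8, 13, 18], -1), ([2, 12, 25], -1),
      ([6, 8, 25], -1), ([4, 10, 25], 1), ([4, 9, 26], -1), ([2, 9, 28], 1), ([5, 8, 26], 1),
      ([3, 8, 28], -1), ([1, 14, 24], -1), ([8, 15, 16], 1), ([8, 8, 23], -1),
      ([1, 12, 26], 1), ([1, 10, 28], -1), ([2, 8, 29], -1), ([4, 8, 27], 1),
      ([0, 15, 24], -1), ([0, 10, 29], -1), ([0, 8, 31], 1), ([0, 12, 27], 1),
      ([0, 9, 30], 1), ([1, 8, 30], 1)]),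
   ([12, 16, 19], [([9, 16, 22], -1), ([8, 19, 20], 1), ([10, 16, 21], 1), ([6, 16, 25], -1),
      ([4, 19, 24], -1), ([8, 17, 22], 1), ([2, 20, 25], -1), ([2, 21, 24], 1),
      ([5, 16, 26], 1), ([3, 16, 28], -1), ([4, 17, 26], -1), ([8, 18, 21], -1),
      ([4, 18, 25], 1), ([2, 17, 28], 1), ([15, 16, 16], 1), ([8, 16, 23], -1),
      ([1, 22, 24], -1), ([1, 20, 26], 1), ([2, 16, 29], -1), ([4, 16, 27], 1),
      ([0, 23, 24], -1), ([0, 16, 31], 1), ([1, 18, 28], -1), ([0, 20, 27], 1),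
      ([0, 18, 29], -1), ([0, 17, 30], 1), ([1, 16, 30], 1)]),
   ([7, 12, 16], [([6, 13, 16], 1), ([7, 8, 20], 1), ([4, 11, 20], -1), ([4, 12, 19], 1),
      ([2, 13, 20], 1), ([5, 14, 16], -1), ([2, 12, 21], -1), ([6, 8, 21], -1),
      ([4, 6, 25], 1), ([5, 8, 22], 1), ([4, 5, 26], -1), ([1, 14, 20], -1), ([1, 12, 22], 1),
      ([2, 5, 28], 1), ([1, 6, 28], -1), ([0, 12, 23], 1), ([0, 15, 20], -1),
      ([0, 6, 29], -1), ([0, 5, 30], 1)]),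
   ([7, 10, 16], [([6, 11, 16], 1), ([3, 14, 16], -1), ([6, 8, 19], -1), ([4, 10, 19], 1),
      ([7, 8, 18], 1), ([4, 11, 18], -1), ([2, 13, 18], 1), ([3, 8, 22], 1),
      ([2, 10, 21], -1), ([2, 6, 25], 1), ([3, 4, 26], -1), ([2, 3, 28], 1), ([1, 10, 22], 1),
      ([1, 14, 18], -1), ([1, 6, 26], -1), ([0, 10, 23], 1), ([0, 15, 18], -1),
      ([0, 6, 27], -1), ([0, 3, 30], 1)]),
   ([7, 9, 16], [([3, 13, 16], -1), ([7, 8, 17], 1), ([4, 9, 19], 1), ([5, 11, 16], 1),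
      ([4, 11, 17], -1), ([2, 13, 17], 1), ([2, 9, 21], -1), ([5, 8, 19], -1),
      ([3, 8, 21], 1), ([3, 4, 25], -1), ([2, 5, 25], 1), ([1, 9, 22], 1), ([1, 14, 17], -1),
      ([0, 9, 23], 1), ([1, 5, 26], -1), ([1, 3, 28], 1), ([0, 15, 17], -1), ([0, 3, 29], 1),
      ([0, 5, 27], -1)]),
   ([11, 12, 23], [([10, 13, 23], 1), ([9, 14, 23], -1), ([12, 15, 19], 1), ([7, 10, 29], -1),
      ([7, 8, 31], 1), ([9, 15, 22], 1), ([6, 11, 29], 1), ([7, 12, 27], 1),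
      ([4, 11, 31], -1), ([2, 13, 31], 1), ([7, 9, 30], 1), ([10, 15, 21], -1),
      ([6, 15, 25], 1), ([6, 13, 27], -1), ([3, 14, 29], -1), ([3, 13, 30], 1),
      ([5, 14, 27], 1), ([5, 15, 26], -1), ([5, 11, 30], -1), ([3, 15, 28], 1),
      ([1, 14, 31], -1), ([15, 15, 16], -1), ([8, 15, 23], 1), ([2, 15, 29], 1),
      ([4, 15, 27], -1), ([0, 15, 31], -1), ([1, 15, 30], -1)]),
   ([11, 20, 23], [([7, 16, 31], 1), ([14, 17, 23], -1), ([15, 19, 20], 1), ([13, 18, 23], 1),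
      ([6, 23, 25], 1), ([6, 19, 29], 1), ([7, 20, 27], 1), ([15, 17, 22], 1),
      ([4, 19, 31], -1), ([7, 18, 29], -1), ([7, 17, 30], 1), ([3, 22, 29], -1),
      ([5, 23, 26], -1), ([3, 23, 28], 1), ([2, 21, 31], 1), ([15, 18, 21], -1),
      ([6, 21, 27], -1), ([5, 22, 27], 1), ([5, 19, 30], -1), ([15, 16, 23], -1),
      ([8, 23, 23], 1), ([3, 21, 30], 1), ([1, 22, 31], -1), ([2, 23, 29], 1),
      ([4, 23, 27], -1), ([0, 23, 31], -1), ([1, 23, 30], -1)]),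
   ([11, 23, 24], [([11, 16, 31], 1), ([10, 23, 25], 1), ([15, 19, 24], 1), ([9, 23, 26], -1),
      ([10, 19, 29], 1), ([8, 19, 31], -1), ([11, 20, 27], 1), ([12, 19, 27], -1),
      ([11, 18, 29], -1), ([9, 19, 30], -1), ([15, 17, 26], 1), ([11, 17, 30], 1),
      ([2, 25, 31], 1), ([15, 18, 25], -1), ([6, 25, 27], -1), ([3, 26, 29], -1),
      ([3, 25, 30], 1), ([5, 26, 27], 1), ([1, 26, 31], -1)]),
   ([13, 23, 24], [([13, 16, 31], 1), ([12, 23, 25], 1), ([15, 20, 25], -1), ([9, 23, 28], -1),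
      ([13, 20, 27], 1), ([15, 21, 24], 1), ([13, 18, 29], -1), ([10, 21, 29], 1),
      ([6, 25, 29], -1), ([8, 21, 31], -1), ([4, 25, 31], 1), ([13, 17, 30], 1),
      ([12, 21, 27], -1), ([15, 17, 28], 1), ([9, 21, 30], -1), ([3, 28, 29], -1),
      ([5, 25, 30], 1), ([5, 27, 28], 1), ([1, 28, 31], -1)]),
   ([14, 23, 24], [([14, 16, 31], 1), ([12, 23, 26], 1), ([15, 22, 24], 1), ([10, 22, 29], 1),
      ([10, 23, 28], -1), ([8, 22, 31], -1), ([14, 20, 27], 1), ([15, 20, 26], -1),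
      ([12, 22, 27], -1), ([14, 18, 29], -1), ([9, 22, 30], -1), ([6, 26, 29], -1),
      ([14, 17, 30], 1), ([4, 26, 31], 1), ([2, 28, 31], -1), ([15, 18, 28], 1),
      ([6, 27, 28], 1), ([5, 26, 30], 1), ([3, 28, 30], -1)])]


/-- The coded rules. -/
def rules : List Rule :=
  [(14803, [(11303, 1), (11227, -1), (7979, -1), (7811, 1), (5141, -1), (4897, 1), (4757, -1),
      (1591, 1), (1457, -1), (671, 1), (667, -1), (221, -1), (133, 1), (82, 1), (15, 1)]),
   (10541, [(9301, 1), (5459, 1), (4453, 1), (1817, -1), (817, 1), (527, -1), (10, -1)]),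
   (12827, [(11021, 1), (5917, 1), (4847, 1), (1357, -1), (1273, 1), (93, -1), (26, -1)]),
   (8881, [(6157, -1), (5429, -1), (5353, 1), (2507, 1), (1139, -1), (129, 1), (14, 1)]),
   (7597, [(6893, -1), (5969, -1), (2071, 1), (1961, 1), (1003, -1), (237, 1), (58, 1)]),
   (7171, [(4841, -1), (3071, 1), (2599, -1), (1691, 1), (1649, -1), (219, 1), (22, 1)]),
   (10573, [(7571, -1), (5251, 1), (2929, 1), (1177, -1), (611, 1), (259, -1), (123, 1)]),
   (7957, [(7031, 1), (4859, -1), (2407, 1), (697, 1), (583, -1), (497, -1), (235, 1)]),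
   (7663, [(4307, 1), (3503, 1), (2987, -1), (1397, 1), (923, 1), (779, -1), (185, -1)]),
   (4891, [(4171, 1), (2759, -1), (1441, -1), (1079, -1), (943, 1), (721, 1), (505, 1)]),
   (5293, [(3799, -1), (3379, -1), (2537, 1), (2501, 1), (889, 1), (689, -1), (535, 1)]),
   (559187, [(491111, 1), (449753, -1), (259969, 1), (221521, -1), (216019, 1), (179653, 1),
      (118243, -1), (117317, -1), (109411, -1), (105659, 1), (82517, -1), (53227, 1),
      (36593, 1), (33511, -1), (28689, -1), (15433, 1), (15341, -1), (13287, 1), (7719, -1),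
      (5083, -1), (3059, 1), (2882, -1), (2158, -1), (1886, 1), (1442, 1), (1010, 1),
      (345, 1)]),
   (684847, [(486719, -1), (318389, 1), (298717, 1), (290177, -1), (271301, -1), (194419, 1),
      (144653, -1), (131393, 1), (97051, 1), (88877, -1), (87419, -1), (71921, -1),
      (67469, 1), (56389, 1), (40931, 1), (40687, -1), (31047, -1), (16383, 1), (13481, -1),
      (8113, 1), (7598, -1), (5002, 1), (4929, -1), (1778, 1), (1378, -1), (1070, 1),
      (915, 1)]),
   (709979, [(420107, 1), (330073, 1), (214757, -1), (213313, 1), (209423, 1), (164761, -1),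
      (103309, -1), (96347, -1), (90383, 1), (67229, 1), (30229, -1), (27813, -1), (24411, 1),
      (19499, 1), (6603, -1), (5974, 1), (2794, -1), (1846, -1), (370, 1)]),
   (572119, [(385459, 1), (209291, -1), (177997, -1), (171893, 1), (137747, 1), (89623, -1),
      (87397, 1), (85399, 1), (83249, -1), (80869, 1), (38399, -1), (24769, 1), (19671, 1),
      (11607, -1), (9159, -1), (4814, 1), (1166, -1), (994, -1), (470, 1)]),
   (696193, [(278099, -1), (278093, 1), (209171, 1), (200873, 1), (180937, -1), (176443, 1),
      (101303, -1), (92759, -1), (63779, 1), (59831, -1), (42143, 1), (23937, 1), (23433, -1),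
      (5858, 1), (4773, -1), (4371, 1), (2354, -1), (1222, 1), (518, -1)]),
   (265843, [(233479, 1), (213817, -1), (123497, 1), (121927, -1), (106559, 1), (87769, 1),
      (82147, 1), (81473, 1), (69331, -1), (67609, 1), (57065, 1), (53867, -1), (52327, 1),
      (48209, -1), (44603, -1), (22795, 1), (18907, 1), (17501, -1), (16465, -1), (16027, 1),
      (8979, -1), (7381, -1), (7337, 1), (2431, 1), (1463, -1), (902, -1), (165, -1)]),
   (327787, [(282613, 1), (226519, -1), (152273, 1), (149089, 1), (137953, 1), (100607, 1),
      (100457, 1), (92983, 1), (84911, -1), (77857, -1), (60455, 1), (48269, -1), (46139, -1),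
      (42253, 1), (41123, 1), (34397, -1), (29323, -1), (20461, 1), (20165, -1), (19459, -1),
      (19343, 1), (13865, 1), (9717, -1), (6409, 1), (3857, -1), (2378, -1), (435, -1)]),
   (338111, [(222589, 1), (161269, 1), (157069, 1), (125947, -1), (117611, 1), (102787, -1),
      (79121, 1), (78589, -1), (61321, -1), (55045, -1), (50611, 1), (47615, 1), (46699, 1),
      (39061, -1), (33299, -1), (26273, -1), (15745, 1), (11137, 1), (5289, -1)]),
   (368503, [(242597, 1), (200129, 1), (93599, -1), (90799, -1), (86233, 1), (85019, 1),
      (66833, -1), (63661, 1), (61841, -1), (55637, -1), (52193, 1), (51895, 1), (42539, -1),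
      (36487, 1), (29795, -1), (18941, -1), (12395, 1), (8029, 1), (3813, -1)]),
   (277327, [(182573, 1), (128441, 1), (113839, 1), (85241, 1), (74617, -1), (74497, -1),
      (64897, 1), (60071, -1), (56959, -1), (50297, -1), (39895, -1), (39689, -1), (39055, 1),
      (33497, 1), (21607, -1), (18073, 1), (15407, 1), (7955, 1), (7285, -1)])]


lemma rules_eq : rawRules.map codR = rules := by decide +kernel

lemma rules_ok : allOK rules 200 = true := by decide +kernel

end Grav


namespace Grav

/-! ## The link with polynomials -/

open MvPolynomial

/-- The finite set with given bit mask. -/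
def vs (n : ℕ) : Finset (Fin 5) := Finset.univ.filter fun i => n.testBit i.1 = true

/-- The bit mask of a finite set. -/
def mk (S : Finset (Fin 5)) : ℕ := ∑ i ∈ S, 2 ^ i.1

lemma mk_vs : ∀ n < 32, mk (vs n) = n := by decide +kernel

lemma mk_lt : ∀ S, mk S < 32 := by decide +kernel

lemma vs_mk : ∀ S, vs (mk S) = S := by decide +kernel

/-- The prime of a variable. -/
def pS (S : Finset (Fin 5)) : ℕ := pr (mk S)

lemma pr_prime : ∀ n < 32, Nat.Prime (pr n) := by
  intro n hn
  unfold pr prm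
  interval_cases n <;> simp <;> norm_num

lemma pS_prime (S : Finset (Fin 5)) : Nat.Prime (pS S) := pr_prime _ (mk_lt S)

lemma pr_inj : ∀ m < 32, ∀ n < 32, pr m = pr n → m = n := by decide +kernel

lemma pS_inj {S T : Finset (Fin 5)} (h : pS S = pS T) : S = T := by
  have := pr_inj _ (mk_lt S) _ (mk_lt T) h
  rw [← vs_mk S, this, vs_mk]

/-- Exponents. -/
abbrev Ex : Type := Finset (Fin 5) →₀ ℕ

/-- The code of a monomial. -/
def code (m : Ex) : ℕ := ∏ S, pS S ^ m S

lemma code_add (a b : Ex) : code (a + b) = code a * code b := by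
  simp [code, pow_add, Finset.prod_mul_distrib]

lemma code_pos (a : Ex) : 0 < code a :=
  Finset.prod_pos fun S _ => pow_pos (pS_prime S).pos _

lemma code_fact (a : Ex) (S : Finset (Fin 5)) : (code a).factorization (pS S) = a S := by
  unfold code
  rw [Nat.factorization_prod (fun S _ => pow_ne_zero _ (pS_prime S).ne_zero)]
  rw [Finsupp.finsetSum_apply, Finset.sum_eq_single S]
  · rw [(pS_prime S).factorization_pow, Finsupp.single_eq_same]
  · intro T _ hT
    rw [(pS_prime T).factorization_pow, Finsupp.single_apply, if_neg]
    exact fun h => hT (pS_inj h)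
  · simp

lemma code_inj {a b : Ex} (h : code a = code b) : a = b := by
  ext S
  rw [← code_fact, h, code_fact]

lemma code_dvd {a b : Ex} (h : code a ∣ code b) : a ≤ b := by
  intro S
  rw [← code_fact a, ← code_fact b]
  exact (Nat.factorization_le_iff_dvd (code_pos a).ne' (code_pos b).ne').2 h (pS S)

lemma code_single (S : Finset (Fin 5)) : code (Finsupp.single S 1) = pS S := by
  unfold code
  rw [Finset.prod_eq_single S]
  · simp
  · intro T _ hT
    rw [Finsupp.single_apply, if_neg (Ne.symm hT), pow_zero]
  · simp

/-- The exponent of a list of variables. -/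
def expo (l : List ℕ) : Ex := (l.map fun v => Finsupp.single (vs v) 1).sum

/-- The monomial of a list of variables. -/
def mon (l : List ℕ) : R32 := (l.map fun v => (X (vs v) : R32)).prod

lemma mon_eq (l : List ℕ) : mon l = monomial (expo l) 1 := by
  induction l with
  | nil => rfl
  | cons v l ih =>
    have h1 : mon (v :: l) = X (vs v) * mon l := by simp [mon]
    have h2 : expo (v :: l) = Finsupp.single (vs v) 1 + expo l := by simp [expo]
    rw [h1, h2, ih, X, monomial_mul, one_mul]

lemma code_expo (l : List ℕ) (hl : ∀ v ∈ l, v < 32) : code (expo l) = cod l := by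
  induction l with
  | nil => simp [expo, cod, code]
  | cons v l ih =>
    have h2 : expo (v :: l) = Finsupp.single (vs v) 1 + expo l := by simp [expo]
    have h3 : cod (v :: l) = pr v * cod l := by simp [cod]
    rw [h2, h3, code_add, ih (fun w hw => hl w (by simp [hw])), code_single, pS,
      mk_vs _ (hl v (by simp))]

/-- The value of a list of terms. -/
def tl (p : List (List ℕ × ℤ)) : R32 := (p.map fun t => t.2 • mon t.1).sum

/-- The polynomial of a rule. -/
def gp (r : RawRule) : R32 := mon r.1 - tl r.2

/-- Rules with reasonable variables. -/
def bnd (r : RawRule) : Prop := (∀ v ∈ r.1, v < 32) ∧ ∀ t ∈ r.2, ∀ v ∈ t.1, v < 32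

instance (r : RawRule) : Decidable (bnd r) := by unfold bnd; infer_instance

lemma rawRules_bnd : ∀ r ∈ rawRules, bnd r := by decide +kernel

/-- The ideal generated by the Groebner basis. -/
def J0 : Ideal R32 := Ideal.span {g | ∃ r ∈ rawRules, g = gp r}

/-- The normal form of a polynomial. -/
def psi : R32 →ₗ[ℂ] (ℕ →₀ ℂ) :=
  (basisMonomials (Finset (Fin 5)) ℂ).constr ℂ fun m => Nrm rules (code m)

lemma psi_mon (m : Ex) (c : ℂ) : psi (monomial m c) = c • Nrm rules (code m) := by
  have h : (monomial m c : R32) = c • basisMonomials (Finset (Fin 5)) ℂ m := by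
    rw [coe_basisMonomials, smul_monomial, smul_eq_mul, mul_one]
  rw [h, map_smul, psi, Module.Basis.constr_basis]

lemma psi_mul_mon (m : Ex) (c : ℂ) (l : List ℕ) (hl : ∀ v ∈ l, v < 32) :
    psi (monomial m c * mon l) = c • Nrm rules (code m * cod l) := by
  rw [mon_eq, monomial_mul, psi_mon, code_add, code_expo l hl, mul_one]

lemma psi_mul_tl (m : Ex) (c : ℂ) (p : List (List ℕ × ℤ)) (hp : ∀ t ∈ p, ∀ v ∈ t.1, v < 32) :
    psi (monomial m c * tl p) =
      c • ev (Nrm rules) (code m) (p.map fun t => (cod t.1, t.2)) := by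
  induction p with
  | nil => simp [tl]
  | cons t p ih =>
    have h1 : tl (t :: p) = t.2 • mon t.1 + tl p := by simp [tl]
    rw [h1, mul_add, map_add, ih (fun s hs => hp s (by simp [hs])), mul_smul_comm,
      map_zsmul, psi_mul_mon _ _ _ (hp t (by simp)), List.map_cons, ev_cons, smul_add,
      smul_comm]

lemma psi_mul_gp (m : Ex) (c : ℂ) (r : RawRule) (hr : bnd r) :
    psi (monomial m c * gp r) =
      c • (Nrm rules (code m * (codR r).1) - ev (Nrm rules) (code m) (codR r).2) := by
  rw [gp, mul_sub, map_sub, psi_mul_mon _ _ _ hr.1, psi_mul_tl _ _ _ hr.2, smul_sub]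
  rfl

lemma codR_mem {r : RawRule} (hr : r ∈ rawRules) : codR r ∈ rules := by
  rw [← rules_eq]
  exact List.mem_map_of_mem hr

lemma psi_mul_gp_zero (a : R32) {r : RawRule} (hr : r ∈ rawRules) : psi (a * gp r) = 0 := by
  induction a using MvPolynomial.induction_on' with
  | monomial m c =>
    rw [psi_mul_gp m c r (rawRules_bnd r hr),
      Nrm_rule rules_ok _ _ (codR_mem hr) _ (code_pos m) rfl, sub_self, smul_zero]
  | add p q hp hq => rw [add_mul, map_add, hp, hq, add_zero]

lemma psi_J0 {f : R32} (hf : f ∈ J0) : psi f = 0 := by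
  suffices h : ∀ a : R32, psi (a * f) = 0 by simpa using h 1
  unfold J0 at hf
  induction hf using Submodule.span_induction with
  | zero => simp
  | add x y _ _ hx hy =>
    intro a
    rw [mul_add, map_add, hx, hy, add_zero]
  | mem x hx =>
    obtain ⟨r, hr, rfl⟩ := hx
    exact fun a => psi_mul_gp_zero a hr
  | smul b x hx ih =>
    intro a
    rw [smul_eq_mul, ← mul_assoc]
    exact ih _

/-- The polynomial `- x₀ (x₀ x₁₂₃ - x₁ x₂₃ + x₂ x₁₃ - x₃ x₁₂)` as a rule. -/
def hraw : RawRule := ([0, 4, 3], [([0, 0, 7], 1), ([0, 1, 6], -1), ([0, 2, 5], 1)])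

lemma hraw_bnd : bnd hraw := by decide +kernel

lemma hraw_cop : ∀ r ∈ rules, Nat.Coprime r.1 (codR hraw).1 := by decide +kernel

lemma hraw_lt : ∀ t ∈ (codR hraw).2, t.1 < (codR hraw).1 ∧ 0 < t.1 := by decide +kernel

lemma decr_rules : Decr rules := by
  have h := rules_ok
  simp only [allOK, Bool.and_eq_true, List.all_eq_true] at h
  intro r hr t ht
  have := h.1 r hr
  simp only [ruleOK, Bool.and_eq_true, List.all_eq_true, Nat.blt_eq] at this
  exact this t ht

lemma psi_h_lt (m : Ex) (c : ℂ) (n : ℕ) (hn : code m < n) :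
    psi (monomial m c * gp hraw) (n * (codR hraw).1) = 0 := by
  have hpos : 0 < (codR hraw).1 := by decide +kernel
  rw [psi_mul_gp m c _ hraw_bnd, Finsupp.smul_apply, Finsupp.sub_apply, ev_apply_zero,
    Nrm_lt decr_rules _ _ (Nat.mul_pos (code_pos m) hpos)
      (Nat.mul_lt_mul_of_pos_right hn hpos), sub_zero, smul_zero]
  intro t ht
  obtain ⟨h1, h2⟩ := hraw_lt t ht
  refine Nrm_lt decr_rules _ _ (Nat.mul_pos (code_pos m) h2) ?_
  exact lt_of_lt_of_le (Nat.mul_lt_mul_of_pos_left h1 (code_pos m))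
    (Nat.mul_le_mul_right _ hn.le)

lemma psi_h_eq (m : Ex) (c : ℂ) (hm : ∀ r ∈ rules, ¬ r.1 ∣ code m) :
    psi (monomial m c * gp hraw) (code m * (codR hraw).1) = c := by
  rw [psi_mul_gp m c _ hraw_bnd, Finsupp.smul_apply, Finsupp.sub_apply, ev_apply_zero,
    Nrm_std, Finsupp.single_eq_same, sub_zero, smul_eq_mul, mul_one]
  · intro r hr hd
    exact hm r hr ((hraw_cop r hr).dvd_of_dvd_mul_right hd)
  · intro t ht
    obtain ⟨h1, h2⟩ := hraw_lt t ht
    exact Nrm_lt decr_rules _ _ (Nat.mul_pos (code_pos m) h2)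
      (Nat.mul_lt_mul_of_pos_left h1 (code_pos m))

/-- Polynomials all of whose monomials have small codes. -/
def W (n : ℕ) : Submodule ℂ R32 := restrictSupport ℂ {m : Ex | code m < n}

lemma mem_W {n : ℕ} {f : R32} : f ∈ W n ↔ ∀ m ∈ f.support, code m < n := Iff.rfl

lemma monomial_mem_W {n : ℕ} {m : Ex} (c : ℂ) (h : code m < n) : monomial m c ∈ W n := by
  rw [mem_W]
  intro m' hm'
  have := MvPolynomial.support_monomial_subset hm'
  rw [Finset.mem_singleton] at this
  rwa [this]

lemma psi_W (f : R32) (n : ℕ) (hf : f ∈ W n) : psi (f * gp hraw) (n * (codR hraw).1) = 0 := by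
  rw [f.as_sum, Finset.sum_mul, map_sum, Finsupp.finsetSum_apply]
  exact Finset.sum_eq_zero fun m hm => psi_h_lt m _ n (mem_W.1 hf m hm)

lemma tl_mem_W (m : Ex) (c : ℂ) (n : ℕ) (p : List (List ℕ × ℤ))
    (hp : ∀ t ∈ p, ∀ v ∈ t.1, v < 32) (h : ∀ t ∈ p, code m * cod t.1 < n) :
    monomial m c * tl p ∈ W n := by
  induction p with
  | nil => simp [tl]
  | cons t p ih =>
    have h1 : tl (t :: p) = t.2 • mon t.1 + tl p := by simp [tl]
    rw [h1, mul_add]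
    refine add_mem ?_ (ih (fun s hs => hp s (by simp [hs])) (fun s hs => h s (by simp [hs])))
    rw [mul_smul_comm, mon_eq, monomial_mul]
    refine zsmul_mem (monomial_mem_W _ ?_) _
    rw [code_add, code_expo _ (hp t (by simp))]
    exact h t (by simp)

lemma sub_top_W {n : ℕ} {f : R32} (hf : f ∈ W (n + 1)) {m : Ex} (hm : code m = n) :
    f - monomial m (f.coeff m) ∈ W n := by
  rw [mem_W]
  intro m' hm'
  rw [mem_support_iff, coeff_sub, coeff_monomial] at hm'
  by_cases h : m = m'
  · subst h; simp at hm'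
  · rw [if_neg h, sub_zero] at hm'
    have h1 := mem_W.1 hf m' (mem_support_iff.2 hm')
    have h2 : code m' ≠ n := fun h3 => h (code_inj (hm.trans h3.symm))
    omega

/-- `h` is a non-zero divisor modulo `J0`. -/
lemma nzd_aux (n : ℕ) : ∀ f : R32, f ∈ W n → f * gp hraw ∈ J0 → f ∈ J0 := by
  induction n with
  | zero =>
    intro f hf _
    have : f = 0 := by
      rw [← support_eq_empty, Finset.eq_empty_iff_forall_notMem]
      intro m hm
      exact absurd (mem_W.1 hf m hm) (Nat.not_lt_zero _)
    rw [this]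
    exact zero_mem _
  | succ n ih =>
    intro f hf hJ
    by_cases hex : ∃ m ∈ f.support, code m = n
    · obtain ⟨m, hm, hmn⟩ := hex
      have hW := sub_top_W hf hmn
      by_cases hdv : ∃ r ∈ rules, r.1 ∣ code m
      · obtain ⟨r, hr, hd⟩ := hdv
        rw [← rules_eq, List.mem_map] at hr
        obtain ⟨rr, hrr, rfl⟩ := hr
        have hb := rawRules_bnd rr hrr
        have hle : expo rr.1 ≤ m := code_dvd (by rw [code_expo _ hb.1]; exact hd)
        set g : R32 := monomial (m - expo rr.1) (f.coeff m) * gp rr with hg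
        have hgJ : g ∈ J0 := Ideal.mul_mem_left _ _ (Ideal.subset_span ⟨rr, hrr, rfl⟩)
        have hmm : m - expo rr.1 + expo rr.1 = m := tsub_add_cancel_of_le hle
        have hfg : f - g ∈ W n := by
          have h1 : f - g = (f - monomial m (f.coeff m)) +
              monomial (m - expo rr.1) (f.coeff m) * tl rr.2 := by
            rw [hg, gp, mul_sub, mon_eq, monomial_mul, hmm, mul_one]
            ring
          rw [h1]
          refine add_mem hW (tl_mem_W _ _ _ _ hb.2 ?_)
          intro t ht
          have h2 := (decr_rules _ (codR_mem hrr) (cod t.1, t.2)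
            (List.mem_map.2 ⟨t, ht, rfl⟩)).1
          have h3 : code (m - expo rr.1) * cod rr.1 = n := by
            rw [← code_expo _ hb.1, ← code_add, hmm, hmn]
          calc code (m - expo rr.1) * cod t.1 < code (m - expo rr.1) * cod rr.1 :=
                Nat.mul_lt_mul_of_pos_left h2 (code_pos _)
            _ = n := h3
        have h4 := ih (f - g) hfg (by
          rw [sub_mul]
          exact sub_mem hJ (Ideal.mul_mem_right _ _ hgJ))
        have := add_mem h4 hgJ
        rwa [sub_add_cancel] at this
      · push Not at hdv
        exfalso
        have h1 := psi_J0 hJ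
        have h2 : f * gp hraw = (f - monomial m (f.coeff m)) * gp hraw +
            monomial m (f.coeff m) * gp hraw := by ring
        rw [h2, map_add] at h1
        have h3 := DFunLike.congr_fun h1 (n * (codR hraw).1)
        rw [Finsupp.add_apply, psi_W _ _ hW, ← hmn, psi_h_eq m _ hdv, zero_add] at h3
        exact (mem_support_iff.1 hm) h3
    · push Not at hex
      refine ih f (mem_W.2 fun m hm => ?_) hJ
      have := mem_W.1 hf m hm
      have := hex m hm
      omega

lemma nzd {f : R32} (h : f * gp hraw ∈ J0) : f ∈ J0 := by
  refine nzd_aux (f.support.sup code + 1) f (mem_W.2 fun m hm => ?_) h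
  exact Nat.lt_succ_of_le (Finset.le_sup (f := code) hm)

end Grav


namespace Grav

/-! ## The eleven quadrics -/

section
variable {A : Type*} [CommRing A] (x : ℕ → A)

/-- The coefficient of (E1). -/
def q0 : A :=
    x 0 * x 31 + x 1 * x 30 - x 2 * x 29 + x 4 * x 27 - x 8 * x 23 + x 15 * x 16 - x 3 * x 28
    + x 5 * x 26 - x 6 * x 25 - x 9 * x 22 + x 10 * x 21 - x 12 * x 19 + x 14 * x 17
    - x 13 * x 18 + x 11 * x 20 - x 7 * x 24

/-- Half of the coefficient of (E2) without `e_1`. -/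
def q1 : A :=
    -(x 0 * x 30) - x 2 * x 28 + x 4 * x 26 - x 8 * x 22 + x 14 * x 16 + x 6 * x 24
    - x 10 * x 20 + x 12 * x 18

/-- Half of the coefficient of (E2) without `e_2`. -/
def q2 : A :=
    -(x 0 * x 29) - x 1 * x 28 + x 4 * x 25 - x 8 * x 21 + x 13 * x 16 + x 5 * x 24
    - x 9 * x 20 + x 12 * x 17

/-- Half of the coefficient of (E2) without `e_3`. -/
def q3 : A :=
    -(x 0 * x 27) - x 1 * x 26 + x 2 * x 25 - x 8 * x 19 + x 11 * x 16 + x 3 * x 24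
    - x 9 * x 18 + x 10 * x 17

/-- Half of the coefficient of (E2) without `e_4`. -/
def q4 : A :=
    -(x 0 * x 23) - x 1 * x 22 + x 2 * x 21 - x 4 * x 19 + x 7 * x 16 + x 3 * x 20 - x 5 * x 18
    + x 6 * x 17

/-- Half of the coefficient of (E2) without `e_5`. -/
def q5 : A :=
    -(x 0 * x 15) - x 1 * x 14 + x 2 * x 13 - x 4 * x 11 + x 7 * x 8 + x 3 * x 12 - x 5 * x 10
    + x 6 * x 9

/-- Half of the coefficient of (E3) for `r = 1`. -/
def q6 : A :=
    -(x 1 * x 31) - x 3 * x 29 + x 5 * x 27 - x 9 * x 23 + x 15 * x 17 + x 7 * x 25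
    - x 11 * x 21 + x 13 * x 19

/-- Half of the coefficient of (E3) for `r = 2`. -/
def q7 : A :=
    -(x 2 * x 31) - x 3 * x 30 + x 6 * x 27 - x 10 * x 23 + x 15 * x 18 + x 7 * x 26
    - x 11 * x 22 + x 14 * x 19

/-- Half of the coefficient of (E3) for `r = 3`. -/
def q8 : A :=
    -(x 4 * x 31) - x 5 * x 30 + x 6 * x 29 - x 12 * x 23 + x 15 * x 20 + x 7 * x 28
    - x 13 * x 22 + x 14 * x 21

/-- Half of the coefficient of (E3) for `r = 4`. -/
def q9 : A :=
    -(x 8 * x 31) - x 9 * x 30 + x 10 * x 29 - x 12 * x 27 + x 15 * x 24 + x 11 * x 28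
    - x 13 * x 26 + x 14 * x 25

/-- Half of the coefficient of (E3) for `r = 5`. -/
def q10 : A :=
    -(x 16 * x 31) - x 17 * x 30 + x 18 * x 29 - x 20 * x 27 + x 23 * x 24 + x 19 * x 28
    - x 21 * x 26 + x 22 * x 25

end

/-- The variables. -/
def xv (n : ℕ) : R32 := MvPolynomial.X (vs n)

/-- The basis vectors. -/
def e (i : Fin 5) : Ext5 := ExteriorAlgebra.ι R32 (Pi.single i 1)

lemma e_sq (i : Fin 5) : e i * e i = 0 := ExteriorAlgebra.ι_sq_zero _

lemma e_swap (i j : Fin 5) (_ : i < j) : e j * e i = -(e i * e j) := by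
  rw [eq_neg_iff_add_eq_zero]
  exact ExteriorAlgebra.ι_add_mul_swap _ _

lemma e_sq2 (i : Fin 5) (w : Ext5) : e i * (e i * w) = 0 := by
  rw [← mul_assoc, e_sq, zero_mul]

lemma e_swap2 (i j : Fin 5) (h : i < j) (w : Ext5) : e j * (e i * w) = -(e i * (e j * w)) := by
  rw [← mul_assoc, e_swap i j h, neg_mul, mul_assoc]

lemma ctr_one (r : Fin 5) : ctr r 1 = 0 := CliffordAlgebra.contractLeft_one _ _

lemma ctr_mul (r i : Fin 5) (w : Ext5) :
    ctr r (e i * w) = (if r = i then w else 0) - e i * ctr r w := by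
  unfold ctr e
  rw [ExteriorAlgebra.ι, CliffordAlgebra.contractLeft_ι_mul]
  congr 1
  rw [LinearMap.proj_apply, Pi.single_apply]
  split_ifs <;> simp

lemma ctr_e (r i : Fin 5) : ctr r (e i) = if r = i then 1 else 0 := by
  have := ctr_mul r i 1
  rwa [mul_one, ctr_one, mul_zero, sub_zero] at this

lemma sort_vs (n : ℕ) : (vs n).sort (· ≤ ·) =
    (List.finRange 5).filter fun i => n.testBit i.1 = true := by
  have hp : ((vs n).sort (· ≤ ·)).Perm
      ((List.finRange 5).filter fun i => n.testBit i.1 = true) := by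
    rw [List.perm_ext_iff_of_nodup (Finset.sort_nodup _ _)
      ((List.nodup_finRange 5).filter _)]
    intro a
    simp [vs]
  refine hp.eq_of_pairwise' (r := (· ≤ ·)) ?_ ?_
  · exact Finset.pairwise_sort _ _
  · exact List.Pairwise.filter _ (List.pairwise_le_finRange 5)

lemma eS_vs (n : ℕ) : eS (vs n) =
    (((List.finRange 5).filter fun i => n.testBit i.1 = true).map e).prod := by
  unfold eS
  rw [sort_vs]
  rfl

lemma lamb_eq (k : ℕ) (l : Finset ℕ) (h1 : (Finset.univ.filter fun S : Finset (Fin 5) => S.card = k)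
    = l.image vs) (h2 : Set.InjOn vs l) : lamb k = ∑ n ∈ l, xv n • eS (vs n) := by
  unfold lamb
  rw [h1, Finset.sum_image h2]
  rfl

lemma lamb_1 : lamb 1 =
    xv 1 • (e 0) + xv 2 • (e 1) + xv 4 • (e 2) + xv 8 • (e 3) + xv 16 • (e 4) := by
  rw [lamb_eq 1 {1, 2, 4, 8, 16} (by decide +kernel) (by
    intro a ha b hb; revert a b; decide +kernel)]
  simp [Finset.sum_insert, eS_vs, Nat.testBit, List.finRange, add_assoc]

lemma lamb_2 : lamb 2 =
    xv 3 • (e 0 * e 1) + xv 5 • (e 0 * e 2) + xv 6 • (e 1 * e 2) + xv 9 • (e 0 * e 3)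
    + xv 10 • (e 1 * e 3) + xv 12 • (e 2 * e 3) + xv 17 • (e 0 * e 4) + xv 18 • (e 1 * e 4)
    + xv 20 • (e 2 * e 4) + xv 24 • (e 3 * e 4) := by
  rw [lamb_eq 2 {3, 5, 6, 9, 10, 12, 17, 18, 20, 24} (by decide +kernel) (by
    intro a ha b hb; revert a b; decide +kernel)]
  simp [Finset.sum_insert, eS_vs, Nat.testBit, List.finRange, add_assoc]

lemma lamb_3 : lamb 3 =
    xv 7 • (e 0 * (e 1 * e 2)) + xv 11 • (e 0 * (e 1 * e 3)) + xv 13 • (e 0 * (e 2 * e 3))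
    + xv 14 • (e 1 * (e 2 * e 3)) + xv 19 • (e 0 * (e 1 * e 4)) + xv 21 • (e 0 * (e 2 * e 4))
    + xv 22 • (e 1 * (e 2 * e 4)) + xv 25 • (e 0 * (e 3 * e 4)) + xv 26 • (e 1 * (e 3 * e 4))
    + xv 28 • (e 2 * (e 3 * e 4)) := by
  rw [lamb_eq 3 {7, 11, 13, 14, 19, 21, 22, 25, 26, 28} (by decide +kernel) (by
    intro a ha b hb; revert a b; decide +kernel)]
  simp [Finset.sum_insert, eS_vs, Nat.testBit, List.finRange, add_assoc]

lemma lamb_4 : lamb 4 =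
    xv 15 • (e 0 * (e 1 * (e 2 * e 3))) + xv 23 • (e 0 * (e 1 * (e 2 * e 4)))
    + xv 27 • (e 0 * (e 1 * (e 3 * e 4))) + xv 29 • (e 0 * (e 2 * (e 3 * e 4)))
    + xv 30 • (e 1 * (e 2 * (e 3 * e 4))) := by
  rw [lamb_eq 4 {15, 23, 27, 29, 30} (by decide +kernel) (by
    intro a ha b hb; revert a b; decide +kernel)]
  simp [Finset.sum_insert, eS_vs, Nat.testBit, List.finRange, add_assoc]

lemma lamb_5 : lamb 5 =
    xv 31 • (e 0 * (e 1 * (e 2 * (e 3 * e 4)))) := by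
  rw [lamb_eq 5 {31} (by decide +kernel) (by
    intro a ha b hb; revert a b; decide +kernel)]
  simp [Finset.sum_insert, eS_vs, Nat.testBit, List.finRange, add_assoc]

/-- The top form. -/
def top5 : Ext5 := e 0 * (e 1 * (e 2 * (e 3 * e 4)))

lemma x_empty : (MvPolynomial.X ∅ : R32) = xv 0 := by
  have : vs 0 = ∅ := by decide +kernel
  rw [xv, this]

lemma E1_eq : E1 = q0 xv • top5 := by
  rw [E1, x_empty, lamb_1, lamb_2, lamb_3, lamb_4, lamb_5]
  simp (disch := decide) only [mul_add, add_mul, smul_mul_assoc, mul_smul_comm, mul_assoc, e_sq, e_sq2, mul_neg, neg_mul,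
    mul_zero, zero_mul, smul_zero, smul_neg, neg_neg, neg_zero, add_zero, zero_add, smul_smul,
    smul_add, sub_zero, zero_sub, mul_one, one_mul, sub_mul, mul_sub,
    e_swap, e_swap2]
  unfold q0 top5
  module

lemma E2_eq : E2 = (2 * q1 xv) • (e 1 * (e 2 * (e 3 * e 4)))
    + (2 * q2 xv) • (e 0 * (e 2 * (e 3 * e 4))) + (2 * q3 xv) • (e 0 * (e 1 * (e 3 * e 4)))
    + (2 * q4 xv) • (e 0 * (e 1 * (e 2 * e 4))) + (2 * q5 xv) • (e 0 * (e 1 * (e 2 * e 3))) := by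
  rw [E2, x_empty, lamb_1, lamb_2, lamb_3, lamb_4]
  simp (disch := decide) only [mul_add, add_mul, smul_mul_assoc, mul_smul_comm, mul_assoc, e_sq, e_sq2, mul_neg, neg_mul,
    mul_zero, zero_mul, smul_zero, smul_neg, neg_neg, neg_zero, add_zero, zero_add, smul_smul,
    smul_add, sub_zero, zero_sub, mul_one, one_mul, sub_mul, mul_sub,
    e_swap, e_swap2]
  unfold q1 q2 q3 q4 q5
  module

lemma E3_eq0 : E3 0 = (2 * q6 xv) • top5 := by
  rw [E3, lamb_1, lamb_2, lamb_3, lamb_4, lamb_5]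
  simp only [map_add, map_smul, ctr_mul, ctr_e, Fin.reduceEq, ↓reduceIte, mul_zero, mul_one,
    sub_zero, zero_sub, smul_zero, smul_neg, add_zero, zero_add, neg_zero]
  simp (disch := decide) only [mul_add, add_mul, smul_mul_assoc, mul_smul_comm, mul_assoc, e_sq, e_sq2, mul_neg, neg_mul,
    mul_zero, zero_mul, smul_zero, smul_neg, neg_neg, neg_zero, add_zero, zero_add, smul_smul,
    smul_add, sub_zero, zero_sub, mul_one, one_mul, sub_mul, mul_sub,
    e_swap, e_swap2]
  unfold q6 top5
  module

lemma E3_eq1 : E3 1 = (2 * q7 xv) • top5 := by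
  rw [E3, lamb_1, lamb_2, lamb_3, lamb_4, lamb_5]
  simp only [map_add, map_smul, ctr_mul, ctr_e, Fin.reduceEq, ↓reduceIte, mul_zero, mul_one,
    sub_zero, zero_sub, smul_zero, smul_neg, add_zero, zero_add, neg_zero]
  simp (disch := decide) only [mul_add, add_mul, smul_mul_assoc, mul_smul_comm, mul_assoc, e_sq, e_sq2, mul_neg, neg_mul,
    mul_zero, zero_mul, smul_zero, smul_neg, neg_neg, neg_zero, add_zero, zero_add, smul_smul,
    smul_add, sub_zero, zero_sub, mul_one, one_mul, sub_mul, mul_sub,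
    e_swap, e_swap2]
  unfold q7 top5
  module

lemma E3_eq2 : E3 2 = (2 * q8 xv) • top5 := by
  rw [E3, lamb_1, lamb_2, lamb_3, lamb_4, lamb_5]
  simp only [map_add, map_smul, ctr_mul, ctr_e, Fin.reduceEq, ↓reduceIte, mul_zero, mul_one,
    sub_zero, zero_sub, smul_zero, smul_neg, add_zero, zero_add, neg_zero]
  simp (disch := decide) only [mul_add, add_mul, smul_mul_assoc, mul_smul_comm, mul_assoc, e_sq, e_sq2, mul_neg, neg_mul,
    mul_zero, zero_mul, smul_zero, smul_neg, neg_neg, neg_zero, add_zero, zero_add, smul_smul,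
    smul_add, sub_zero, zero_sub, mul_one, one_mul, sub_mul, mul_sub,
    e_swap, e_swap2]
  unfold q8 top5
  module

lemma E3_eq3 : E3 3 = (2 * q9 xv) • top5 := by
  rw [E3, lamb_1, lamb_2, lamb_3, lamb_4, lamb_5]
  simp only [map_add, map_smul, ctr_mul, ctr_e, Fin.reduceEq, ↓reduceIte, mul_zero, mul_one,
    sub_zero, zero_sub, smul_zero, smul_neg, add_zero, zero_add, neg_zero]
  simp (disch := decide) only [mul_add, add_mul, smul_mul_assoc, mul_smul_comm, mul_assoc, e_sq, e_sq2, mul_neg, neg_mul,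
    mul_zero, zero_mul, smul_zero, smul_neg, neg_neg, neg_zero, add_zero, zero_add, smul_smul,
    smul_add, sub_zero, zero_sub, mul_one, one_mul, sub_mul, mul_sub,
    e_swap, e_swap2]
  unfold q9 top5
  module

lemma E3_eq4 : E3 4 = (2 * q10 xv) • top5 := by
  rw [E3, lamb_1, lamb_2, lamb_3, lamb_4, lamb_5]
  simp only [map_add, map_smul, ctr_mul, ctr_e, Fin.reduceEq, ↓reduceIte, mul_zero, mul_one,
    sub_zero, zero_sub, smul_zero, smul_neg, add_zero, zero_add, neg_zero]
  simp (disch := decide) only [mul_add, add_mul, smul_mul_assoc, mul_smul_comm, mul_assoc, e_sq, e_sq2, mul_neg, neg_mul,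
    mul_zero, zero_mul, smul_zero, smul_neg, neg_neg, neg_zero, add_zero, zero_add, smul_smul,
    smul_add, sub_zero, zero_sub, mul_one, one_mul, sub_mul, mul_sub,
    e_swap, e_swap2]
  unfold q10 top5
  module

end Grav


namespace Grav

/-! ## The ideal is generated by the Groebner basis -/

/-- The rule with a given number. -/
def rr (k : ℕ) : RawRule := rawRules.getD k ([], [])

lemma rr_mem : ∀ k < 21, rr k ∈ rawRules := by decide +kernel

lemma exists_rr {r : RawRule} (hr : r ∈ rawRules) : ∃ k < 21, r = rr k := by
  have h : ∀ r ∈ rawRules, ∃ k < 21, r = rr k := by decide +kernel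
  exact h r hr

lemma mon_xv (l : List ℕ) : mon l = (l.map xv).prod := rfl

lemma gp_0 : gp (rr 0) = -q0 xv := by
  simp only [gp, tl, rr, rawRules, mon_xv, List.getD_cons_succ, List.getD_cons_zero, List.map,
    List.prod_cons, List.prod_nil, List.sum_cons, List.sum_nil, one_zsmul, neg_zsmul]
  unfold q0
  ring

lemma gp_1 : gp (rr 1) = -q1 xv := by
  simp only [gp, tl, rr, rawRules, mon_xv, List.getD_cons_succ, List.getD_cons_zero, List.map,
    List.prod_cons, List.prod_nil, List.sum_cons, List.sum_nil, one_zsmul, neg_zsmul]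
  unfold q1
  ring

lemma gp_2 : gp (rr 2) = -q2 xv := by
  simp only [gp, tl, rr, rawRules, mon_xv, List.getD_cons_succ, List.getD_cons_zero, List.map,
    List.prod_cons, List.prod_nil, List.sum_cons, List.sum_nil, one_zsmul, neg_zsmul]
  unfold q2
  ring

lemma gp_3 : gp (rr 3) = q3 xv := by
  simp only [gp, tl, rr, rawRules, mon_xv, List.getD_cons_succ, List.getD_cons_zero, List.map,
    List.prod_cons, List.prod_nil, List.sum_cons, List.sum_nil, one_zsmul, neg_zsmul]
  unfold q3
  ring

lemma gp_4 : gp (rr 4) = q4 xv := by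
  simp only [gp, tl, rr, rawRules, mon_xv, List.getD_cons_succ, List.getD_cons_zero, List.map,
    List.prod_cons, List.prod_nil, List.sum_cons, List.sum_nil, one_zsmul, neg_zsmul]
  unfold q4
  ring

lemma gp_5 : gp (rr 5) = q5 xv := by
  simp only [gp, tl, rr, rawRules, mon_xv, List.getD_cons_succ, List.getD_cons_zero, List.map,
    List.prod_cons, List.prod_nil, List.sum_cons, List.sum_nil, one_zsmul, neg_zsmul]
  unfold q5
  ring

lemma gp_6 : gp (rr 6) = q6 xv := by
  simp only [gp, tl, rr, rawRules, mon_xv, List.getD_cons_succ, List.getD_cons_zero, List.map,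
    List.prod_cons, List.prod_nil, List.sum_cons, List.sum_nil, one_zsmul, neg_zsmul]
  unfold q6
  ring

lemma gp_7 : gp (rr 7) = q7 xv := by
  simp only [gp, tl, rr, rawRules, mon_xv, List.getD_cons_succ, List.getD_cons_zero, List.map,
    List.prod_cons, List.prod_nil, List.sum_cons, List.sum_nil, one_zsmul, neg_zsmul]
  unfold q7
  ring

lemma gp_8 : gp (rr 8) = -q8 xv := by
  simp only [gp, tl, rr, rawRules, mon_xv, List.getD_cons_succ, List.getD_cons_zero, List.map,
    List.prod_cons, List.prod_nil, List.sum_cons, List.sum_nil, one_zsmul, neg_zsmul]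
  unfold q8
  ring

lemma gp_9 : gp (rr 9) = q9 xv := by
  simp only [gp, tl, rr, rawRules, mon_xv, List.getD_cons_succ, List.getD_cons_zero, List.map,
    List.prod_cons, List.prod_nil, List.sum_cons, List.sum_nil, one_zsmul, neg_zsmul]
  unfold q9
  ring

lemma gp_10 : gp (rr 10) = q10 xv := by
  simp only [gp, tl, rr, rawRules, mon_xv, List.getD_cons_succ, List.getD_cons_zero, List.map,
    List.prod_cons, List.prod_nil, List.sum_cons, List.sum_nil, one_zsmul, neg_zsmul]
  unfold q10
  ring

lemma gp_11 : gp (rr 11) = -(xv 8 * q0 xv) + xv 9 * q1 xv - xv 10 * q2 xv + xv 12 * q3 xv - xv 24 * q5 xv := by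
  simp only [gp, tl, rr, rawRules, mon_xv, List.getD_cons_succ, List.getD_cons_zero, List.map,
    List.prod_cons, List.prod_nil, List.sum_cons, List.sum_nil, one_zsmul, neg_zsmul]
  unfold q0 q1 q2 q3 q5
  ring

lemma gp_12 : gp (rr 12) = -(xv 16 * q0 xv) + xv 17 * q1 xv - xv 18 * q2 xv + xv 20 * q3 xv - xv 24 * q4 xv := by
  simp only [gp, tl, rr, rawRules, mon_xv, List.getD_cons_succ, List.getD_cons_zero, List.map,
    List.prod_cons, List.prod_nil, List.sum_cons, List.sum_nil, one_zsmul, neg_zsmul]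
  unfold q0 q1 q2 q3 q4
  ring

lemma gp_13 : gp (rr 13) = xv 5 * q1 xv - xv 6 * q2 xv + xv 12 * q4 xv - xv 20 * q5 xv := by
  simp only [gp, tl, rr, rawRules, mon_xv, List.getD_cons_succ, List.getD_cons_zero, List.map,
    List.prod_cons, List.prod_nil, List.sum_cons, List.sum_nil, one_zsmul, neg_zsmul]
  unfold q1 q2 q4 q5
  ring

lemma gp_14 : gp (rr 14) = xv 3 * q1 xv - xv 6 * q3 xv + xv 10 * q4 xv - xv 18 * q5 xv := by
  simp only [gp, tl, rr, rawRules, mon_xv, List.getD_cons_succ, List.getD_cons_zero, List.map,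
    List.prod_cons, List.prod_nil, List.sum_cons, List.sum_nil, one_zsmul, neg_zsmul]
  unfold q1 q3 q4 q5
  ring

lemma gp_15 : gp (rr 15) = xv 3 * q2 xv - xv 5 * q3 xv + xv 9 * q4 xv - xv 17 * q5 xv := by
  simp only [gp, tl, rr, rawRules, mon_xv, List.getD_cons_succ, List.getD_cons_zero, List.map,
    List.prod_cons, List.prod_nil, List.sum_cons, List.sum_nil, one_zsmul, neg_zsmul]
  unfold q2 q3 q4 q5
  ring

lemma gp_16 : gp (rr 16) = xv 15 * q0 xv - xv 14 * q6 xv + xv 13 * q7 xv - xv 11 * q8 xv + xv 7 * q9 xv := by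
  simp only [gp, tl, rr, rawRules, mon_xv, List.getD_cons_succ, List.getD_cons_zero, List.map,
    List.prod_cons, List.prod_nil, List.sum_cons, List.sum_nil, one_zsmul, neg_zsmul]
  unfold q0 q6 q7 q8 q9
  ring

lemma gp_17 : gp (rr 17) = xv 23 * q0 xv - xv 22 * q6 xv + xv 21 * q7 xv - xv 19 * q8 xv + xv 7 * q10 xv := by
  simp only [gp, tl, rr, rawRules, mon_xv, List.getD_cons_succ, List.getD_cons_zero, List.map,
    List.prod_cons, List.prod_nil, List.sum_cons, List.sum_nil, one_zsmul, neg_zsmul]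
  unfold q0 q6 q7 q8 q10
  ring

lemma gp_18 : gp (rr 18) = -(xv 26 * q6 xv) + xv 25 * q7 xv - xv 19 * q9 xv + xv 11 * q10 xv := by
  simp only [gp, tl, rr, rawRules, mon_xv, List.getD_cons_succ, List.getD_cons_zero, List.map,
    List.prod_cons, List.prod_nil, List.sum_cons, List.sum_nil, one_zsmul, neg_zsmul]
  unfold q6 q7 q9 q10
  ring

lemma gp_19 : gp (rr 19) = -(xv 28 * q6 xv) + xv 25 * q8 xv - xv 21 * q9 xv + xv 13 * q10 xv := by
  simp only [gp, tl, rr, rawRules, mon_xv, List.getD_cons_succ, List.getD_cons_zero, List.map,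
    List.prod_cons, List.prod_nil, List.sum_cons, List.sum_nil, one_zsmul, neg_zsmul]
  unfold q6 q8 q9 q10
  ring

lemma gp_20 : gp (rr 20) = -(xv 28 * q7 xv) + xv 26 * q8 xv - xv 22 * q9 xv + xv 14 * q10 xv := by
  simp only [gp, tl, rr, rawRules, mon_xv, List.getD_cons_succ, List.getD_cons_zero, List.map,
    List.prod_cons, List.prod_nil, List.sum_cons, List.sum_nil, one_zsmul, neg_zsmul]
  unfold q7 q8 q9 q10
  ring

lemma two_cancel {J : Ideal R32} {a : R32} (h : 2 * a ∈ J) : a ∈ J := by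
  have h2 : (MvPolynomial.C (2⁻¹ : ℂ) : R32) * 2 = 1 := by
    have : (2 : R32) = MvPolynomial.C (2 : ℂ) := (map_ofNat MvPolynomial.C 2).symm
    rw [this, ← MvPolynomial.C_mul]
    simp
  have := J.mul_mem_left (MvPolynomial.C (2⁻¹ : ℂ)) h
  rwa [← mul_assoc, h2, one_mul] at this

lemma func_mem {J : Ideal R32} (l : Ext5 →ₗ[R32] R32) {w : Ext5}
    (h : w ∈ J • (⊤ : Submodule R32 Ext5)) : l w ∈ J := by
  induction h using Submodule.smul_induction_on' with
  | smul r hr n _ =>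
    rw [map_smul, smul_eq_mul]
    exact J.mul_mem_right _ hr
  | add x _ y _ hx hy =>
    rw [map_add]
    exact J.add_mem hx hy

/-- The scalar part. -/
def scal : Ext5 →ₗ[R32] R32 := ExteriorAlgebra.algebraMapInv.toLinearMap

lemma scal_one : scal 1 = 1 := map_one ExteriorAlgebra.algebraMapInv

/-- Coefficient of the top form. -/
def lt5 : Ext5 →ₗ[R32] R32 := scal ∘ₗ ctr 4 ∘ₗ ctr 3 ∘ₗ ctr 2 ∘ₗ ctr 1 ∘ₗ ctr 0

/-- Iterated contraction. -/
def lt4 (a b c d : Fin 5) : Ext5 →ₗ[R32] R32 := scal ∘ₗ ctr d ∘ₗ ctr c ∘ₗ ctr b ∘ₗ ctr a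

lemma lt5_top : lt5 top5 = 1 := by
  simp [lt5, top5, ctr_mul, ctr_e, ctr_one, scal_one]

/-- An ideal contains the eleven quadrics. -/
structure HasQ (J : Ideal R32) : Prop where
  m0 : q0 xv ∈ J
  m1 : q1 xv ∈ J
  m2 : q2 xv ∈ J
  m3 : q3 xv ∈ J
  m4 : q4 xv ∈ J
  m5 : q5 xv ∈ J
  m6 : q6 xv ∈ J
  m7 : q7 xv ∈ J
  m8 : q8 xv ∈ J
  m9 : q9 xv ∈ J
  m10 : q10 xv ∈ J

lemma hasQ_of {J : Ideal R32} (h1 : E1 ∈ J • (⊤ : Submodule R32 Ext5))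
    (h2 : E2 ∈ J • (⊤ : Submodule R32 Ext5))
    (h3 : ∀ r : Fin 5, E3 r ∈ J • (⊤ : Submodule R32 Ext5)) : HasQ J := by
  constructor
  · have := func_mem lt5 h1
    rwa [E1_eq, map_smul, lt5_top, smul_eq_mul, mul_one] at this
  · have := func_mem (lt4 1 2 3 4) h2
    rw [E2_eq] at this
    simp [lt4, ctr_mul, ctr_e, ctr_one, scal_one] at this
    exact two_cancel this
  · have := func_mem (lt4 0 2 3 4) h2
    rw [E2_eq] at this
    simp [lt4, ctr_mul, ctr_e, ctr_one, scal_one] at this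
    exact two_cancel this
  · have := func_mem (lt4 0 1 3 4) h2
    rw [E2_eq] at this
    simp [lt4, ctr_mul, ctr_e, ctr_one, scal_one] at this
    exact two_cancel this
  · have := func_mem (lt4 0 1 2 4) h2
    rw [E2_eq] at this
    simp [lt4, ctr_mul, ctr_e, ctr_one, scal_one] at this
    exact two_cancel this
  · have := func_mem (lt4 0 1 2 3) h2
    rw [E2_eq] at this
    simp [lt4, ctr_mul, ctr_e, ctr_one, scal_one] at this
    exact two_cancel this
  · have := func_mem lt5 (h3 0)
    rw [E3_eq0, map_smul, lt5_top, smul_eq_mul, mul_one] at this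
    exact two_cancel this
  · have := func_mem lt5 (h3 1)
    rw [E3_eq1, map_smul, lt5_top, smul_eq_mul, mul_one] at this
    exact two_cancel this
  · have := func_mem lt5 (h3 2)
    rw [E3_eq2, map_smul, lt5_top, smul_eq_mul, mul_one] at this
    exact two_cancel this
  · have := func_mem lt5 (h3 3)
    rw [E3_eq3, map_smul, lt5_top, smul_eq_mul, mul_one] at this
    exact two_cancel this
  · have := func_mem lt5 (h3 4)
    rw [E3_eq4, map_smul, lt5_top, smul_eq_mul, mul_one] at this
    exact two_cancel this

lemma J0_le {J : Ideal R32} (h : HasQ J) : J0 ≤ J := by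
  unfold J0
  rw [Ideal.span_le]
  rintro g ⟨r, hr, rfl⟩
  obtain ⟨k, hk, rfl⟩ := exists_rr hr
  obtain ⟨m0, m1, m2, m3, m4, m5, m6, m7, m8, m9, m10⟩ := h
  rw [SetLike.mem_coe]
  interval_cases k
  · rw [gp_0]
    exact neg_mem m0
  · rw [gp_1]
    exact neg_mem m1
  · rw [gp_2]
    exact neg_mem m2
  · rw [gp_3]
    exact m3
  · rw [gp_4]
    exact m4
  · rw [gp_5]
    exact m5
  · rw [gp_6]
    exact m6
  · rw [gp_7]
    exact m7
  · rw [gp_8]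
    exact neg_mem m8
  · rw [gp_9]
    exact m9
  · rw [gp_10]
    exact m10
  · rw [gp_11]
    exact (sub_mem (add_mem (sub_mem (add_mem (neg_mem (J.mul_mem_left _ m0)) (J.mul_mem_left _ m1)) (J.mul_mem_left _ m2)) (J.mul_mem_left _ m3)) (J.mul_mem_left _ m5))
  · rw [gp_12]
    exact (sub_mem (add_mem (sub_mem (add_mem (neg_mem (J.mul_mem_left _ m0)) (J.mul_mem_left _ m1)) (J.mul_mem_left _ m2)) (J.mul_mem_left _ m3)) (J.mul_mem_left _ m4))
  · rw [gp_13]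
    exact (sub_mem (add_mem (sub_mem (J.mul_mem_left _ m1) (J.mul_mem_left _ m2)) (J.mul_mem_left _ m4)) (J.mul_mem_left _ m5))
  · rw [gp_14]
    exact (sub_mem (add_mem (sub_mem (J.mul_mem_left _ m1) (J.mul_mem_left _ m3)) (J.mul_mem_left _ m4)) (J.mul_mem_left _ m5))
  · rw [gp_15]
    exact (sub_mem (add_mem (sub_mem (J.mul_mem_left _ m2) (J.mul_mem_left _ m3)) (J.mul_mem_left _ m4)) (J.mul_mem_left _ m5))
  · rw [gp_16]
    exact (add_mem (sub_mem (add_mem (sub_mem (J.mul_mem_left _ m0) (J.mul_mem_left _ m6)) (J.mul_mem_left _ m7)) (J.mul_mem_left _ m8)) (J.mul_mem_left _ m9))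
  · rw [gp_17]
    exact (add_mem (sub_mem (add_mem (sub_mem (J.mul_mem_left _ m0) (J.mul_mem_left _ m6)) (J.mul_mem_left _ m7)) (J.mul_mem_left _ m8)) (J.mul_mem_left _ m10))
  · rw [gp_18]
    exact (add_mem (sub_mem (add_mem (neg_mem (J.mul_mem_left _ m6)) (J.mul_mem_left _ m7)) (J.mul_mem_left _ m9)) (J.mul_mem_left _ m10))
  · rw [gp_19]
    exact (add_mem (sub_mem (add_mem (neg_mem (J.mul_mem_left _ m6)) (J.mul_mem_left _ m8)) (J.mul_mem_left _ m9)) (J.mul_mem_left _ m10))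
  · rw [gp_20]
    exact (add_mem (sub_mem (add_mem (neg_mem (J.mul_mem_left _ m7)) (J.mul_mem_left _ m8)) (J.mul_mem_left _ m9)) (J.mul_mem_left _ m10))

lemma hasQ_J0 : HasQ J0 := by
  have h : ∀ k < 21, gp (rr k) ∈ J0 := fun k hk => Ideal.subset_span ⟨rr k, rr_mem k hk, rfl⟩
  constructor
  · have := h 0 (by norm_num)
    rw [gp_0] at this
    simpa using this
  · have := h 1 (by norm_num)
    rw [gp_1] at this
    simpa using this
  · have := h 2 (by norm_num)
    rw [gp_2] at this
    simpa using this
  · have := h 3 (by norm_num)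
    rw [gp_3] at this
    exact this
  · have := h 4 (by norm_num)
    rw [gp_4] at this
    exact this
  · have := h 5 (by norm_num)
    rw [gp_5] at this
    exact this
  · have := h 6 (by norm_num)
    rw [gp_6] at this
    exact this
  · have := h 7 (by norm_num)
    rw [gp_7] at this
    exact this
  · have := h 8 (by norm_num)
    rw [gp_8] at this
    simpa using this
  · have := h 9 (by norm_num)
    rw [gp_9] at this
    exact this
  · have := h 10 (by norm_num)
    rw [gp_10] at this
    exact this

lemma Igrav_eq : Igrav = J0 := by
  apply le_antisymm
  · apply sInf_le
    obtain ⟨m0, m1, m2, m3, m4, m5, m6, m7, m8, m9, m10⟩ := hasQ_J0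
    have hs : ∀ (a : R32) (w : Ext5), a ∈ J0 → a • w ∈ J0 • (⊤ : Submodule R32 Ext5) :=
      fun a w ha => Submodule.smul_mem_smul ha trivial
    refine ⟨?_, ?_, ?_⟩
    · rw [E1_eq]
      exact hs _ _ m0
    · rw [E2_eq]
      exact add_mem (add_mem (add_mem (add_mem (hs _ _ (J0.mul_mem_left _ m1))
        (hs _ _ (J0.mul_mem_left _ m2))) (hs _ _ (J0.mul_mem_left _ m3)))
        (hs _ _ (J0.mul_mem_left _ m4))) (hs _ _ (J0.mul_mem_left _ m5))
    · intro r
      fin_cases r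
      · have := hs _ top5 (J0.mul_mem_left 2 m6)
        rwa [← E3_eq0] at this
      · have := hs _ top5 (J0.mul_mem_left 2 m7)
        rwa [← E3_eq1] at this
      · have := hs _ top5 (J0.mul_mem_left 2 m8)
        rwa [← E3_eq2] at this
      · have := hs _ top5 (J0.mul_mem_left 2 m9)
        rwa [← E3_eq3] at this
      · have := hs _ top5 (J0.mul_mem_left 2 m10)
        rwa [← E3_eq4] at this
  · apply le_sInf
    rintro J ⟨h1, h2, h3⟩
    exact J0_le (hasQ_of h1 h2 h3)

end Grav


namespace Grav

/-! ## The parametrization -/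

section
variable {A : Type*} [CommRing A] (x : ℕ → A)

/-- A component of `λ₀ λ₃ - λ₁ ∧ λ₂`. -/
def m123 : A := x 0 * x 7 - x 1 * x 6 + x 2 * x 5 - x 3 * x 4

/-- A component of `λ₀ λ₃ - λ₁ ∧ λ₂`. -/
def m124 : A := x 0 * x 11 - x 1 * x 10 + x 2 * x 9 - x 3 * x 8

/-- A component of `λ₀ λ₃ - λ₁ ∧ λ₂`. -/
def m125 : A := x 0 * x 19 - x 1 * x 18 + x 2 * x 17 - x 3 * x 16

/-- A component of `λ₀ λ₃ - λ₁ ∧ λ₂`. -/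
def m134 : A := x 0 * x 13 - x 1 * x 12 + x 4 * x 9 - x 5 * x 8

/-- A component of `λ₀ λ₃ - λ₁ ∧ λ₂`. -/
def m135 : A := x 0 * x 21 - x 1 * x 20 + x 4 * x 17 - x 5 * x 16

/-- A component of `λ₀ λ₃ - λ₁ ∧ λ₂`. -/
def m145 : A := x 0 * x 25 - x 1 * x 24 + x 8 * x 17 - x 9 * x 16

/-- A component of `λ₀ λ₃ - λ₁ ∧ λ₂`. -/
def m234 : A := x 0 * x 14 - x 2 * x 12 + x 4 * x 10 - x 6 * x 8

/-- A component of `λ₀ λ₃ - λ₁ ∧ λ₂`. -/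
def m235 : A := x 0 * x 22 - x 2 * x 20 + x 4 * x 18 - x 6 * x 16

/-- A component of `λ₀ λ₃ - λ₁ ∧ λ₂`. -/
def m245 : A := x 0 * x 26 - x 2 * x 24 + x 8 * x 18 - x 10 * x 16

/-- A component of `λ₀ λ₃ - λ₁ ∧ λ₂`. -/
def m345 : A := x 0 * x 28 - x 4 * x 24 + x 8 * x 20 - x 12 * x 16

/-- A Pluecker relation. -/
def pl1 : A := m123 x * m145 x - m124 x * m135 x + m134 x * m125 x

/-- A Pluecker relation. -/
def pl2 : A := m123 x * m245 x - m124 x * m235 x + m234 x * m125 x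

/-- A Pluecker relation. -/
def pl3 : A := m123 x * m345 x - m134 x * m235 x + m234 x * m135 x

/-- A Pluecker relation. -/
def pl4 : A := m124 x * m345 x - m134 x * m245 x + m234 x * m145 x

/-- A Pluecker relation. -/
def pl5 : A := m125 x * m345 x - m135 x * m245 x + m235 x * m145 x

lemma id_1 : pl1 x =
    x 0 ^ 2 * q6 x + x 0 * x 1 * q0 x + (x 1 * x 1) * q1 x + (-(x 0 * x 3) - x 1 * x 2) * q2 x
    + (x 0 * x 5 + x 1 * x 4) * q3 x + (-(x 0 * x 9) - x 1 * x 8) * q4 x + (x 0 * x 17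
    + x 1 * x 16) * q5 x := by
  unfold pl1 m123 m145 m124 m135 m134 m125 q6 q0 q1 q2 q3 q4 q5
  ring

lemma id_2 : pl2 x =
    x 0 ^ 2 * q7 x + x 0 * x 2 * q0 x + (-(x 0 * x 3) + x 1 * x 2) * q1 x
    + (-(x 2 * x 2)) * q2 x + (x 0 * x 6 + x 2 * x 4) * q3 x + (-(x 0 * x 10)
    - x 2 * x 8) * q4 x + (x 0 * x 18 + x 2 * x 16) * q5 x := by
  unfold pl2 m123 m245 m124 m235 m234 m125 q7 q0 q1 q2 q3 q4 q5
  ring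

lemma id_3 : pl3 x =
    x 0 ^ 2 * q8 x + x 0 * x 4 * q0 x + (-(x 0 * x 5) + x 1 * x 4) * q1 x + (x 0 * x 6
    - x 2 * x 4) * q2 x + (x 4 * x 4) * q3 x + (-(x 0 * x 12) - x 4 * x 8) * q4 x + (x 0 * x 20
    + x 4 * x 16) * q5 x := by
  unfold pl3 m123 m345 m134 m235 m234 m135 q8 q0 q1 q2 q3 q4 q5
  ring

lemma id_4 : pl4 x =
    x 0 ^ 2 * q9 x + x 0 * x 8 * q0 x + (-(x 0 * x 9) + x 1 * x 8) * q1 x + (x 0 * x 10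
    - x 2 * x 8) * q2 x + (-(x 0 * x 12) + x 4 * x 8) * q3 x + (-(x 8 * x 8)) * q4 x
    + (x 0 * x 24 + x 8 * x 16) * q5 x := by
  unfold pl4 m124 m345 m134 m245 m234 m145 q9 q0 q1 q2 q3 q4 q5
  ring

lemma id_5 : pl5 x =
    x 0 ^ 2 * q10 x + x 0 * x 16 * q0 x + (-(x 0 * x 17) + x 1 * x 16) * q1 x + (x 0 * x 18
    - x 2 * x 16) * q2 x + (-(x 0 * x 20) + x 4 * x 16) * q3 x + (x 0 * x 24
    - x 8 * x 16) * q4 x + (x 16 * x 16) * q5 x := by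
  unfold pl5 m125 m345 m135 m245 m235 m145 q10 q0 q1 q2 q3 q4 q5
  ring

lemma id_m4 : m123 x * pl4 x = m124 x * pl3 x - m134 x * pl2 x + m234 x * pl1 x := by
  unfold pl1 pl2 pl3 pl4
  ring

lemma id_m5 : m123 x * pl5 x = m125 x * pl3 x - m135 x * pl2 x + m235 x * pl1 x := by
  unfold pl1 pl2 pl3 pl5
  ring

end

/-- The free variables. -/
def free : List ℕ :=
  [0, 1, 2, 3, 4, 5, 6, 7, 8, 9, 10, 11, 12, 13, 14, 16, 17, 18, 19, 20, 21, 22, 24]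

lemma exists_sol {K : Type*} [Field K] (z : ℕ → K) (h0 : z 0 ≠ 0) (hm : m123 z ≠ 0) :
    ∃ y : ℕ → K, (∀ n ∈ free, y n = z n) ∧ q0 y = 0 ∧ q1 y = 0 ∧ q2 y = 0 ∧ q3 y = 0 ∧
      q4 y = 0 ∧ q5 y = 0 ∧ q6 y = 0 ∧ q7 y = 0 ∧ q8 y = 0 ∧ q9 y = 0 ∧ q10 y = 0 := by
  obtain ⟨a25, h25⟩ : ∃ a, m123 z * (z 0 * a + (-(z 1 * z 24) + z 8 * z 17 - z 9 * z 16)) = m124 z * m135 z - m134 z * m125 z :=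
    ⟨((m124 z * m135 z - m134 z * m125 z) / m123 z - (-(z 1 * z 24) + z 8 * z 17 - z 9 * z 16)) / z 0, by field_simp; ring⟩
  obtain ⟨a26, h26⟩ : ∃ a, m123 z * (z 0 * a + (-(z 2 * z 24) + z 8 * z 18 - z 10 * z 16)) = m124 z * m235 z - m234 z * m125 z :=
    ⟨((m124 z * m235 z - m234 z * m125 z) / m123 z - (-(z 2 * z 24) + z 8 * z 18 - z 10 * z 16)) / z 0, by field_simp; ring⟩
  obtain ⟨a28, h28⟩ : ∃ a, m123 z * (z 0 * a + (-(z 4 * z 24) + z 8 * z 20 - z 12 * z 16)) = m134 z * m235 z - m234 z * m135 z :=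
    ⟨((m134 z * m235 z - m234 z * m135 z) / m123 z - (-(z 4 * z 24) + z 8 * z 20 - z 12 * z 16)) / z 0, by field_simp; ring⟩
  obtain ⟨a30, h30⟩ : ∃ a, z 0 * a =
      -(z 2 * a28) + z 4 * a26 - z 8 * z 22 + z 14 * z 16 + z 6 * z 24 - z 10 * z 20
      + z 12 * z 18 :=
    ⟨_, mul_div_cancel₀ _ h0⟩
  obtain ⟨a29, h29⟩ : ∃ a, z 0 * a =
      -(z 1 * a28) + z 4 * a25 - z 8 * z 21 + z 13 * z 16 + z 5 * z 24 - z 9 * z 20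
      + z 12 * z 17 :=
    ⟨_, mul_div_cancel₀ _ h0⟩
  obtain ⟨a27, h27⟩ : ∃ a, z 0 * a =
      -(z 1 * a26) + z 2 * a25 - z 8 * z 19 + z 11 * z 16 + z 3 * z 24 - z 9 * z 18
      + z 10 * z 17 :=
    ⟨_, mul_div_cancel₀ _ h0⟩
  obtain ⟨a23, h23⟩ : ∃ a, z 0 * a =
      -(z 1 * z 22) + z 2 * z 21 - z 4 * z 19 + z 7 * z 16 + z 3 * z 20 - z 5 * z 18
      + z 6 * z 17 :=
    ⟨_, mul_div_cancel₀ _ h0⟩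
  obtain ⟨a15, h15⟩ : ∃ a, z 0 * a =
      -(z 1 * z 14) + z 2 * z 13 - z 4 * z 11 + z 7 * z 8 + z 3 * z 12 - z 5 * z 10 + z 6 * z 9 :=
    ⟨_, mul_div_cancel₀ _ h0⟩
  obtain ⟨a31, h31⟩ : ∃ a, z 0 * a = -(
      z 1 * a30 - z 2 * a29 + z 4 * a27 - z 8 * a23 + a15 * z 16 - z 3 * a28 + z 5 * a26
      - z 6 * a25 - z 9 * z 22 + z 10 * z 21 - z 12 * z 19 + z 14 * z 17 - z 13 * z 18
      + z 11 * z 20 - z 7 * z 24) :=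
    ⟨_, mul_div_cancel₀ _ h0⟩
  obtain ⟨y, hy, y25, y26, y28, y30, y29, y27, y23, y15, y31⟩ : ∃ y : ℕ → K, (∀ n ∈ free, y n = z n) ∧ y 25 = a25 ∧ y 26 = a26 ∧ y 28 = a28 ∧ y 30 = a30 ∧ y 29 = a29 ∧ y 27 = a27 ∧ y 23 = a23 ∧ y 15 = a15 ∧ y 31 = a31 :=
    ⟨fun n => if n = 25 then a25 else if n = 26 then a26 else if n = 28 then a28 else if n = 30 then a30 else if n = 29 then a29 else if n = 27 then a27 else if n = 23 then a23 else if n = 15 then a15 else if n = 31 then a31 else z n, by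
      simp [free], by simp⟩
  have y0 : y 0 = z 0 := hy 0 (by decide)
  have y1 : y 1 = z 1 := hy 1 (by decide)
  have y2 : y 2 = z 2 := hy 2 (by decide)
  have y3 : y 3 = z 3 := hy 3 (by decide)
  have y4 : y 4 = z 4 := hy 4 (by decide)
  have y5 : y 5 = z 5 := hy 5 (by decide)
  have y6 : y 6 = z 6 := hy 6 (by decide)
  have y7 : y 7 = z 7 := hy 7 (by decide)
  have y8 : y 8 = z 8 := hy 8 (by decide)
  have y9 : y 9 = z 9 := hy 9 (by decide)
  have y10 : y 10 = z 10 := hy 10 (by decide)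
  have y11 : y 11 = z 11 := hy 11 (by decide)
  have y12 : y 12 = z 12 := hy 12 (by decide)
  have y13 : y 13 = z 13 := hy 13 (by decide)
  have y14 : y 14 = z 14 := hy 14 (by decide)
  have y16 : y 16 = z 16 := hy 16 (by decide)
  have y17 : y 17 = z 17 := hy 17 (by decide)
  have y18 : y 18 = z 18 := hy 18 (by decide)
  have y19 : y 19 = z 19 := hy 19 (by decide)
  have y20 : y 20 = z 20 := hy 20 (by decide)
  have y21 : y 21 = z 21 := hy 21 (by decide)
  have y22 : y 22 = z 22 := hy 22 (by decide)
  have y24 : y 24 = z 24 := hy 24 (by decide)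
  have e0 : q0 y = 0 := by
    unfold q0
    simp only [y0, y1, y2, y3, y4, y5, y6, y7, y8, y9, y10, y11, y12, y13, y14, y15, y16, y17, y18, y19, y20, y21, y22, y23, y24, y25, y26, y27, y28, y29, y30, y31]
    linear_combination h31
  have e1 : q1 y = 0 := by
    unfold q1
    simp only [y0, y1, y2, y3, y4, y5, y6, y7, y8, y9, y10, y11, y12, y13, y14, y15, y16, y17, y18, y19, y20, y21, y22, y23, y24, y25, y26, y27, y28, y29, y30, y31]
    linear_combination -h30
  have e2 : q2 y = 0 := by
    unfold q2
    simp only [y0, y1, y2, y3, y4, y5, y6, y7, y8, y9, y10, y11, y12, y13, y14, y15, y16, y17, y18, y19, y20, y21, y22, y23, y24, y25, y26, y27, y28, y29, y30, y31]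
    linear_combination -h29
  have e3 : q3 y = 0 := by
    unfold q3
    simp only [y0, y1, y2, y3, y4, y5, y6, y7, y8, y9, y10, y11, y12, y13, y14, y15, y16, y17, y18, y19, y20, y21, y22, y23, y24, y25, y26, y27, y28, y29, y30, y31]
    linear_combination -h27
  have e4 : q4 y = 0 := by
    unfold q4
    simp only [y0, y1, y2, y3, y4, y5, y6, y7, y8, y9, y10, y11, y12, y13, y14, y15, y16, y17, y18, y19, y20, y21, y22, y23, y24, y25, y26, y27, y28, y29, y30, y31]
    linear_combination -h23
  have e5 : q5 y = 0 := by
    unfold q5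
    simp only [y0, y1, y2, y3, y4, y5, y6, y7, y8, y9, y10, y11, y12, y13, y14, y15, y16, y17, y18, y19, y20, y21, y22, y23, y24, y25, y26, y27, y28, y29, y30, y31]
    linear_combination -h15
  have p1 : pl1 y = 0 := by
    unfold pl1
    unfold m123 m124 m125 m134 m135 at h25
    unfold m123 m124 m125 m134 m135 m145
    simp only [y0, y1, y2, y3, y4, y5, y6, y7, y8, y9, y10, y11, y12, y13, y14, y15, y16, y17, y18, y19, y20, y21, y22, y23, y24, y25, y26, y27, y28, y29, y30, y31]
    linear_combination h25
  have p2 : pl2 y = 0 := by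
    unfold pl2
    unfold m123 m124 m125 m234 m235 at h26
    unfold m123 m124 m125 m234 m235 m245
    simp only [y0, y1, y2, y3, y4, y5, y6, y7, y8, y9, y10, y11, y12, y13, y14, y15, y16, y17, y18, y19, y20, y21, y22, y23, y24, y25, y26, y27, y28, y29, y30, y31]
    linear_combination h26
  have p3 : pl3 y = 0 := by
    unfold pl3
    unfold m123 m134 m135 m234 m235 at h28
    unfold m123 m134 m135 m234 m235 m345
    simp only [y0, y1, y2, y3, y4, y5, y6, y7, y8, y9, y10, y11, y12, y13, y14, y15, y16, y17, y18, y19, y20, y21, y22, y23, y24, y25, y26, y27, y28, y29, y30, y31]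
    linear_combination h28
  have hm' : m123 y ≠ 0 := by
    have : m123 y = m123 z := by
      unfold m123
      simp only [y0, y1, y2, y3, y4, y5, y6, y7, y8, y9, y10, y11, y12, y13, y14, y15, y16, y17, y18, y19, y20, y21, y22, y23, y24, y25, y26, y27, y28, y29, y30, y31]
    rwa [this]
  have h0' : y 0 ^ 2 ≠ 0 := by
    rw [y0]
    exact pow_ne_zero 2 h0
  have p4 : pl4 y = 0 := by
    refine (mul_eq_zero.1 ?_).resolve_left hm'
    rw [id_m4, p1, p2, p3]
    ring
  have p5 : pl5 y = 0 := by
    refine (mul_eq_zero.1 ?_).resolve_left hm'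
    rw [id_m5, p1, p2, p3]
    ring
  have e6 : q6 y = 0 := by
    have h := id_1 y
    rw [p1, e0, e1, e2, e3, e4, e5] at h
    simp only [mul_zero, add_zero] at h
    exact (mul_eq_zero.1 h.symm).resolve_left h0'
  have e7 : q7 y = 0 := by
    have h := id_2 y
    rw [p2, e0, e1, e2, e3, e4, e5] at h
    simp only [mul_zero, add_zero] at h
    exact (mul_eq_zero.1 h.symm).resolve_left h0'
  have e8 : q8 y = 0 := by
    have h := id_3 y
    rw [p3, e0, e1, e2, e3, e4, e5] at h
    simp only [mul_zero, add_zero] at h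
    exact (mul_eq_zero.1 h.symm).resolve_left h0'
  have e9 : q9 y = 0 := by
    have h := id_4 y
    rw [p4, e0, e1, e2, e3, e4, e5] at h
    simp only [mul_zero, add_zero] at h
    exact (mul_eq_zero.1 h.symm).resolve_left h0'
  have e10 : q10 y = 0 := by
    have h := id_5 y
    rw [p5, e0, e1, e2, e3, e4, e5] at h
    simp only [mul_zero, add_zero] at h
    exact (mul_eq_zero.1 h.symm).resolve_left h0'
  exact ⟨y, hy, e0, e1, e2, e3, e4, e5, e6, e7, e8, e9, e10⟩

lemma pl1_mem {J : Ideal R32} (h : HasQ J) : pl1 xv ∈ J := by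
  rw [id_1]
  exact (add_mem (add_mem (add_mem (add_mem (add_mem (add_mem (J.mul_mem_left _ h.m6) (J.mul_mem_left _ h.m0))
      (J.mul_mem_left _ h.m1))
      (J.mul_mem_left _ h.m2))
      (J.mul_mem_left _ h.m3))
      (J.mul_mem_left _ h.m4))
      (J.mul_mem_left _ h.m5))

lemma pl2_mem {J : Ideal R32} (h : HasQ J) : pl2 xv ∈ J := by
  rw [id_2]
  exact (add_mem (add_mem (add_mem (add_mem (add_mem (add_mem (J.mul_mem_left _ h.m7) (J.mul_mem_left _ h.m0))
      (J.mul_mem_left _ h.m1))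
      (J.mul_mem_left _ h.m2))
      (J.mul_mem_left _ h.m3))
      (J.mul_mem_left _ h.m4))
      (J.mul_mem_left _ h.m5))

lemma pl3_mem {J : Ideal R32} (h : HasQ J) : pl3 xv ∈ J := by
  rw [id_3]
  exact (add_mem (add_mem (add_mem (add_mem (add_mem (add_mem (J.mul_mem_left _ h.m8) (J.mul_mem_left _ h.m0))
      (J.mul_mem_left _ h.m1))
      (J.mul_mem_left _ h.m2))
      (J.mul_mem_left _ h.m3))
      (J.mul_mem_left _ h.m4))
      (J.mul_mem_left _ h.m5))

end Grav


namespace Grav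

/-! ## Localization and conclusion -/

open MvPolynomial

/-- The polynomials in the free variables. -/
def Bf : Subalgebra ℂ R32 := Algebra.adjoin ℂ {f | ∃ n ∈ free, f = xv n}

lemma xv_mem_Bf {n : ℕ} (h : n ∈ free) : xv n ∈ Bf := Algebra.subset_adjoin ⟨n, h, rfl⟩

lemma m123_mem_Bf : m123 xv ∈ Bf := by
  unfold m123
  exact sub_mem (add_mem (sub_mem
    (mul_mem (xv_mem_Bf (by decide)) (xv_mem_Bf (by decide)))
    (mul_mem (xv_mem_Bf (by decide)) (xv_mem_Bf (by decide))))
    (mul_mem (xv_mem_Bf (by decide)) (xv_mem_Bf (by decide))))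
    (mul_mem (xv_mem_Bf (by decide)) (xv_mem_Bf (by decide)))

/-- The denominator. -/
def hh : R32 := xv 0 * m123 xv

lemma hh_mem : hh ∈ Bf := mul_mem (xv_mem_Bf (by decide)) m123_mem_Bf

lemma gp_hraw : gp hraw = -hh := by
  simp only [gp, tl, hraw, mon_xv, List.map,
    List.prod_cons, List.prod_nil, List.sum_cons, List.sum_nil, one_zsmul, neg_zsmul]
  unfold hh m123
  ring

lemma nzd_hh {f : R32} (h : hh * f ∈ J0) : f ∈ J0 := by
  apply nzd
  rw [gp_hraw]
  have := neg_mem h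
  rwa [← mul_neg, mul_comm, neg_mul_comm, mul_comm, mul_comm (-hh)] at this

lemma nzd_pow (k : ℕ) {f : R32} (h : hh ^ k * f ∈ J0) : f ∈ J0 := by
  induction k with
  | zero => simpa using h
  | succ k ih =>
    apply ih
    apply nzd_hh
    rwa [pow_succ', mul_assoc] at h

/-- Elements which become polynomials in the free variables after multiplication by a power of
`hh`, modulo `J0`. -/
def Tf : Subalgebra ℂ R32 where
  carrier := {f | ∃ k : ℕ, ∃ g ∈ Bf, hh ^ k * f - g ∈ J0}
  algebraMap_mem' c := ⟨0, algebraMap ℂ R32 c, Bf.algebraMap_mem c, by simp⟩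
  add_mem' := by
    rintro f f' ⟨k, g, hg, h⟩ ⟨k', g', hg', h'⟩
    refine ⟨k + k', hh ^ k' * g + hh ^ k * g', add_mem (mul_mem (pow_mem hh_mem _) hg)
      (mul_mem (pow_mem hh_mem _) hg'), ?_⟩
    have := add_mem (J0.mul_mem_left (hh ^ k') h) (J0.mul_mem_left (hh ^ k) h')
    convert this using 1
    ring
  mul_mem' := by
    rintro f f' ⟨k, g, hg, h⟩ ⟨k', g', hg', h'⟩
    refine ⟨k + k', g * g', mul_mem hg hg', ?_⟩
    have := add_mem (J0.mul_mem_left (hh ^ k * f) h') (J0.mul_mem_left g' h)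
    convert this using 1
    ring

lemma mem_Tf {f : R32} : f ∈ Tf ↔ ∃ k : ℕ, ∃ g ∈ Bf, hh ^ k * f - g ∈ J0 := Iff.rfl

lemma Tf_congr {a b : R32} (hb : b ∈ J0) (h : a + b ∈ Tf) : a ∈ Tf := by
  obtain ⟨k, g, hg, h⟩ := mem_Tf.1 h
  refine mem_Tf.2 ⟨k, g, hg, ?_⟩
  have := sub_mem h (J0.mul_mem_left (hh ^ k) hb)
  convert this using 1
  ring

lemma Tf_cancel_zero {a : R32} (h : xv 0 * a ∈ Tf) : a ∈ Tf := by
  obtain ⟨k, g, hg, h⟩ := mem_Tf.1 h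
  refine mem_Tf.2 ⟨k + 1, m123 xv * g, mul_mem m123_mem_Bf hg, ?_⟩
  have := J0.mul_mem_left (m123 xv) h
  convert this using 1
  rw [pow_succ]
  nth_rewrite 2 [hh]
  ring

lemma Tf_cancel_m {a : R32} (h : m123 xv * a ∈ Tf) : a ∈ Tf := by
  obtain ⟨k, g, hg, h⟩ := mem_Tf.1 h
  refine mem_Tf.2 ⟨k + 1, xv 0 * g, mul_mem (xv_mem_Bf (by decide)) hg, ?_⟩
  have := J0.mul_mem_left (xv 0) h
  convert this using 1
  rw [pow_succ]
  nth_rewrite 2 [hh]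
  ring

lemma xv_mem_Tf_free {n : ℕ} (h : n ∈ free) : xv n ∈ Tf :=
  mem_Tf.2 ⟨0, xv n, xv_mem_Bf h, by simp⟩

lemma Ta {a b : R32} (ha : a ∈ Tf) (hb : b ∈ Tf) : a + b ∈ Tf := add_mem ha hb

lemma Ts {a b : R32} (ha : a ∈ Tf) (hb : b ∈ Tf) : a - b ∈ Tf := sub_mem ha hb

lemma Tn {a : R32} (ha : a ∈ Tf) : -a ∈ Tf := neg_mem ha

lemma Tm {a b : R32} (ha : a ∈ Tf) (hb : b ∈ Tf) : a * b ∈ Tf := mul_mem ha hb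

lemma x0 : xv 0 ∈ Tf := xv_mem_Tf_free (by decide)

lemma x1 : xv 1 ∈ Tf := xv_mem_Tf_free (by decide)

lemma x2 : xv 2 ∈ Tf := xv_mem_Tf_free (by decide)

lemma x3 : xv 3 ∈ Tf := xv_mem_Tf_free (by decide)

lemma x4 : xv 4 ∈ Tf := xv_mem_Tf_free (by decide)

lemma x5 : xv 5 ∈ Tf := xv_mem_Tf_free (by decide)

lemma x6 : xv 6 ∈ Tf := xv_mem_Tf_free (by decide)

lemma x7 : xv 7 ∈ Tf := xv_mem_Tf_free (by decide)

lemma x8 : xv 8 ∈ Tf := xv_mem_Tf_free (by decide)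

lemma x9 : xv 9 ∈ Tf := xv_mem_Tf_free (by decide)

lemma x10 : xv 10 ∈ Tf := xv_mem_Tf_free (by decide)

lemma x11 : xv 11 ∈ Tf := xv_mem_Tf_free (by decide)

lemma x12 : xv 12 ∈ Tf := xv_mem_Tf_free (by decide)

lemma x13 : xv 13 ∈ Tf := xv_mem_Tf_free (by decide)

lemma x14 : xv 14 ∈ Tf := xv_mem_Tf_free (by decide)

lemma x16 : xv 16 ∈ Tf := xv_mem_Tf_free (by decide)

lemma x17 : xv 17 ∈ Tf := xv_mem_Tf_free (by decide)

lemma x18 : xv 18 ∈ Tf := xv_mem_Tf_free (by decide)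

lemma x19 : xv 19 ∈ Tf := xv_mem_Tf_free (by decide)

lemma x20 : xv 20 ∈ Tf := xv_mem_Tf_free (by decide)

lemma x21 : xv 21 ∈ Tf := xv_mem_Tf_free (by decide)

lemma x22 : xv 22 ∈ Tf := xv_mem_Tf_free (by decide)

lemma x24 : xv 24 ∈ Tf := xv_mem_Tf_free (by decide)

lemma n124 : m124 xv ∈ Tf := by
  unfold m124
  exact Ts (Ta (Ts (Tm x0 x11) (Tm x1 x10)) (Tm x2 x9)) (Tm x3 x8)

lemma n125 : m125 xv ∈ Tf := by
  unfold m125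
  exact Ts (Ta (Ts (Tm x0 x19) (Tm x1 x18)) (Tm x2 x17)) (Tm x3 x16)

lemma n134 : m134 xv ∈ Tf := by
  unfold m134
  exact Ts (Ta (Ts (Tm x0 x13) (Tm x1 x12)) (Tm x4 x9)) (Tm x5 x8)

lemma n135 : m135 xv ∈ Tf := by
  unfold m135
  exact Ts (Ta (Ts (Tm x0 x21) (Tm x1 x20)) (Tm x4 x17)) (Tm x5 x16)

lemma n234 : m234 xv ∈ Tf := by
  unfold m234
  exact Ts (Ta (Ts (Tm x0 x14) (Tm x2 x12)) (Tm x4 x10)) (Tm x6 x8)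

lemma n235 : m235 xv ∈ Tf := by
  unfold m235
  exact Ts (Ta (Ts (Tm x0 x22) (Tm x2 x20)) (Tm x4 x18)) (Tm x6 x16)

lemma n145 : m145 xv ∈ Tf := by
  apply Tf_cancel_m
  refine Tf_congr (neg_mem (pl1_mem hasQ_J0)) ?_
  have : m123 xv * m145 xv + -pl1 xv = m124 xv * m135 xv - m134 xv * m125 xv := by
    unfold pl1
    ring
  rw [this]
  exact Ts (Tm n124 n135) (Tm n134 n125)

lemma x25 : xv 25 ∈ Tf := by
  apply Tf_cancel_zero
  have : xv 0 * xv 25 = m145 xv - (-(xv 1 * xv 24) + xv 8 * xv 17 - xv 9 * xv 16) := by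
    unfold m145
    ring
  rw [this]
  exact Ts n145 (Ts (Ta (Tn (Tm x1 x24)) (Tm x8 x17)) (Tm x9 x16))

lemma n245 : m245 xv ∈ Tf := by
  apply Tf_cancel_m
  refine Tf_congr (neg_mem (pl2_mem hasQ_J0)) ?_
  have : m123 xv * m245 xv + -pl2 xv = m124 xv * m235 xv - m234 xv * m125 xv := by
    unfold pl2
    ring
  rw [this]
  exact Ts (Tm n124 n235) (Tm n234 n125)

lemma x26 : xv 26 ∈ Tf := by
  apply Tf_cancel_zero
  have : xv 0 * xv 26 = m245 xv - (-(xv 2 * xv 24) + xv 8 * xv 18 - xv 10 * xv 16) := by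
    unfold m245
    ring
  rw [this]
  exact Ts n245 (Ts (Ta (Tn (Tm x2 x24)) (Tm x8 x18)) (Tm x10 x16))

lemma n345 : m345 xv ∈ Tf := by
  apply Tf_cancel_m
  refine Tf_congr (neg_mem (pl3_mem hasQ_J0)) ?_
  have : m123 xv * m345 xv + -pl3 xv = m134 xv * m235 xv - m234 xv * m135 xv := by
    unfold pl3
    ring
  rw [this]
  exact Ts (Tm n134 n235) (Tm n234 n135)

lemma x28 : xv 28 ∈ Tf := by
  apply Tf_cancel_zero
  have : xv 0 * xv 28 = m345 xv - (-(xv 4 * xv 24) + xv 8 * xv 20 - xv 12 * xv 16) := by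
    unfold m345
    ring
  rw [this]
  exact Ts n345 (Ts (Ta (Tn (Tm x4 x24)) (Tm x8 x20)) (Tm x12 x16))

lemma x30 : xv 30 ∈ Tf := by
  apply Tf_cancel_zero
  refine Tf_congr (hasQ_J0.m1) ?_
  have : xv 0 * xv 30 + q1 xv =
      -(xv 2 * xv 28) + xv 4 * xv 26 - xv 8 * xv 22 + xv 14 * xv 16 + xv 6 * xv 24
      - xv 10 * xv 20 + xv 12 * xv 18 := by
    unfold q1
    ring
  rw [this]
  exact Ta (Ts (Ta (Ta (Ts (Ta (Tn (Tm x2 x28)) (Tm x4 x26)) (Tm x8 x22)) (Tm x14 x16)) (Tm x6 x24)) (Tm x10 x20)) (Tm x12 x18)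

lemma x29 : xv 29 ∈ Tf := by
  apply Tf_cancel_zero
  refine Tf_congr (hasQ_J0.m2) ?_
  have : xv 0 * xv 29 + q2 xv =
      -(xv 1 * xv 28) + xv 4 * xv 25 - xv 8 * xv 21 + xv 13 * xv 16 + xv 5 * xv 24
      - xv 9 * xv 20 + xv 12 * xv 17 := by
    unfold q2
    ring
  rw [this]
  exact Ta (Ts (Ta (Ta (Ts (Ta (Tn (Tm x1 x28)) (Tm x4 x25)) (Tm x8 x21)) (Tm x13 x16)) (Tm x5 x24)) (Tm x9 x20)) (Tm x12 x17)

lemma x27 : xv 27 ∈ Tf := by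
  apply Tf_cancel_zero
  refine Tf_congr (hasQ_J0.m3) ?_
  have : xv 0 * xv 27 + q3 xv =
      -(xv 1 * xv 26) + xv 2 * xv 25 - xv 8 * xv 19 + xv 11 * xv 16 + xv 3 * xv 24
      - xv 9 * xv 18 + xv 10 * xv 17 := by
    unfold q3
    ring
  rw [this]
  exact Ta (Ts (Ta (Ta (Ts (Ta (Tn (Tm x1 x26)) (Tm x2 x25)) (Tm x8 x19)) (Tm x11 x16)) (Tm x3 x24)) (Tm x9 x18)) (Tm x10 x17)

lemma x23 : xv 23 ∈ Tf := by
  apply Tf_cancel_zero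
  refine Tf_congr (hasQ_J0.m4) ?_
  have : xv 0 * xv 23 + q4 xv =
      -(xv 1 * xv 22) + xv 2 * xv 21 - xv 4 * xv 19 + xv 7 * xv 16 + xv 3 * xv 20
      - xv 5 * xv 18 + xv 6 * xv 17 := by
    unfold q4
    ring
  rw [this]
  exact Ta (Ts (Ta (Ta (Ts (Ta (Tn (Tm x1 x22)) (Tm x2 x21)) (Tm x4 x19)) (Tm x7 x16)) (Tm x3 x20)) (Tm x5 x18)) (Tm x6 x17)

lemma x15 : xv 15 ∈ Tf := by
  apply Tf_cancel_zero
  refine Tf_congr (hasQ_J0.m5) ?_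
  have : xv 0 * xv 15 + q5 xv =
      -(xv 1 * xv 14) + xv 2 * xv 13 - xv 4 * xv 11 + xv 7 * xv 8 + xv 3 * xv 12 - xv 5 * xv 10
      + xv 6 * xv 9 := by
    unfold q5
    ring
  rw [this]
  exact Ta (Ts (Ta (Ta (Ts (Ta (Tn (Tm x1 x14)) (Tm x2 x13)) (Tm x4 x11)) (Tm x7 x8)) (Tm x3 x12)) (Tm x5 x10)) (Tm x6 x9)

lemma x31 : xv 31 ∈ Tf := by
  apply Tf_cancel_zero
  refine Tf_congr (neg_mem hasQ_J0.m0) ?_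
  have : xv 0 * xv 31 + -q0 xv =
      -(xv 1 * xv 30) + xv 2 * xv 29 - xv 4 * xv 27 + xv 8 * xv 23 - xv 15 * xv 16
      + xv 3 * xv 28 - xv 5 * xv 26 + xv 6 * xv 25 + xv 9 * xv 22 - xv 10 * xv 21
      + xv 12 * xv 19 - xv 14 * xv 17 + xv 13 * xv 18 - xv 11 * xv 20 + xv 7 * xv 24 := by
    unfold q0
    ring
  rw [this]
  exact Ta (Ts (Ta (Ts (Ta (Ts (Ta (Ta (Ts (Ta (Ts (Ta (Ts (Ta (Tn (Tm x1 x30)) (Tm x2 x29)) (Tm x4 x27)) (Tm x8 x23)) (Tm x15 x16)) (Tm x3 x28)) (Tm x5 x26)) (Tm x6 x25)) (Tm x9 x22)) (Tm x10 x21)) (Tm x12 x19)) (Tm x14 x17)) (Tm x13 x18)) (Tm x11 x20)) (Tm x7 x24)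

lemma xv_mem_Tf : ∀ n < 32, xv n ∈ Tf := by
  intro n hn
  interval_cases n
  exacts [x0, x1, x2, x3, x4, x5, x6, x7, x8, x9, x10, x11, x12, x13, x14, x15, x16, x17, x18, x19, x20, x21, x22, x23, x24, x25, x26, x27, x28, x29, x30, x31]

lemma mem_Tf_all (f : R32) : f ∈ Tf := by
  induction f using MvPolynomial.induction_on with
  | C a => exact Tf.algebraMap_mem a
  | add p q hp hq => exact add_mem hp hq
  | mul_X p S hp =>
    refine mul_mem hp ?_
    have := xv_mem_Tf _ (mk_lt S)
    rwa [xv, vs_mk] at this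

lemma m123_ne : m123 xv ≠ 0 := by
  intro h
  have h1 := congrArg (MvPolynomial.eval
    (fun S => if mk S = 0 ∨ mk S = 7 then (1 : ℂ) else 0)) h
  unfold m123 xv at h1
  simp only [map_sub, map_add, map_mul, eval_X, map_zero] at h1
  rw [mk_vs 0 (by norm_num), mk_vs 7 (by norm_num), mk_vs 1 (by norm_num), mk_vs 6 (by norm_num),
    mk_vs 2 (by norm_num), mk_vs 5 (by norm_num), mk_vs 3 (by norm_num),
    mk_vs 4 (by norm_num)] at h1
  norm_num at h1

lemma exists_hom : ∃ φ : R32 →ₐ[ℂ] FractionRing R32,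
    HasQ (RingHom.ker φ) ∧ ∀ n ∈ free, φ (xv n) = algebraMap R32 (FractionRing R32) (xv n) := by
  have hinj : Function.Injective (algebraMap R32 (FractionRing R32)) :=
    IsFractionRing.injective R32 (FractionRing R32)
  have h0 : algebraMap R32 (FractionRing R32) (xv 0) ≠ 0 := by
    rw [Ne, map_eq_zero_iff _ hinj]
    exact X_ne_zero _
  have hm : m123 (fun n => algebraMap R32 (FractionRing R32) (xv n)) ≠ 0 := by
    have : m123 (fun n => algebraMap R32 (FractionRing R32) (xv n)) =
        algebraMap R32 (FractionRing R32) (m123 xv) := by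
      unfold m123
      simp only [map_sub, map_add, map_mul]
    rw [this, Ne, map_eq_zero_iff _ hinj]
    exact m123_ne
  obtain ⟨y, hy, e0, e1, e2, e3, e4, e5, e6, e7, e8, e9, e10⟩ := exists_sol _ h0 hm
  have hx : ∀ n < 32, aeval (R := ℂ) (fun S => y (mk S)) (xv n) = y n := by
    intro n hn
    rw [xv, aeval_X, mk_vs n hn]
  have x0 := hx 0 (by norm_num)
  have x1 := hx 1 (by norm_num)
  have x2 := hx 2 (by norm_num)
  have x3 := hx 3 (by norm_num)
  have x4 := hx 4 (by norm_num)
  have x5 := hx 5 (by norm_num)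
  have x6 := hx 6 (by norm_num)
  have x7 := hx 7 (by norm_num)
  have x8 := hx 8 (by norm_num)
  have x9 := hx 9 (by norm_num)
  have x10 := hx 10 (by norm_num)
  have x11 := hx 11 (by norm_num)
  have x12 := hx 12 (by norm_num)
  have x13 := hx 13 (by norm_num)
  have x14 := hx 14 (by norm_num)
  have x15 := hx 15 (by norm_num)
  have x16 := hx 16 (by norm_num)
  have x17 := hx 17 (by norm_num)
  have x18 := hx 18 (by norm_num)
  have x19 := hx 19 (by norm_num)
  have x20 := hx 20 (by norm_num)
  have x21 := hx 21 (by norm_num)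
  have x22 := hx 22 (by norm_num)
  have x23 := hx 23 (by norm_num)
  have x24 := hx 24 (by norm_num)
  have x25 := hx 25 (by norm_num)
  have x26 := hx 26 (by norm_num)
  have x27 := hx 27 (by norm_num)
  have x28 := hx 28 (by norm_num)
  have x29 := hx 29 (by norm_num)
  have x30 := hx 30 (by norm_num)
  have x31 := hx 31 (by norm_num)
  refine ⟨aeval (fun S => y (mk S)), ⟨?_, ?_, ?_, ?_, ?_, ?_, ?_, ?_, ?_, ?_, ?_⟩, ?_⟩
  · rw [RingHom.mem_ker, ← e0]
    unfold q0
    simp only [map_sub, map_add, map_mul, map_neg,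

      x0, x1, x2, x3, x4, x5, x6, x7, x8, x9, x10, x11, x12, x13, x14, x15, x16, x17, x18, x19, x20, x21, x22, x23, x24, x25, x26, x27, x28, x29, x30, x31]
  · rw [RingHom.mem_ker, ← e1]
    unfold q1
    simp only [map_sub, map_add, map_mul, map_neg,
      x0, x2, x4, x6, x8, x10, x12, x14, x16, x18, x20, x22, x24, x26, x28, x30]
  · rw [RingHom.mem_ker, ← e2]
    unfold q2
    simp only [map_sub, map_add, map_mul, map_neg,
      x0, x1, x4, x5, x8, x9, x12, x13, x16, x17, x20, x21, x24, x25, x28, x29]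
  · rw [RingHom.mem_ker, ← e3]
    unfold q3
    simp only [map_sub, map_add, map_mul, map_neg,
      x0, x1, x2, x3, x8, x9, x10, x11, x16, x17, x18, x19, x24, x25, x26, x27]
  · rw [RingHom.mem_ker, ← e4]
    unfold q4
    simp only [map_sub, map_add, map_mul, map_neg,
      x0, x1, x2, x3, x4, x5, x6, x7, x16, x17, x18, x19, x20, x21, x22, x23]
  · rw [RingHom.mem_ker, ← e5]
    unfold q5
    simp only [map_sub, map_add, map_mul, map_neg,
      x0, x1, x2, x3, x4, x5, x6, x7, x8, x9, x10, x11, x12, x13, x14, x15]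
  · rw [RingHom.mem_ker, ← e6]
    unfold q6
    simp only [map_sub, map_add, map_mul, map_neg,
      x1, x3, x5, x7, x9, x11, x13, x15, x17, x19, x21, x23, x25, x27, x29, x31]
  · rw [RingHom.mem_ker, ← e7]
    unfold q7
    simp only [map_sub, map_add, map_mul, map_neg,
      x2, x3, x6, x7, x10, x11, x14, x15, x18, x19, x22, x23, x26, x27, x30, x31]
  · rw [RingHom.mem_ker, ← e8]
    unfold q8
    simp only [map_sub, map_add, map_mul, map_neg,
      x4, x5, x6, x7, x12, x13, x14, x15, x20, x21, x22, x23, x28, x29, x30, x31]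
  · rw [RingHom.mem_ker, ← e9]
    unfold q9
    simp only [map_sub, map_add, map_mul, map_neg,
      x8, x9, x10, x11, x12, x13, x14, x15, x24, x25, x26, x27, x28, x29, x30, x31]
  · rw [RingHom.mem_ker, ← e10]
    unfold q10
    simp only [map_sub, map_add, map_mul, map_neg,
      x16, x17, x18, x19, x20, x21, x22, x23, x24, x25, x26, x27, x28, x29, x30, x31]
  · intro n hn
    rw [hx n, hy n hn]
    revert n
    decide

lemma J0_prime : J0.IsPrime := by
  obtain ⟨φ, hQ, hφ⟩ := exists_hom
  have hB : ∀ g ∈ Bf, φ g = algebraMap R32 (FractionRing R32) g := by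
    intro g hg
    induction hg using Algebra.adjoin_induction with
    | mem x hx =>
      obtain ⟨n, hn, rfl⟩ := hx
      exact hφ n hn
    | algebraMap r =>
      rw [AlgHom.commutes, ← IsScalarTower.algebraMap_apply]
    | add x y _ _ hx hy => rw [map_add, map_add, hx, hy]
    | mul x y _ _ hx hy => rw [map_mul, map_mul, hx, hy]
  have hle : J0 ≤ RingHom.ker φ := J0_le hQ
  have heq : J0 = RingHom.ker φ := by
    refine le_antisymm hle fun f hf => ?_
    obtain ⟨k, g, hg, h⟩ := mem_Tf.1 (mem_Tf_all f)
    have h1 := hle h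
    rw [RingHom.mem_ker, map_sub, map_mul, (RingHom.mem_ker).1 hf, mul_zero, zero_sub,
      neg_eq_zero, hB g hg, map_eq_zero_iff _ (IsFractionRing.injective R32 (FractionRing R32))]
      at h1
    rw [h1, sub_zero] at h
    exact nzd_pow k h
  rw [heq]
  exact RingHom.ker_isPrime φ

end Grav

/-- the ideal `I` is prime, i.e. `A = R/I` is an integral domain. -/
theorem gravSpinorIdeal_isPrime : Igrav.IsPrime := by
  rw [Grav.Igrav_eq]
  exact Grav.J0_prime
end
end

section
/- The ring A = R/I has Krull dimension 23; equivalently, the projective scheme X = Proj A of eleven-dimensional gravitational spinors has dimension 22. -/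
set_option synthInstance.maxHeartbeats 1000000
set_option maxHeartbeats 2000000

noncomputable section

set_option linter.unusedSimpArgs false

section Graded
open MvPolynomial

attribute [local instance] MvPolynomial.gradedAlgebra

/-- Multiplying by a linear form shifts homogeneous components. -/
lemma grav_component_mul_linear {σ : Type*} (c y : MvPolynomial σ ℂ) (hy : y.IsHomogeneous 1)
    (n : ℕ) : homogeneousComponent (n + 1) (c * y) = homogeneousComponent n c * y := by
  conv_lhs => rw [← sum_homogeneousComponent c]
  rw [Finset.sum_mul, map_sum]
  have h : ∀ k, homogeneousComponent (n + 1) (homogeneousComponent k c * y) =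
      if k = n then homogeneousComponent k c * y else 0 := by
    intro k
    have hk : (homogeneousComponent k c * y) ∈ homogeneousSubmodule σ ℂ (k + 1) :=
      (homogeneousComponent_isHomogeneous k c).mul hy
    rw [homogeneousComponent_of_mem hk]
    by_cases hkn : k = n <;> simp [hkn]
    intro h; omega
  simp_rw [h]
  rw [Finset.sum_ite_eq']
  split_ifs with hn
  · rfl
  · rw [homogeneousComponent_eq_zero, zero_mul]
    simp only [Finset.mem_range] at hn
    omega

/-- A graded Nakayama argument: if all variables are nilpotent modulo the homogeneous ideal `I`
and `m` linear forms, then the quotient by `I` has Krull dimension at most `m`. -/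
theorem grav_dim_le {σ A : Type*} [Finite σ] [CommRing A] (π : MvPolynomial σ ℂ →+* A)
    (hπ : Function.Surjective π) (Q : Set (MvPolynomial σ ℂ))
    (hQ : ∀ q ∈ Q, q.IsHomogeneous 2) (m : ℕ) (y : Fin m → MvPolynomial σ ℂ)
    (hy : ∀ j, (y j).IsHomogeneous 1)
    (hker : ∀ p ∈ Ideal.span Q, π p = 0)
    (hX : ∀ i, (X i : MvPolynomial σ ℂ) ∈ (Ideal.span Q ⊔ Ideal.span (Set.range y)).radical) :
    ringKrullDim A ≤ m := by
  classical
  set I := Ideal.span Q with hI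
  have hIhom : I.IsHomogeneous (homogeneousSubmodule σ ℂ) :=
    Ideal.homogeneous_span (homogeneousSubmodule σ ℂ) Q fun q hq => ⟨2, hQ q hq⟩
  set 𝔪 : Ideal (MvPolynomial σ ℂ) := Ideal.span (Set.range X) with h𝔪
  obtain ⟨K, hK⟩ : ∃ K, 𝔪 ^ K ≤ I ⊔ Ideal.span (Set.range y) := by
    apply Ideal.exists_pow_le_of_le_radical_of_fg
    · rw [h𝔪, Ideal.span_le]
      rintro _ ⟨i, rfl⟩
      exact hX i
    · exact IsNoetherian.noetherian _
  have hmono : ∀ (s : σ →₀ ℕ) (a : ℂ), monomial s a ∈ 𝔪 ^ s.degree := by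
    intro s a
    rw [monomial_eq]
    apply Ideal.mul_mem_left
    rw [Finsupp.prod, Finsupp.degree_apply, ← Finset.prod_pow_eq_pow_sum]
    apply Ideal.prod_mem_prod
    intro i _
    have hi : (X i : MvPolynomial σ ℂ) ∈ 𝔪 := Ideal.subset_span (Set.mem_range_self i)
    exact Ideal.pow_mem_pow hi _
  have hpow : ∀ (n : ℕ) (p : MvPolynomial σ ℂ), p.IsHomogeneous n → p ∈ 𝔪 ^ n := by
    intro n p hp
    rw [p.as_sum]
    refine Ideal.sum_mem _ fun s hs => ?_
    have := hp.degree_eq_sum_deg_support hs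
    rw [this]
    exact hmono s _
  -- the algebra structure
  let f : MvPolynomial (Fin m) ℂ →+* A := eval₂Hom (π.comp C) fun j => π (y j)
  let _ : Algebra (MvPolynomial (Fin m) ℂ) A := f.toAlgebra
  have hsmul : ∀ j (z : A),
      (X j : MvPolynomial (Fin m) ℂ) • z = π (y j) * z := by
    intro j z
    rw [Algebra.smul_def]
    congr 1
    exact eval₂Hom_X' _ _ j
  have hsmulC : ∀ (a : ℂ) (z : A),
      (C a : MvPolynomial (Fin m) ℂ) • z = π (C a) * z := by
    intro a z
    rw [Algebra.smul_def]
    congr 1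
    exact eval₂Hom_C _ _ a
  let G : Set A :=
    (fun s : σ →₀ ℕ => π (monomial s 1)) '' {s | s.degree ≤ K}
  have hGfin : G.Finite := (Finsupp.finite_of_degree_le K).image _
  let N : Submodule (MvPolynomial (Fin m) ℂ) A := Submodule.span _ G
  have key : ∀ (n : ℕ) (p : MvPolynomial σ ℂ), p.IsHomogeneous n →
      π p ∈ N := by
    intro n
    induction n with
    | zero =>
      intro p hp
      rw [p.as_sum, map_sum]
      refine N.sum_mem fun s hs => ?_
      have hd := hp.degree_eq_sum_deg_support hs
      have : monomial s (coeff s p) = C (coeff s p) * monomial s 1 := by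
        rw [C_mul_monomial, mul_one]
      rw [this, map_mul, ← hsmulC]
      refine N.smul_mem _ (Submodule.subset_span ⟨s, ?_, rfl⟩)
      show s.degree ≤ K
      rw [Finsupp.degree_apply, ← hd]; exact Nat.zero_le _
    | succ n ih =>
      intro p hp
      by_cases hn : n + 1 ≤ K
      · rw [p.as_sum, map_sum]
        refine N.sum_mem fun s hs => ?_
        have hd := hp.degree_eq_sum_deg_support hs
        have : monomial s (coeff s p) = C (coeff s p) * monomial s 1 := by
          rw [C_mul_monomial, mul_one]
        rw [this, map_mul, ← hsmulC]
        refine N.smul_mem _ (Submodule.subset_span ⟨s, ?_, rfl⟩)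
        show s.degree ≤ K
        rw [Finsupp.degree_apply, ← hd]; exact hn
      · have hmem := hK (Ideal.pow_le_pow_right (by omega : K ≤ n + 1) (hpow _ _ hp))
        obtain ⟨a, ha, b, hb, hab⟩ := Submodule.mem_sup.mp hmem
        obtain ⟨c, rfl⟩ := Ideal.mem_span_range_iff_exists_fun.mp hb
        have h1 : p = homogeneousComponent (n + 1) a +
            ∑ j, homogeneousComponent n (c j) * y j := by
          conv_lhs => rw [← homogeneousComponent_eq_self hp, ← hab]
          rw [map_add, map_sum]
          congr 1
          exact Finset.sum_congr rfl fun j _ => grav_component_mul_linear _ _ (hy j) n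
        have h2 : homogeneousComponent (n + 1) a ∈ I :=
          homogeneousComponent_mem_of_mem hIhom ha _
        rw [h1, map_add, hker _ h2, zero_add, map_sum]
        refine N.sum_mem fun j _ => ?_
        rw [map_mul, mul_comm, ← hsmul]
        exact N.smul_mem _ (ih _ (homogeneousComponent_isHomogeneous n _))
  have htop : N = ⊤ := by
    rw [eq_top_iff]
    rintro z -
    obtain ⟨p, rfl⟩ := hπ z
    rw [← sum_homogeneousComponent p, map_sum]
    exact N.sum_mem fun n _ => key n _ (homogeneousComponent_isHomogeneous n p)
  have : Module.Finite (MvPolynomial (Fin m) ℂ) A :=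
    ⟨⟨hGfin.toFinset, by rw [Set.Finite.coe_toFinset]; exact htop⟩⟩
  have hle : ringKrullDim A ≤ ringKrullDim (MvPolynomial (Fin m) ℂ) :=
    Order.krullDim_le_of_strictMono
      (PrimeSpectrum.comap (algebraMap (MvPolynomial (Fin m) ℂ) A))
      fun P P' h => by
        have h' : P.asIdeal < P'.asIdeal := h
        exact Ideal.IsIntegral.comap_lt_comap h'
  refine hle.trans ?_
  rw [MvPolynomial.ringKrullDim_of_isNoetherianRing]
  simp

end Graded

/-- The eleven quadrics, as functions of the 32 coordinates of a spinor. -/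
def gq {R : Type*} [CommRing R] (x : Finset (Fin 5) → R) : Fin 11 → R :=
  ![
    x ∅ * x Finset.univ + x {0} * x {1, 2, 3, 4} - x {1} * x {0, 2, 3, 4} + x {2} * x {0, 1,
      3, 4} - x {3} * x {0, 1, 2, 4} + x {4} * x {0, 1, 2, 3} - x {0, 1} * x {2, 3, 4} + x {0,
      2} * x {1, 3, 4} - x {0, 3} * x {1, 2, 4} + x {0, 4} * x {1, 2, 3} - x {1, 2} * x {0, 3,
      4} + x {1, 3} * x {0, 2, 4} - x {1, 4} * x {0, 2, 3} - x {2, 3} * x {0, 1, 4} + x {2, 4}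
      * x {0, 1, 3} - x {3, 4} * x {0, 1, 2},
    - 2 * (x ∅ * x {1, 2, 3, 4}) - 2 * (x {1} * x {2, 3, 4}) + 2 * (x {2} * x {1, 3, 4}) - 2
      * (x {3} * x {1, 2, 4}) + 2 * (x {4} * x {1, 2, 3}) + 2 * (x {1, 2} * x {3, 4}) - 2 * (x
      {1, 3} * x {2, 4}) + 2 * (x {1, 4} * x {2, 3}),
    - 2 * (x ∅ * x {0, 2, 3, 4}) - 2 * (x {0} * x {2, 3, 4}) + 2 * (x {2} * x {0, 3, 4}) - 2
      * (x {3} * x {0, 2, 4}) + 2 * (x {4} * x {0, 2, 3}) + 2 * (x {0, 2} * x {3, 4}) - 2 * (x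
      {0, 3} * x {2, 4}) + 2 * (x {0, 4} * x {2, 3}),
    - 2 * (x ∅ * x {0, 1, 3, 4}) - 2 * (x {0} * x {1, 3, 4}) + 2 * (x {1} * x {0, 3, 4}) - 2
      * (x {3} * x {0, 1, 4}) + 2 * (x {4} * x {0, 1, 3}) + 2 * (x {0, 1} * x {3, 4}) - 2 * (x
      {0, 3} * x {1, 4}) + 2 * (x {0, 4} * x {1, 3}),
    - 2 * (x ∅ * x {0, 1, 2, 4}) - 2 * (x {0} * x {1, 2, 4}) + 2 * (x {1} * x {0, 2, 4}) - 2
      * (x {2} * x {0, 1, 4}) + 2 * (x {4} * x {0, 1, 2}) + 2 * (x {0, 1} * x {2, 4}) - 2 * (x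
      {0, 2} * x {1, 4}) + 2 * (x {0, 4} * x {1, 2}),
    - 2 * (x ∅ * x {0, 1, 2, 3}) - 2 * (x {0} * x {1, 2, 3}) + 2 * (x {1} * x {0, 2, 3}) - 2
      * (x {2} * x {0, 1, 3}) + 2 * (x {3} * x {0, 1, 2}) + 2 * (x {0, 1} * x {2, 3}) - 2 * (x
      {0, 2} * x {1, 3}) + 2 * (x {0, 3} * x {1, 2}),
    - 2 * (x {0} * x Finset.univ) - 2 * (x {0, 1} * x {0, 2, 3, 4}) + 2 * (x {0, 2} * x {0,
      1, 3, 4}) - 2 * (x {0, 3} * x {0, 1, 2, 4}) + 2 * (x {0, 4} * x {0, 1, 2, 3}) + 2 * (x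
      {0, 1, 2} * x {0, 3, 4}) - 2 * (x {0, 1, 3} * x {0, 2, 4}) + 2 * (x {0, 1, 4} * x {0, 2,
      3}),
    - 2 * (x {1} * x Finset.univ) - 2 * (x {0, 1} * x {1, 2, 3, 4}) + 2 * (x {1, 2} * x {0,
      1, 3, 4}) - 2 * (x {1, 3} * x {0, 1, 2, 4}) + 2 * (x {1, 4} * x {0, 1, 2, 3}) + 2 * (x
      {0, 1, 2} * x {1, 3, 4}) - 2 * (x {0, 1, 3} * x {1, 2, 4}) + 2 * (x {0, 1, 4} * x {1, 2,
      3}),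
    - 2 * (x {2} * x Finset.univ) - 2 * (x {0, 2} * x {1, 2, 3, 4}) + 2 * (x {1, 2} * x {0,
      2, 3, 4}) - 2 * (x {2, 3} * x {0, 1, 2, 4}) + 2 * (x {2, 4} * x {0, 1, 2, 3}) + 2 * (x
      {0, 1, 2} * x {2, 3, 4}) - 2 * (x {0, 2, 3} * x {1, 2, 4}) + 2 * (x {0, 2, 4} * x {1, 2,
      3}),
    - 2 * (x {3} * x Finset.univ) - 2 * (x {0, 3} * x {1, 2, 3, 4}) + 2 * (x {1, 3} * x {0,
      2, 3, 4}) - 2 * (x {2, 3} * x {0, 1, 3, 4}) + 2 * (x {3, 4} * x {0, 1, 2, 3}) + 2 * (x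
      {0, 1, 3} * x {2, 3, 4}) - 2 * (x {0, 2, 3} * x {1, 3, 4}) + 2 * (x {0, 3, 4} * x {1, 2,
      3}),
    - 2 * (x {4} * x Finset.univ) - 2 * (x {0, 4} * x {1, 2, 3, 4}) + 2 * (x {1, 4} * x {0,
      2, 3, 4}) - 2 * (x {2, 4} * x {0, 1, 3, 4}) + 2 * (x {3, 4} * x {0, 1, 2, 4}) + 2 * (x
      {0, 1, 4} * x {2, 3, 4}) - 2 * (x {0, 2, 4} * x {1, 3, 4}) + 2 * (x {0, 3, 4} * x {1, 2,
      4})]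

/-- The degree 1 part of a spinor, written out. -/
def gl1 {R A : Type*} [CommRing R] [Ring A] [Algebra R A] (x : Finset (Fin 5) → R) (g : Fin 5 → A) : A :=
  x {0} • g 0 + x {1} • g 1 + x {2} • g 2 + x {3} • g 3 + x {4} • g 4

/-- The degree 2 part of a spinor, written out. -/
def gl2 {R A : Type*} [CommRing R] [Ring A] [Algebra R A] (x : Finset (Fin 5) → R) (g : Fin 5 → A) : A :=
  x {0, 1} • (g 0 * g 1) + x {0, 2} • (g 0 * g 2) + x {0, 3} • (g 0 * g 3) + x {0, 4} • (g 0
    * g 4) + x {1, 2} • (g 1 * g 2) + x {1, 3} • (g 1 * g 3) + x {1, 4} • (g 1 * g 4) + x {2,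
    3} • (g 2 * g 3) + x {2, 4} • (g 2 * g 4) + x {3, 4} • (g 3 * g 4)

/-- The degree 3 part of a spinor, written out. -/
def gl3 {R A : Type*} [CommRing R] [Ring A] [Algebra R A] (x : Finset (Fin 5) → R) (g : Fin 5 → A) : A :=
  x {0, 1, 2} • (g 0 * (g 1 * g 2)) + x {0, 1, 3} • (g 0 * (g 1 * g 3)) + x {0, 1, 4} • (g 0
    * (g 1 * g 4)) + x {0, 2, 3} • (g 0 * (g 2 * g 3)) + x {0, 2, 4} • (g 0 * (g 2 * g 4)) + x
    {0, 3, 4} • (g 0 * (g 3 * g 4)) + x {1, 2, 3} • (g 1 * (g 2 * g 3)) + x {1, 2, 4} • (g 1 *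
    (g 2 * g 4)) + x {1, 3, 4} • (g 1 * (g 3 * g 4)) + x {2, 3, 4} • (g 2 * (g 3 * g 4))

/-- The degree 4 part of a spinor, written out. -/
def gl4 {R A : Type*} [CommRing R] [Ring A] [Algebra R A] (x : Finset (Fin 5) → R) (g : Fin 5 → A) : A :=
  x {0, 1, 2, 3} • (g 0 * (g 1 * (g 2 * g 3))) + x {0, 1, 2, 4} • (g 0 * (g 1 * (g 2 * g 4)))
    + x {0, 1, 3, 4} • (g 0 * (g 1 * (g 3 * g 4))) + x {0, 2, 3, 4} • (g 0 * (g 2 * (g 3 * g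
    4))) + x {1, 2, 3, 4} • (g 1 * (g 2 * (g 3 * g 4)))

/-- The degree 5 part of a spinor, written out. -/
def gl5 {R A : Type*} [CommRing R] [Ring A] [Algebra R A] (x : Finset (Fin 5) → R) (g : Fin 5 → A) : A :=
  x Finset.univ • (g 0 * (g 1 * (g 2 * (g 3 * g 4))))

/-- `E1`, `E2`, `E3` in an abstract algebra with anticommuting generators. -/
lemma gl_E1 {R A : Type*} [CommRing R] [Ring A] [Algebra R A] (x : Finset (Fin 5) → R)
    (g : Fin 5 → A) (h0 : ∀ i, g i * g i = 0) (h1 : ∀ i z, g i * (g i * z) = 0)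
    (h2 : ∀ i j, j < i → g i * g j = -(g j * g i))
    (h3 : ∀ i j z, j < i → g i * (g j * z) = -(g j * (g i * z))) :
    x ∅ • gl5 x g + gl1 x g * gl4 x g - gl2 x g * gl3 x g =
      gq x 0 • (g 0 * (g 1 * (g 2 * (g 3 * g 4)))) := by
  simp only [gl1, gl2, gl3, gl4, gl5, gq, add_mul, mul_add, smul_mul_assoc, mul_smul_comm,
    mul_assoc, h0, h1, h2, h3, Fin.reduceLT, mul_neg, neg_neg, mul_zero, smul_zero, neg_zero,
    add_zero, zero_add, smul_neg, Matrix.cons_val]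
  module

lemma gl_E2 {R A : Type*} [CommRing R] [Ring A] [Algebra R A] (x : Finset (Fin 5) → R)
    (g : Fin 5 → A) (h0 : ∀ i, g i * g i = 0) (h1 : ∀ i z, g i * (g i * z) = 0)
    (h2 : ∀ i j, j < i → g i * g j = -(g j * g i))
    (h3 : ∀ i j z, j < i → g i * (g j * z) = -(g j * (g i * z))) :
    -(2 • (x ∅ • gl4 x g)) - 2 • (gl1 x g * gl3 x g) + gl2 x g * gl2 x g =
      gq x 1 • (g 1 * (g 2 * (g 3 * g 4))) + gq x 2 • (g 0 * (g 2 * (g 3 * g 4))) +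
      gq x 3 • (g 0 * (g 1 * (g 3 * g 4))) + gq x 4 • (g 0 * (g 1 * (g 2 * g 4))) +
      gq x 5 • (g 0 * (g 1 * (g 2 * g 3))) := by
  simp only [gl1, gl2, gl3, gl4, gq, add_mul, mul_add, smul_mul_assoc, mul_smul_comm,
    mul_assoc, h0, h1, h2, h3, Fin.reduceLT, mul_neg, neg_neg, mul_zero, smul_zero, neg_zero,
    add_zero, zero_add, smul_neg, Matrix.cons_val]
  module

lemma gl_E3 {R A : Type*} [CommRing R] [Ring A] [Algebra R A] (x : Finset (Fin 5) → R)
    (g : Fin 5 → A) (h0 : ∀ i, g i * g i = 0) (h1 : ∀ i z, g i * (g i * z) = 0)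
    (h2 : ∀ i j, j < i → g i * g j = -(g j * g i))
    (h3 : ∀ i j z, j < i → g i * (g j * z) = -(g j * (g i * z)))
    (c : Fin 5 → A →ₗ[R] A) (hc : ∀ r i z, c r (g i * z) = (if i = r then z else 0) - g i * c r z)
    (hc1 : ∀ r i, c r (g i) = if i = r then 1 else 0) (r : Fin 5) :
    -(2 • (c r (gl1 x g) * gl5 x g)) + 2 • (c r (gl2 x g) * gl4 x g) +
      c r (gl3 x g) * gl3 x g =
      gq x (r.natAdd 6) • (g 0 * (g 1 * (g 2 * (g 3 * g 4)))) := by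
  fin_cases r <;>
  · simp only [gl1, gl2, gl3, gl4, gl5, gq, map_add, map_smul, hc, hc1, Fin.zero_eta, Fin.mk_one,
      Fin.reduceFinMk, Fin.reduceEq, Fin.isValue, if_true, if_false, sub_zero, zero_sub, mul_one,
      one_mul, mul_zero, neg_zero, sub_neg_eq_add, neg_mul, reduceIte,
      Fin.reduceNatAdd, Fin.natAdd_mk,
      add_mul, mul_add, smul_mul_assoc, mul_smul_comm, zero_mul, smul_add, sub_mul, mul_sub,
      mul_assoc, h0, h1, h2, h3, Fin.reduceLT, mul_neg, neg_neg, smul_zero,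
      add_zero, zero_add, smul_neg, Matrix.cons_val]
    module

/-- The generators of the exterior algebra. -/
def gg (i : Fin 5) : Ext5 := ExteriorAlgebra.ι R32 (Pi.single i 1)

lemma gg_sq (i : Fin 5) : gg i * gg i = 0 := ExteriorAlgebra.ι_sq_zero _

lemma gg_sq' (i : Fin 5) (z : Ext5) : gg i * (gg i * z) = 0 := by
  rw [← mul_assoc, gg_sq, zero_mul]

lemma gg_anti (i j : Fin 5) : gg i * gg j = -(gg j * gg i) :=
  eq_neg_of_add_eq_zero_left (ExteriorAlgebra.ι_add_mul_swap _ _)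

lemma gg_anti' (i j : Fin 5) (z : Ext5) : gg i * (gg j * z) = -(gg j * (gg i * z)) := by
  rw [← mul_assoc, gg_anti, neg_mul, mul_assoc]

lemma ext_contract_ι_mul {R M : Type*} [CommRing R] [AddCommGroup M] [Module R M]
    (d : Module.Dual R M) (m : M) (z : ExteriorAlgebra R M) :
    CliffordAlgebra.contractLeft (Q := (0 : QuadraticForm R M)) d (ExteriorAlgebra.ι R m * z) =
      d m • z - ExteriorAlgebra.ι R m * CliffordAlgebra.contractLeft d z :=
  CliffordAlgebra.contractLeft_ι_mul d m z

lemma ctr_gg_mul (r i : Fin 5) (z : Ext5) :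
    ctr r (gg i * z) = (if i = r then z else 0) - gg i * ctr r z := by
  have h : ctr r (gg i * z) = (LinearMap.proj r : Module.Dual R32 (Fin 5 → R32))
      (Pi.single i 1) • z - gg i * ctr r z := ext_contract_ι_mul _ _ z
  rw [h, LinearMap.proj_apply, Pi.single_apply]
  by_cases hir : i = r
  · rw [if_pos hir, if_pos hir.symm, one_smul]
  · rw [if_neg hir, if_neg (Ne.symm hir), zero_smul]

lemma ctr_one (r : Fin 5) : ctr r 1 = 0 := CliffordAlgebra.contractLeft_one _ _

lemma ctr_gg (r i : Fin 5) : ctr r (gg i) = if i = r then 1 else 0 := by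
  have := ctr_gg_mul r i 1
  rwa [mul_one, ctr_one, mul_zero, sub_zero] at this

lemma eS_empty : eS ∅ = 1 := by simp [eS]

lemma eS_insert (a : Fin 5) (s : Finset (Fin 5)) (h : ∀ b ∈ s, a < b) :
    eS (insert a s) = gg a * eS s := by
  unfold eS
  rw [Finset.sort_insert _ (fun b hb => (h b hb).le) (fun ha => lt_irrefl _ (h a ha))]
  simp [gg]

lemma eS_singleton (a : Fin 5) : eS {a} = gg a := by simp [eS, gg]

lemma lamb_one : lamb 1 = gl1 (MvPolynomial.X : _ → R32) gg := by
  unfold lamb gl1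
  rw [show Finset.univ.filter (fun S : Finset (Fin 5) => S.card = 1) =
    {{0}, {1}, {2}, {3}, {4}} by decide]
  repeat rw [Finset.sum_insert (by decide)]
  rw [Finset.sum_singleton]
  simp only [eS_singleton, add_assoc]

lemma lamb_two : lamb 2 = gl2 (MvPolynomial.X : _ → R32) gg := by
  unfold lamb gl2
  rw [show Finset.univ.filter (fun S : Finset (Fin 5) => S.card = 2) =
    {{0, 1}, {0, 2}, {0, 3}, {0, 4}, {1, 2}, {1, 3}, {1, 4}, {2, 3}, {2, 4}, {3, 4}} by decide]
  repeat rw [Finset.sum_insert (by decide)]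
  rw [Finset.sum_singleton]
  repeat rw [eS_insert _ _ (by decide)]
  simp only [eS_singleton, add_assoc]

lemma lamb_three : lamb 3 = gl3 (MvPolynomial.X : _ → R32) gg := by
  unfold lamb gl3
  rw [show Finset.univ.filter (fun S : Finset (Fin 5) => S.card = 3) =
    {{0, 1, 2}, {0, 1, 3}, {0, 1, 4}, {0, 2, 3}, {0, 2, 4}, {0, 3, 4}, {1, 2, 3}, {1, 2, 4},
      {1, 3, 4}, {2, 3, 4}} by decide]
  repeat rw [Finset.sum_insert (by decide)]
  rw [Finset.sum_singleton]
  repeat rw [eS_insert _ _ (by decide)]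
  simp only [eS_singleton, add_assoc]

lemma lamb_four : lamb 4 = gl4 (MvPolynomial.X : _ → R32) gg := by
  unfold lamb gl4
  rw [show Finset.univ.filter (fun S : Finset (Fin 5) => S.card = 4) =
    {{0, 1, 2, 3}, {0, 1, 2, 4}, {0, 1, 3, 4}, {0, 2, 3, 4}, {1, 2, 3, 4}} by decide]
  repeat rw [Finset.sum_insert (by decide)]
  rw [Finset.sum_singleton]
  repeat rw [eS_insert _ _ (by decide)]
  simp only [eS_singleton, add_assoc]

lemma lamb_five : lamb 5 = gl5 (MvPolynomial.X : _ → R32) gg := by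
  unfold lamb gl5
  rw [show Finset.univ.filter (fun S : Finset (Fin 5) => S.card = 5) = {Finset.univ} by decide]
  rw [Finset.sum_singleton]
  have : eS Finset.univ = gg 0 * (gg 1 * (gg 2 * (gg 3 * gg 4))) := by
    rw [show (Finset.univ : Finset (Fin 5)) = {0, 1, 2, 3, 4} by decide]
    repeat rw [eS_insert _ _ (by decide)]
    rw [eS_singleton]
  rw [this]

lemma E1_eq : E1 = gq (MvPolynomial.X : _ → R32) 0 •
    (gg 0 * (gg 1 * (gg 2 * (gg 3 * gg 4)))) := by
  rw [E1, lamb_one, lamb_two, lamb_three, lamb_four, lamb_five]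
  exact gl_E1 _ _ gg_sq gg_sq' (fun i j _ => gg_anti i j) (fun i j z _ => gg_anti' i j z)

lemma E2_eq : E2 = gq (MvPolynomial.X : _ → R32) 1 • (gg 1 * (gg 2 * (gg 3 * gg 4))) +
    gq (MvPolynomial.X : _ → R32) 2 • (gg 0 * (gg 2 * (gg 3 * gg 4))) +
    gq (MvPolynomial.X : _ → R32) 3 • (gg 0 * (gg 1 * (gg 3 * gg 4))) +
    gq (MvPolynomial.X : _ → R32) 4 • (gg 0 * (gg 1 * (gg 2 * gg 4))) +
    gq (MvPolynomial.X : _ → R32) 5 • (gg 0 * (gg 1 * (gg 2 * gg 3))) := by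
  rw [E2, lamb_one, lamb_two, lamb_three, lamb_four]
  exact gl_E2 _ _ gg_sq gg_sq' (fun i j _ => gg_anti i j) (fun i j z _ => gg_anti' i j z)

lemma E3_eq (r : Fin 5) : E3 r = gq (MvPolynomial.X : _ → R32) (r.natAdd 6) •
    (gg 0 * (gg 1 * (gg 2 * (gg 3 * gg 4)))) := by
  rw [E3, lamb_one, lamb_two, lamb_three, lamb_four, lamb_five]
  exact gl_E3 _ _ gg_sq gg_sq' (fun i j _ => gg_anti i j) (fun i j z _ => gg_anti' i j z)
    ctr ctr_gg_mul ctr_gg r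

lemma map_mem_of_mem_smul_top (F : Ext5 →ₗ[R32] R32) (J : Ideal R32) (e : Ext5)
    (he : e ∈ J • (⊤ : Submodule R32 Ext5)) : F e ∈ J := by
  induction he using Submodule.smul_induction_on' with
  | smul a ha n hn => rw [map_smul]; exact J.mul_mem_right _ ha
  | add a _ b _ h1 h2 => rw [map_add]; exact J.add_mem h1 h2

/-- The scalar part of an element of the exterior algebra. -/
def scal : Ext5 →ₗ[R32] R32 := (ExteriorAlgebra.algebraMapInv (R := R32) (M := Fin 5 → R32)).toLinearMap

lemma scal_one : scal 1 = 1 := map_one (ExteriorAlgebra.algebraMapInv (R := R32) (M := Fin 5 → R32))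

lemma gq_mem_Igrav (i : Fin 11) : gq (MvPolynomial.X : _ → R32) i ∈ Igrav := by
  unfold Igrav
  rw [Submodule.mem_sInf]
  rintro J ⟨hJ1, hJ2, hJ3⟩
  rw [E1_eq] at hJ1
  rw [E2_eq] at hJ2
  simp_rw [E3_eq] at hJ3
  have k1 := map_mem_of_mem_smul_top (scal ∘ₗ ctr 4 ∘ₗ ctr 3 ∘ₗ ctr 2 ∘ₗ ctr 1 ∘ₗ ctr 0) J _ hJ1
  have k3 := fun r => map_mem_of_mem_smul_top
    (scal ∘ₗ ctr 4 ∘ₗ ctr 3 ∘ₗ ctr 2 ∘ₗ ctr 1 ∘ₗ ctr 0) J _ (hJ3 r)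
  have k20 := map_mem_of_mem_smul_top (scal ∘ₗ ctr 4 ∘ₗ ctr 3 ∘ₗ ctr 2 ∘ₗ ctr 1) J _ hJ2
  have k21 := map_mem_of_mem_smul_top (scal ∘ₗ ctr 4 ∘ₗ ctr 3 ∘ₗ ctr 2 ∘ₗ ctr 0) J _ hJ2
  have k22 := map_mem_of_mem_smul_top (scal ∘ₗ ctr 4 ∘ₗ ctr 3 ∘ₗ ctr 1 ∘ₗ ctr 0) J _ hJ2
  have k23 := map_mem_of_mem_smul_top (scal ∘ₗ ctr 4 ∘ₗ ctr 2 ∘ₗ ctr 1 ∘ₗ ctr 0) J _ hJ2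
  have k24 := map_mem_of_mem_smul_top (scal ∘ₗ ctr 3 ∘ₗ ctr 2 ∘ₗ ctr 1 ∘ₗ ctr 0) J _ hJ2
  simp only [LinearMap.comp_apply, map_add, map_smul, ctr_gg_mul, ctr_gg, Fin.reduceEq, reduceIte,
    mul_zero, sub_zero, zero_sub, map_neg, map_sub, neg_neg, scal_one, neg_zero, map_zero,
    smul_eq_mul, mul_one, mul_neg, smul_zero, add_zero, zero_add] at k1 k3 k20 k21 k22 k23 k24
  fin_cases i
  · exact k1
  · exact k20
  · exact k21
  · exact k22
  · exact k23
  · exact k24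
  · exact k3 0
  · exact k3 1
  · exact k3 2
  · exact k3 3
  · exact k3 4

lemma Igrav_le (J : Ideal R32) (h : ∀ i, gq (MvPolynomial.X : _ → R32) i ∈ J) : Igrav ≤ J := by
  refine sInf_le ⟨?_, ?_, fun r => ?_⟩
  · rw [E1_eq]
    exact Submodule.smul_mem_smul (h _) trivial
  · rw [E2_eq]
    exact add_mem (add_mem (add_mem (add_mem (Submodule.smul_mem_smul (h _) trivial)
      (Submodule.smul_mem_smul (h _) trivial)) (Submodule.smul_mem_smul (h _) trivial))
      (Submodule.smul_mem_smul (h _) trivial)) (Submodule.smul_mem_smul (h _) trivial)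
  · rw [E3_eq]
    exact Submodule.smul_mem_smul (h _) trivial

/-- The 23 linear forms which, together with the quadrics, cut out the origin. -/
def gy {R : Type*} [CommRing R] (x : Finset (Fin 5) → R) : Fin 23 → R :=
  ![x ∅ - x {0, 2, 3, 4}, x {1} - x Finset.univ, x {3} - x {1, 2, 4}, x {0, 1} - x {3, 4},
    x {0, 2} - x {1, 3}, x {0, 4} - x {1, 2}, x {2, 3} - x {0, 1, 4}, x {0, 1, 2} - x {2, 3, 4},
    x {0, 3, 4} - x {1, 2, 3}, x {0}, x {2}, x {4}, x {0, 3}, x {1, 4}, x {2, 4}, x {0, 1, 3},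
    x {0, 2, 3}, x {0, 2, 4}, x {1, 3, 4}, x {0, 1, 2, 3}, x {0, 1, 2, 4}, x {0, 1, 3, 4},
    x {1, 2, 3, 4}]

lemma forall_subset_fin5 {P : Finset (Fin 5) → Prop} (h0 : P ∅) (h1 : P {0}) (h2 : P {1})
    (h3 : P {2}) (h4 : P {3}) (h5 : P {4}) (h01 : P {0, 1}) (h02 : P {0, 2}) (h03 : P {0, 3})
    (h04 : P {0, 4}) (h12 : P {1, 2}) (h13 : P {1, 3}) (h14 : P {1, 4}) (h23 : P {2, 3})
    (h24 : P {2, 4}) (h34 : P {3, 4}) (h012 : P {0, 1, 2}) (h013 : P {0, 1, 3})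
    (h014 : P {0, 1, 4}) (h023 : P {0, 2, 3}) (h024 : P {0, 2, 4}) (h034 : P {0, 3, 4})
    (h123 : P {1, 2, 3}) (h124 : P {1, 2, 4}) (h134 : P {1, 3, 4}) (h234 : P {2, 3, 4})
    (h0123 : P {0, 1, 2, 3}) (h0124 : P {0, 1, 2, 4}) (h0134 : P {0, 1, 3, 4})
    (h0234 : P {0, 2, 3, 4}) (h1234 : P {1, 2, 3, 4}) (hu : P Finset.univ) : ∀ S, P S := by
  intro S
  have hS : S ∈ ({∅, {0}, {1}, {2}, {3}, {4}, {0, 1}, {0, 2}, {0, 3}, {0, 4}, {1, 2}, {1, 3},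
    {1, 4}, {2, 3}, {2, 4}, {3, 4}, {0, 1, 2}, {0, 1, 3}, {0, 1, 4}, {0, 2, 3}, {0, 2, 4},
    {0, 3, 4}, {1, 2, 3}, {1, 2, 4}, {1, 3, 4}, {2, 3, 4}, {0, 1, 2, 3}, {0, 1, 2, 4},
    {0, 1, 3, 4}, {0, 2, 3, 4}, {1, 2, 3, 4}, Finset.univ} : Finset (Finset (Fin 5))) := by
    revert S; decide
  simp only [Finset.mem_insert, Finset.mem_singleton] at hS
  rcases hS with h | h | h | h | h | h | h | h | h | h | h | h | h | h | h | h | h | h | h | h |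
    h | h | h | h | h | h | h | h | h | h | h | h <;> rw [h] <;> assumption

lemma grav_forms_zero {D : Type*} [CommRing D] [IsDomain D] [CharZero D] (x : Finset (Fin 5) → D)
    (hq : ∀ i, gq x i = 0) (hy : ∀ j, gy x j = 0) : ∀ S, x S = 0 := by
  have y0 : x ∅ - x {0, 2, 3, 4} = 0 := hy 0
  have y1 : x {1} - x Finset.univ = 0 := hy 1
  have y2 : x {3} - x {1, 2, 4} = 0 := hy 2
  have y3 : x {0, 1} - x {3, 4} = 0 := hy 3
  have y4 : x {0, 2} - x {1, 3} = 0 := hy 4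
  have y5 : x {0, 4} - x {1, 2} = 0 := hy 5
  have y6 : x {2, 3} - x {0, 1, 4} = 0 := hy 6
  have y7 : x {0, 1, 2} - x {2, 3, 4} = 0 := hy 7
  have y8 : x {0, 3, 4} - x {1, 2, 3} = 0 := hy 8
  have y9 : x {0} = 0 := hy 9
  have y10 : x {2} = 0 := hy 10
  have y11 : x {4} = 0 := hy 11
  have y12 : x {0, 3} = 0 := hy 12
  have y13 : x {1, 4} = 0 := hy 13
  have y14 : x {2, 4} = 0 := hy 14
  have y15 : x {0, 1, 3} = 0 := hy 15
  have y16 : x {0, 2, 3} = 0 := hy 16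
  have y17 : x {0, 2, 4} = 0 := hy 17
  have y18 : x {1, 3, 4} = 0 := hy 18
  have y19 : x {0, 1, 2, 3} = 0 := hy 19
  have y20 : x {0, 1, 2, 4} = 0 := hy 20
  have y21 : x {0, 1, 3, 4} = 0 := hy 21
  have y22 : x {1, 2, 3, 4} = 0 := hy 22
  rw [sub_eq_zero] at y0 y1 y2 y3 y4 y5 y6 y7 y8
  have q0 := hq 0
  have q1 := hq 1
  have q2 := hq 2
  have q3 := hq 3
  have q4 := hq 4
  have q5 := hq 5
  have q6 := hq 6
  have q7 := hq 7
  have q8 := hq 8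
  have q9 := hq 9
  have q10 := hq 10
  simp only [gq, Matrix.cons_val, y0, y1, y2, y3, y4, y5, y6, y7, y8, y9, y10, y11, y12, y13, y14,
    y15, y16, y17, y18, y19, y20, y21, y22] at q0 q1 q2 q3 q4 q5 q6 q7 q8 q9 q10
  have sq : ∀ z : D, 2 * (z * z) = 0 → z = 0 := by
    intro z hz
    rcases mul_eq_zero.mp hz with h | h
    · exact absurd h two_ne_zero
    · exact mul_self_eq_zero.mp h
  have z5 : x {1, 2} = 0 := by
    apply sq
    linear_combination q4
  simp only [z5] at q0 q1 q2 q3 q4 q5 q6 q7 q8 q9 q10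
  have z7 : x {2, 3, 4} = 0 := by
    apply sq
    linear_combination q8
  simp only [z7] at q0 q1 q2 q3 q4 q5 q6 q7 q8 q9 q10
  have z8 : x {0, 1, 4} = 0 := by
    apply sq
    linear_combination -2 * q0
  simp only [z8] at q0 q1 q2 q3 q4 q5 q6 q7 q8 q9 q10
  have z1 : x Finset.univ = 0 := by
    apply sq
    linear_combination -q7
  simp only [z1] at q0 q1 q2 q3 q4 q5 q6 q7 q8 q9 q10
  have z4 : x {1, 2, 4} = 0 := by
    apply sq
    linear_combination -q1
  simp only [z4] at q0 q1 q2 q3 q4 q5 q6 q7 q8 q9 q10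
  have z3 : x {1, 3} = 0 := by
    apply sq
    linear_combination -q5
  simp only [z3] at q0 q1 q2 q3 q4 q5 q6 q7 q8 q9 q10
  have z0 : x {3, 4} = 0 := by
    apply sq
    linear_combination q3
  simp only [z0] at q0 q1 q2 q3 q4 q5 q6 q7 q8 q9 q10
  have z6 : x {0, 2, 3, 4} = 0 := by
    apply sq
    linear_combination -q2
  simp only [z6] at q0 q1 q2 q3 q4 q5 q6 q7 q8 q9 q10
  have z2 : x {1, 2, 3} = 0 := by
    apply sq
    linear_combination q9
  rw [z6] at y0
  rw [z1] at y1
  rw [z4] at y2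
  rw [z0] at y3
  rw [z3] at y4
  rw [z5] at y5
  rw [z8] at y6
  rw [z7] at y7
  rw [z2] at y8
  apply forall_subset_fin5 <;> assumption

lemma map_gq {R S : Type*} [CommRing R] [CommRing S] (f : R →+* S) (x : Finset (Fin 5) → R)
    (i : Fin 11) : f (gq x i) = gq (fun T => f (x T)) i := by
  have h2 : f 2 = 2 := map_ofNat f 2
  fin_cases i <;> simp [gq, h2]

lemma map_gy {R S : Type*} [CommRing R] [CommRing S] (f : R →+* S) (x : Finset (Fin 5) → R)
    (i : Fin 23) : f (gy x i) = gy (fun T => f (x T)) i := by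
  fin_cases i <;> simp [gy]

section Upper
open MvPolynomial

lemma gq_mem_addSubgroup {R : Type*} [CommRing R] (x : Finset (Fin 5) → R) (M : AddSubgroup R)
    (hm : ∀ S T, x S * x T ∈ M) (i : Fin 11) : gq x i ∈ M := by
  have h2 : ∀ S T, 2 * (x S * x T) ∈ M := fun S T => by
    rw [two_mul]; exact M.add_mem (hm S T) (hm S T)
  have h2' : ∀ S T, -2 * (x S * x T) ∈ M := fun S T => by
    rw [neg_mul]; exact M.neg_mem (h2 S T)
  fin_cases i <;>
  · simp only [gq, Fin.zero_eta, Fin.mk_one, Fin.reduceFinMk, Fin.isValue, Matrix.cons_val]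
    repeat first
      | exact hm _ _
      | exact h2 _ _
      | exact h2' _ _
      | apply M.add_mem
      | apply M.sub_mem

lemma gq_hom (i : Fin 11) : (gq (X : _ → R32) i).IsHomogeneous 2 :=
  gq_mem_addSubgroup X (homogeneousSubmodule (Finset (Fin 5)) ℂ 2).toAddSubgroup
    (fun S T => (isHomogeneous_X ℂ S).mul (isHomogeneous_X ℂ T)) i

lemma gy_hom (i : Fin 23) : (gy (X : _ → R32) i).IsHomogeneous 1 := by
  have hm : ∀ S : Finset (Fin 5), (X S : R32).IsHomogeneous 1 := fun S => isHomogeneous_X ℂ S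
  fin_cases i <;>
  · simp only [gy, Fin.zero_eta, Fin.mk_one, Fin.reduceFinMk, Fin.isValue, Matrix.cons_val]
    first
      | exact hm _
      | exact (hm _).sub (hm _)

theorem grav_upper : ringKrullDim (R32 ⧸ Igrav) ≤ 23 := by
  refine grav_dim_le (Ideal.Quotient.mk Igrav) Ideal.Quotient.mk_surjective
    (Set.range (gq (X : _ → R32))) ?_ 23 (gy (X : _ → R32)) gy_hom ?_ ?_
  · rintro _ ⟨i, rfl⟩
    exact gq_hom i
  · intro p hp
    rw [Ideal.Quotient.eq_zero_iff_mem]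
    refine (Ideal.span_le.mpr ?_) hp
    rintro _ ⟨i, rfl⟩
    exact gq_mem_Igrav i
  · intro S
    rw [Ideal.radical_eq_sInf, Submodule.mem_sInf]
    rintro (P : Ideal R32) ⟨hP, hPp⟩
    have hPp' : P.IsPrime := hPp
    have : CharZero (R32 ⧸ P) := charZero_of_injective_algebraMap
      (algebraMap ℂ (R32 ⧸ P)).injective
    rw [← Ideal.Quotient.eq_zero_iff_mem]
    refine grav_forms_zero (fun T => Ideal.Quotient.mk P (X T)) (fun i => ?_) (fun j => ?_) S
    · rw [← map_gq, Ideal.Quotient.eq_zero_iff_mem]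
      exact hP (Ideal.mem_sup_left (Ideal.subset_span (Set.mem_range_self i)))
    · rw [← map_gy, Ideal.Quotient.eq_zero_iff_mem]
      exact hP (Ideal.mem_sup_right (Ideal.subset_span (Set.mem_range_self j)))

end Upper

/-- A 23-parameter family of gravitational spinors. -/
def gp {R : Type*} [CommRing R] (v : Fin 23 → R) (S : Finset (Fin 5)) : R :=
  match decide (0 ∈ S), decide (1 ∈ S), decide (2 ∈ S), decide (3 ∈ S), decide (4 ∈ S) with
  | false, false, false, false, false =>
      v 22
  | true, false, false, false, false =>
      v 22 * (v 0)
  | false, true, false, false, false =>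
      v 22 * (v 1)
  | false, false, true, false, false =>
      v 22 * (v 2)
  | false, false, false, true, false =>
      v 22 * (v 3)
  | false, false, false, false, true =>
      v 22 * (v 4)
  | true, true, false, false, false =>
      v 22 * (v 5)
  | true, false, true, false, false =>
      v 22 * (v 6)
  | true, false, false, true, false =>
      v 22 * (v 7)
  | true, false, false, false, true =>
      v 22 * (v 8)
  | false, true, true, false, false =>
      v 22 * (v 9)
  | false, true, false, true, false =>
      v 22 * (v 10)
  | false, true, false, false, true =>
      v 22 * (v 11)
  | false, false, true, true, false =>
      v 22 * (v 12)
  | false, false, true, false, true =>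
      v 22 * (v 13)
  | false, false, false, true, true =>
      v 22 * (v 14)
  | true, true, true, false, false =>
      v 22 * (v 21 + v 0 * v 9 - v 1 * v 6 + v 2 * v 5)
  | true, true, false, true, false =>
      v 22 * (v 21 * v 17 + v 0 * v 10 - v 1 * v 7 + v 3 * v 5)
  | true, true, false, false, true =>
      v 22 * (v 21 * v 20 + v 0 * v 11 - v 1 * v 8 + v 4 * v 5)
  | true, false, true, true, false =>
      v 22 * (-(v 21 * v 16) + v 0 * v 12 - v 2 * v 7 + v 3 * v 6)
  | true, false, true, false, true =>
      v 22 * (-(v 21 * v 19) + v 0 * v 13 - v 2 * v 8 + v 4 * v 6)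
  | true, false, false, true, true =>
      v 22 * (v 21 * (v 16 * v 20 - v 17 * v 19) + v 0 * v 14 - v 3 * v 8 + v 4 * v 7)
  | false, true, true, true, false =>
      v 22 * (v 21 * v 15 + v 1 * v 12 - v 2 * v 10 + v 3 * v 9)
  | false, true, true, false, true =>
      v 22 * (v 21 * v 18 + v 1 * v 13 - v 2 * v 11 + v 4 * v 9)
  | false, true, false, true, true =>
      v 22 * (-(v 21 * (v 15 * v 20 - v 18 * v 17)) + v 1 * v 14 - v 3 * v 11 + v 4 * v 10)
  | false, false, true, true, true =>
      v 22 * (v 21 * (v 15 * v 19 - v 18 * v 16) + v 2 * v 14 - v 3 * v 13 + v 4 * v 12)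
  | true, true, true, true, false =>
      v 22 * (v 5 * v 12 - v 6 * v 10 + v 7 * v 9 - v 0 * (v 21 * v 15) + v 1 * (-(v 21 * v 16))
      - v 2 * (v 21 * v 17) + v 3 * (v 21))
  | true, true, true, false, true =>
      v 22 * (v 5 * v 13 - v 6 * v 11 + v 8 * v 9 - v 0 * (v 21 * v 18) + v 1 * (-(v 21 * v 19))
      - v 2 * (v 21 * v 20) + v 4 * (v 21))
  | true, true, false, true, true =>
      v 22 * (v 5 * v 14 - v 7 * v 11 + v 8 * v 10 - v 0 * (-(v 21 * (v 15 * v 20 - v 18 * v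
      17))) + v 1 * (v 21 * (v 16 * v 20 - v 17 * v 19)) - v 3 * (v 21 * v 20) + v 4 * (v 21 * v
      17))
  | true, false, true, true, true =>
      v 22 * (v 6 * v 14 - v 7 * v 13 + v 8 * v 12 - v 0 * (v 21 * (v 15 * v 19 - v 18 * v 16))
      + v 2 * (v 21 * (v 16 * v 20 - v 17 * v 19)) - v 3 * (-(v 21 * v 19)) + v 4 * (-(v 21 * v
      16)))
  | false, true, true, true, true =>
      v 22 * (v 9 * v 14 - v 10 * v 13 + v 11 * v 12 - v 1 * (v 21 * (v 15 * v 19 - v 18 * v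
      16)) + v 2 * (-(v 21 * (v 15 * v 20 - v 18 * v 17))) - v 3 * (v 21 * v 18) + v 4 * (v 21 *
      v 15))
  | true, true, true, true, true =>
      v 22 * (v 5 * (v 21 * (v 15 * v 19 - v 18 * v 16)) - v 6 * (-(v 21 * (v 15 * v 20 - v 18 *
      v 17))) + v 7 * (v 21 * v 18) - v 8 * (v 21 * v 15) + v 9 * (v 21 * (v 16 * v 20 - v 17 *
      v 19)) - v 10 * (-(v 21 * v 19)) + v 11 * (-(v 21 * v 16)) + v 12 * (v 21 * v 20) - v 13 *
      (v 21 * v 17) + v 14 * (v 21) + v 0 * (v 9 * v 14 - v 10 * v 13 + v 11 * v 12) - v 1 * (v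
      6 * v 14 - v 7 * v 13 + v 8 * v 12) + v 2 * (v 5 * v 14 - v 7 * v 11 + v 8 * v 10) - v 3 *
      (v 5 * v 13 - v 6 * v 11 + v 8 * v 9) + v 4 * (v 5 * v 12 - v 6 * v 10 + v 7 * v 9))

section Param
variable {R : Type*} [CommRing R] (v : Fin 23 → R)

lemma gp_e : gp v ∅ =
      v 22 := rfl

lemma gp_0 : gp v {0} =
      v 22 * (v 0) := rfl

lemma gp_1 : gp v {1} =
      v 22 * (v 1) := rfl

lemma gp_2 : gp v {2} =
      v 22 * (v 2) := rfl

lemma gp_3 : gp v {3} =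
      v 22 * (v 3) := rfl

lemma gp_4 : gp v {4} =
      v 22 * (v 4) := rfl

lemma gp_01 : gp v {0, 1} =
      v 22 * (v 5) := rfl

lemma gp_02 : gp v {0, 2} =
      v 22 * (v 6) := rfl

lemma gp_03 : gp v {0, 3} =
      v 22 * (v 7) := rfl

lemma gp_04 : gp v {0, 4} =
      v 22 * (v 8) := rfl

lemma gp_12 : gp v {1, 2} =
      v 22 * (v 9) := rfl

lemma gp_13 : gp v {1, 3} =
      v 22 * (v 10) := rfl

lemma gp_14 : gp v {1, 4} =
      v 22 * (v 11) := rfl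

lemma gp_23 : gp v {2, 3} =
      v 22 * (v 12) := rfl

lemma gp_24 : gp v {2, 4} =
      v 22 * (v 13) := rfl

lemma gp_34 : gp v {3, 4} =
      v 22 * (v 14) := rfl

lemma gp_012 : gp v {0, 1, 2} =
      v 22 * (v 21 + v 0 * v 9 - v 1 * v 6 + v 2 * v 5) := rfl

lemma gp_013 : gp v {0, 1, 3} =
      v 22 * (v 21 * v 17 + v 0 * v 10 - v 1 * v 7 + v 3 * v 5) := rfl

lemma gp_014 : gp v {0, 1, 4} =
      v 22 * (v 21 * v 20 + v 0 * v 11 - v 1 * v 8 + v 4 * v 5) := rfl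

lemma gp_023 : gp v {0, 2, 3} =
      v 22 * (-(v 21 * v 16) + v 0 * v 12 - v 2 * v 7 + v 3 * v 6) := rfl

lemma gp_024 : gp v {0, 2, 4} =
      v 22 * (-(v 21 * v 19) + v 0 * v 13 - v 2 * v 8 + v 4 * v 6) := rfl

lemma gp_034 : gp v {0, 3, 4} =
      v 22 * (v 21 * (v 16 * v 20 - v 17 * v 19) + v 0 * v 14 - v 3 * v 8 + v 4 * v 7) := rfl

lemma gp_123 : gp v {1, 2, 3} =
      v 22 * (v 21 * v 15 + v 1 * v 12 - v 2 * v 10 + v 3 * v 9) := rfl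

lemma gp_124 : gp v {1, 2, 4} =
      v 22 * (v 21 * v 18 + v 1 * v 13 - v 2 * v 11 + v 4 * v 9) := rfl

lemma gp_134 : gp v {1, 3, 4} =
      v 22 * (-(v 21 * (v 15 * v 20 - v 18 * v 17)) + v 1 * v 14 - v 3 * v 11 + v 4 * v 10) := rfl

lemma gp_234 : gp v {2, 3, 4} =
      v 22 * (v 21 * (v 15 * v 19 - v 18 * v 16) + v 2 * v 14 - v 3 * v 13 + v 4 * v 12) := rfl

lemma gp_0123 : gp v {0, 1, 2, 3} =
      v 22 * (v 5 * v 12 - v 6 * v 10 + v 7 * v 9 - v 0 * (v 21 * v 15) + v 1 * (-(v 21 * v 16))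
      - v 2 * (v 21 * v 17) + v 3 * (v 21)) := rfl

lemma gp_0124 : gp v {0, 1, 2, 4} =
      v 22 * (v 5 * v 13 - v 6 * v 11 + v 8 * v 9 - v 0 * (v 21 * v 18) + v 1 * (-(v 21 * v 19))
      - v 2 * (v 21 * v 20) + v 4 * (v 21)) := rfl

lemma gp_0134 : gp v {0, 1, 3, 4} =
      v 22 * (v 5 * v 14 - v 7 * v 11 + v 8 * v 10 - v 0 * (-(v 21 * (v 15 * v 20 - v 18 * v
      17))) + v 1 * (v 21 * (v 16 * v 20 - v 17 * v 19)) - v 3 * (v 21 * v 20) + v 4 * (v 21 * v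
      17)) := rfl

lemma gp_0234 : gp v {0, 2, 3, 4} =
      v 22 * (v 6 * v 14 - v 7 * v 13 + v 8 * v 12 - v 0 * (v 21 * (v 15 * v 19 - v 18 * v 16))
      + v 2 * (v 21 * (v 16 * v 20 - v 17 * v 19)) - v 3 * (-(v 21 * v 19)) + v 4 * (-(v 21 * v
      16))) := rfl

lemma gp_1234 : gp v {1, 2, 3, 4} =
      v 22 * (v 9 * v 14 - v 10 * v 13 + v 11 * v 12 - v 1 * (v 21 * (v 15 * v 19 - v 18 * v
      16)) + v 2 * (-(v 21 * (v 15 * v 20 - v 18 * v 17))) - v 3 * (v 21 * v 18) + v 4 * (v 21 *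
      v 15)) := rfl

lemma gp_01234 : gp v Finset.univ =
      v 22 * (v 5 * (v 21 * (v 15 * v 19 - v 18 * v 16)) - v 6 * (-(v 21 * (v 15 * v 20 - v 18 *
      v 17))) + v 7 * (v 21 * v 18) - v 8 * (v 21 * v 15) + v 9 * (v 21 * (v 16 * v 20 - v 17 *
      v 19)) - v 10 * (-(v 21 * v 19)) + v 11 * (-(v 21 * v 16)) + v 12 * (v 21 * v 20) - v 13 *
      (v 21 * v 17) + v 14 * (v 21) + v 0 * (v 9 * v 14 - v 10 * v 13 + v 11 * v 12) - v 1 * (v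
      6 * v 14 - v 7 * v 13 + v 8 * v 12) + v 2 * (v 5 * v 14 - v 7 * v 11 + v 8 * v 10) - v 3 *
      (v 5 * v 13 - v 6 * v 11 + v 8 * v 9) + v 4 * (v 5 * v 12 - v 6 * v 10 + v 7 * v 9)) := rfl

end Param

lemma map_gp {R S : Type*} [CommRing R] [CommRing S] (f : R →+* S) (v : Fin 23 → R)
    (T : Finset (Fin 5)) : f (gp v T) = gp (fun j => f (v j)) T := by
  revert T
  apply forall_subset_fin5 <;>
  simp only [gp_e, gp_0, gp_1, gp_2, gp_3, gp_4, gp_01, gp_02, gp_03, gp_04, gp_12, gp_13, gp_14,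
    gp_23, gp_24, gp_34, gp_012, gp_013, gp_014, gp_023, gp_024, gp_034, gp_123, gp_124,
    gp_134, gp_234, gp_0123, gp_0124, gp_0134, gp_0234, gp_1234, gp_01234,
    map_mul, map_add, map_sub, map_neg]

lemma gq_gp {R : Type*} [CommRing R] (v : Fin 23 → R) (i : Fin 11) : gq (gp v) i = 0 := by
  fin_cases i <;>
  · simp only [gq, Fin.zero_eta, Fin.mk_one, Fin.reduceFinMk, Fin.isValue, Matrix.cons_val,
    gp_e, gp_0, gp_1, gp_2, gp_3, gp_4, gp_01, gp_02, gp_03, gp_04, gp_12, gp_13, gp_14,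
    gp_23, gp_24, gp_34, gp_012, gp_013, gp_014, gp_023, gp_024, gp_034, gp_123, gp_124,
    gp_134, gp_234, gp_0123, gp_0124, gp_0134, gp_0234, gp_1234, gp_01234]
    ring

/-- Coordinates which distinguish consecutive primes of the chain. -/
def gw : Fin 23 → Finset (Fin 5) :=
  ![{0}, {1}, {2}, {3}, {4}, {0, 1}, {0, 2}, {0, 3}, {0, 4}, {1, 2}, {1, 3}, {1, 4}, {2, 3},
    {2, 4}, {3, 4}, {1, 2, 3}, {0, 2, 3}, {0, 1, 3}, {1, 2, 4}, {0, 2, 4}, {0, 1, 4}, {0,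
    1, 2}, ∅]

section Lower
open MvPolynomial

/-- The `k`-th degeneration of the parameters. -/
def gv (k : ℕ) (j : Fin 23) : MvPolynomial (Fin 23) ℂ := if (j : ℕ) < k then 0 else X j

lemma gv_zero (k : ℕ) (j : Fin 23) (h : (j : ℕ) < k) : gv k j = 0 := if_pos h

lemma gv_ne (k : ℕ) (j : Fin 23) (h : k ≤ (j : ℕ)) : gv k j ≠ 0 := by
  rw [gv, if_neg (not_lt.mpr h)]
  exact X_ne_zero j

lemma gw_zero {R : Type*} [CommRing R] (v : Fin 23 → R) (k : Fin 23)
    (h : ∀ j, j ≤ k → v j = 0) : gp v (gw k) = 0 := by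
  fin_cases k <;>
  · simp only [Fin.zero_eta, Fin.mk_one, Fin.reduceFinMk, Fin.isValue] at h
    simp only [gw, Fin.zero_eta, Fin.mk_one, Fin.reduceFinMk, Fin.isValue, Matrix.cons_val,
    gp_e, gp_0, gp_1, gp_2, gp_3, gp_4, gp_01, gp_02, gp_03, gp_04, gp_12, gp_13, gp_14,
    gp_23, gp_24, gp_34, gp_012, gp_013, gp_014, gp_023, gp_024, gp_034, gp_123, gp_124,
    gp_134, gp_234, gp_0123, gp_0124, gp_0134, gp_0234, gp_1234, gp_01234,
    h, Fin.reduceLE, le_refl, mul_zero, zero_mul, neg_zero, add_zero, sub_zero]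

lemma gw_ne {R : Type*} [CommRing R] [IsDomain R] (v : Fin 23 → R) (k : Fin 23)
    (h : ∀ j, j < k → v j = 0) (h' : ∀ j, k ≤ j → v j ≠ 0) : gp v (gw k) ≠ 0 := by
  have hs := h' 22 (Fin.le_last k)
  fin_cases k <;>
  · simp only [Fin.zero_eta, Fin.mk_one, Fin.reduceFinMk, Fin.isValue] at h h'
    simp only [gw, Fin.zero_eta, Fin.mk_one, Fin.reduceFinMk, Fin.isValue, Matrix.cons_val,
    gp_e, gp_0, gp_1, gp_2, gp_3, gp_4, gp_01, gp_02, gp_03, gp_04, gp_12, gp_13, gp_14,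
    gp_23, gp_24, gp_34, gp_012, gp_013, gp_014, gp_023, gp_024, gp_034, gp_123, gp_124,
    gp_134, gp_234, gp_0123, gp_0124, gp_0134, gp_0234, gp_1234, gp_01234,
    h, h', hs, Fin.reduceLT, Fin.reduceLE, le_refl, mul_zero, zero_mul, neg_zero, add_zero, sub_zero, zero_add,
    ne_eq, mul_eq_zero, neg_eq_zero, or_self, not_false_eq_true]

/-- The `k`-th parametrization, as a ring homomorphism. -/
def gphi (k : ℕ) : R32 →+* MvPolynomial (Fin 23) ℂ := (aeval (gp (gv k)) : R32 →ₐ[ℂ] _).toRingHom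

lemma gphi_X (k : ℕ) (S : Finset (Fin 5)) : gphi k (X S) = gp (gv k) S :=
  aeval_X (gp (gv k)) S

lemma gphi_Igrav (k : ℕ) : ∀ p ∈ Igrav, gphi k p = 0 := by
  have h : Igrav ≤ RingHom.ker (gphi k) := by
    apply Igrav_le
    intro i
    rw [RingHom.mem_ker, map_gq]
    simp_rw [gphi_X]
    exact gq_gp _ i
  exact fun p hp => h hp

lemma gphi_succ (k : ℕ) (p : R32) : gphi (k + 1) p = aeval (gv (k + 1)) (gphi k p) := by
  have : (aeval (gp (gv (k + 1))) : R32 →ₐ[ℂ] MvPolynomial (Fin 23) ℂ) =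
      (aeval (gv (k + 1))).comp (aeval (gp (gv k))) := by
    apply MvPolynomial.algHom_ext
    intro S
    rw [AlgHom.comp_apply, aeval_X, aeval_X]
    refine Eq.trans ?_ (map_gp (aeval (gv (k + 1)) : MvPolynomial (Fin 23) ℂ →ₐ[ℂ]
      MvPolynomial (Fin 23) ℂ).toRingHom (gv k) S).symm
    congr 1
    funext j
    show gv (k + 1) j = aeval (gv (k + 1)) (gv k j)
    by_cases h : (j : ℕ) < k
    · rw [gv_zero k j h, gv_zero (k + 1) j (by omega), map_zero]
    · conv_rhs => rw [gv, if_neg h, aeval_X]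
  exact DFunLike.congr_fun this p

/-- The chain of primes. -/
def gprime (k : ℕ) : PrimeSpectrum (R32 ⧸ Igrav) :=
  ⟨RingHom.ker (Ideal.Quotient.lift Igrav (gphi k) (gphi_Igrav k)), RingHom.ker_isPrime _⟩

lemma mk_mem_gprime (k : ℕ) (p : R32) :
    Ideal.Quotient.mk Igrav p ∈ (gprime k).asIdeal ↔ gphi k p = 0 := by
  unfold gprime
  rw [RingHom.mem_ker, Ideal.Quotient.lift_mk]

lemma gprime_lt (k : Fin 23) : gprime k < gprime (k + 1) := by
  rw [lt_iff_le_not_ge]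
  constructor
  · intro z hz
    obtain ⟨p, rfl⟩ := Ideal.Quotient.mk_surjective z
    rw [mk_mem_gprime] at hz ⊢
    rw [gphi_succ, hz, map_zero]
  · intro h
    have h1 : Ideal.Quotient.mk Igrav (X (gw k)) ∈ (gprime (k + 1)).asIdeal := by
      rw [mk_mem_gprime, gphi_X]
      exact gw_zero _ _ fun j hj => gv_zero _ _ (by have : (j : ℕ) ≤ k := hj; omega)
    have h2 := h h1
    rw [mk_mem_gprime, gphi_X] at h2
    exact gw_ne _ _ (fun j hj => gv_zero _ _ hj) (fun j hj => gv_ne _ _ hj) h2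

theorem grav_lower : 23 ≤ ringKrullDim (R32 ⧸ Igrav) := by
  let s : LTSeries (PrimeSpectrum (R32 ⧸ Igrav)) :=
    ⟨23, fun i => gprime i, fun i => gprime_lt i⟩
  exact Order.LTSeries.length_le_krullDim s

end Lower

/-- the ring `A = R/I` has Krull dimension 23, i.e. `X = Proj A` has
dimension 22. -/
theorem gravSpinor_krullDim : ringKrullDim (R32 ⧸ Igrav) = 23 := 
  le_antisymm grav_upper grav_lower
end
end
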